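/- arXiv:1706.08134 — 2 statements merged into one kernel-verified Lean document; each statement's English description precedes it below -/
import Mathlib

section
/- The restricted size Ramsey number r*(P_3, C_9) equals 17: there exists a simple graph F on 9 vertices with 17 edges such that F → (P_3, C_9), and every simple graph on 9 vertices with fewer than 17 edges fails to arrow (P_3, C_9). -/
open SimpleGraph

/-- `F` contains a copy of `G` (an injective graph homomorphism from `G` to `F`). -/
def Contains {α β : Type*} (F : SimpleGraph α) (G : SimpleGraph β) : Prop :=
  ∃ f : G →g F, Function.Injective f

/-- `F → (G, H)`: for every red/blue coloring of the edges of `F` (given by the spanning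
subgraph `R ≤ F` of red edges, the other edges of `F` being blue), there is a red copy of `G`
or a blue copy of `H`. -/
def Arrows {α β γ : Type*} (F : SimpleGraph α) (G : SimpleGraph β) (H : SimpleGraph γ) : Prop :=
  ∀ R : SimpleGraph α, R ≤ F → Contains R G ∨ Contains (F \ R) H


/-! ## The upper bound: an explicit graph with 17 edges -/

/-- Edges of the witness graph. -/
def wEdges : List (Fin 9 × Fin 9) :=
  [(0, 1), (0, 5), (0, 8), (1, 2), (1, 4), (1, 7), (2, 3), (2, 7), (2, 8), (3, 4), (3, 6), (4, 5),
   (4, 8), (5, 6), (5, 7), (6, 7), (7, 8)]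

/-- The witness graph. -/
def wGraph : SimpleGraph (Fin 9) where
  Adj i j := (i, j) ∈ wEdges ∨ (j, i) ∈ wEdges
  symm := ⟨fun _ _ h => h.symm⟩
  loopless := ⟨by decide⟩

instance : DecidableRel wGraph.Adj := fun i j =>
  inferInstanceAs (Decidable ((i, j) ∈ wEdges ∨ (j, i) ∈ wEdges))

/-- Hamiltonian cycles of the witness graph. -/
def wCycles : List (Fin 9 → Fin 9) :=
  [![0, 1, 7, 6, 5, 4, 3, 2, 8], ![0, 5, 7, 6, 3, 2, 1, 4, 8], ![0, 1, 7, 2, 8, 4, 3, 6, 5],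
   ![0, 1, 2, 3, 4, 8, 7, 6, 5], ![0, 1, 4, 5, 6, 3, 2, 7, 8], ![0, 5, 4, 3, 6, 7, 1, 2, 8],
   ![0, 1, 7, 6, 3, 2, 8, 4, 5], ![0, 5, 6, 3, 4, 1, 2, 7, 8], ![0, 5, 6, 7, 1, 4, 3, 2, 8],
   ![0, 1, 2, 7, 5, 6, 3, 4, 8], ![0, 1, 2, 8, 7, 6, 3, 4, 5], ![0, 1, 2, 3, 4, 5, 6, 7, 8],
   ![0, 5, 6, 3, 2, 7, 1, 4, 8], ![0, 1, 4, 5, 7, 6, 3, 2, 8], ![0, 1, 4, 3, 6, 5, 7, 2, 8],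
   ![0, 1, 4, 8, 7, 2, 3, 6, 5], ![0, 5, 6, 7, 1, 2, 3, 4, 8], ![0, 1, 4, 3, 2, 8, 7, 6, 5],
   ![0, 1, 2, 3, 6, 7, 8, 4, 5], ![0, 5, 6, 3, 4, 1, 7, 2, 8], ![0, 1, 2, 8, 4, 3, 6, 7, 5]]

/-- Every matching consisting of `M` and some of the remaining edges misses a listed cycle. -/
def wCheck : List (Fin 9 × Fin 9) → List (Fin 9 × Fin 9) → Bool
  | [], M => wCycles.any fun c => decide (∀ i : Fin 9, (c i, c (i + 1)) ∉ M ∧ (c (i + 1), c i) ∉ M)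
  | e :: es, M => wCheck es M &&
      (M.any (fun e' => e.1 == e'.1 || e.1 == e'.2 || e.2 == e'.1 || e.2 == e'.2) ||
        wCheck es (e :: M))

theorem wCheck_true : wCheck wEdges [] = true := by decide +kernel

theorem wCycles_ok' : (wCycles.all fun c => decide ((∀ i j : Fin 9, c i = c j → i = j) ∧
    ∀ i, ((c i, c (i + 1)) ∈ wEdges ∨ (c (i + 1), c i) ∈ wEdges))) = true := by
  decide +kernel

theorem wCycles_ok (c : Fin 9 → Fin 9) (hc : c ∈ wCycles) :
    Function.Injective c ∧ ∀ i, wGraph.Adj (c i) (c (i + 1)) := by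
  have h := List.all_eq_true.1 wCycles_ok' c hc
  have h := of_decide_eq_true h
  exact ⟨fun i j => h.1 i j, h.2⟩

theorem wGraph_card : wGraph.edgeSet.ncard = 17 := by
  rw [Set.ncard_eq_toFinset_card']
  decide +kernel

/-- A graph without a copy of `P_3` is a matching. -/
theorem matching_of_not_contains {V : Type*} (R : SimpleGraph V)
    (h : ¬ Contains R (pathGraph 3)) (a b c : V) (hb : R.Adj a b) (hc : R.Adj a c) : b = c := by
  by_contra hne
  apply h
  have hab := hb.ne
  have hac := hc.ne
  refine ⟨⟨![b, a, c], ?_⟩, ?_⟩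
  · intro i j hij
    rw [pathGraph_adj] at hij
    fin_cases i <;> fin_cases j <;> simp at hij ⊢ <;> first | exact hb | exact hc | exact hb.symm | exact hc.symm
  · intro i j hij
    fin_cases i <;> fin_cases j <;> simp_all

theorem not_contains_of_matching {V : Type*} (R : SimpleGraph V)
    (h : ∀ a b c : V, R.Adj a b → R.Adj a c → b = c) : ¬ Contains R (pathGraph 3) := by
  rintro ⟨f, hf⟩
  have h1 : R.Adj (f 1) (f 0) := f.map_rel (by rw [pathGraph_adj]; decide)
  have h2 : R.Adj (f 1) (f 2) := f.map_rel (by rw [pathGraph_adj]; decide)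
  exact absurd (hf (h _ _ _ h1 h2)) (by decide)

theorem wCheck_sound (R : SimpleGraph (Fin 9))
    (hm : ∀ a b c, R.Adj a b → R.Adj a c → b = c) :
    ∀ (es M : List (Fin 9 × Fin 9)), wCheck es M = true →
      (∀ e ∈ M, R.Adj e.1 e.2) →
      (∀ i j, R.Adj i j → (i, j) ∈ M ∨ (j, i) ∈ M ∨ (i, j) ∈ es ∨ (j, i) ∈ es) →
      ∃ c ∈ wCycles, ∀ i, ¬ R.Adj (c i) (c (i + 1)) := by
  intro es
  induction es with
  | nil =>
    intro M h _ hR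
    simp only [wCheck, List.any_eq_true, decide_eq_true_eq] at h
    obtain ⟨c, hc, h⟩ := h
    refine ⟨c, hc, fun i hi => ?_⟩
    have := hR _ _ hi
    have := h i
    simp_all
  | cons e es ih =>
    intro M h hM hR
    simp only [wCheck, Bool.and_eq_true, Bool.or_eq_true] at h
    obtain ⟨h1, h2⟩ := h
    obtain ⟨a, b⟩ := e
    by_cases hab : R.Adj a b
    · rcases h2 with h2 | h2
      · rw [List.any_eq_true] at h2
        obtain ⟨⟨a', b'⟩, hmem, h2⟩ := h2
        have hab' := hM _ hmem
        simp only [Bool.or_eq_true, beq_iff_eq] at h2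
        have hin : (a, b) ∈ M ∨ (b, a) ∈ M := by
          rcases h2 with ((rfl | rfl) | rfl) | rfl
          · obtain rfl := hm _ _ _ hab hab'
            exact Or.inl hmem
          · obtain rfl := hm _ _ _ hab hab'.symm
            exact Or.inr hmem
          · obtain rfl := hm _ _ _ hab.symm hab'
            exact Or.inr hmem
          · obtain rfl := hm _ _ _ hab.symm hab'.symm
            exact Or.inl hmem
        refine ih M h1 hM fun i j hij => ?_
        have := hR i j hij
        simp only [List.mem_cons, Prod.mk.injEq] at this
        grind
      · refine ih _ h2 ?_ fun i j hij => ?_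
        · intro e he
          rcases List.mem_cons.1 he with rfl | he
          · exact hab
          · exact hM e he
        · have := hR i j hij
          simp only [List.mem_cons, Prod.mk.injEq] at this ⊢
          tauto
    · refine ih M h1 hM fun i j hij => ?_
      have := hR i j hij
      have hji := hij.symm
      simp only [List.mem_cons, Prod.mk.injEq] at this
      rcases this with h | h | (⟨rfl, rfl⟩ | h) | (⟨rfl, rfl⟩ | h)
      · exact Or.inl h
      · exact Or.inr (Or.inl h)
      · exact absurd hij hab
      · exact Or.inr (Or.inr (Or.inl h))
      · exact absurd hji hab
      · exact Or.inr (Or.inr (Or.inr h))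

theorem wGraph_arrows : Arrows wGraph (pathGraph 3) (cycleGraph 9) := by
  intro R hR
  by_cases h : Contains R (pathGraph 3)
  · exact Or.inl h
  right
  have hm := matching_of_not_contains R h
  obtain ⟨c, hc, hcR⟩ := wCheck_sound R hm wEdges [] wCheck_true (by simp)
    (fun i j hij => Or.inr (Or.inr (hR hij)))
  obtain ⟨hinj, hadj⟩ := wCycles_ok c hc
  have key : ∀ i, (wGraph \ R).Adj (c i) (c (i + 1)) := fun i => ⟨hadj i, hcR i⟩
  refine ⟨⟨c, ?_⟩, hinj⟩
  intro i j hij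
  rw [cycleGraph_adj] at hij
  rcases hij with hij | hij
  · have : i = j + 1 := by rw [← hij]; abel
    rw [this]; exact (key j).symm
  · have : j = i + 1 := by rw [← hij]; abel
    rw [this]; exact key i

/-! ## The lower bound: computational part

Graphs on `{0, …, 8}` are coded by natural numbers: bit `9 * i + j` says whether `i` and `j` are
adjacent. -/

/-- Bit test that the kernel evaluates quickly. -/
def tb (m n : Nat) : Bool := Nat.beq (Nat.land (Nat.shiftRight m n) 1) 1

/-- `force n k = k n`, but the kernel evaluates `n` first. -/
noncomputable def force {α : Type} (n : Nat) (k : Nat → α) : α :=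
  Nat.rec (motive := fun _ => α) (k 0) (fun m _ => k m) (Nat.add n 1)

/-- The code of the edge `ij`. -/
def eb (i j : Nat) : Nat :=
  Nat.lor (Nat.pow 2 (Nat.add (Nat.mul 9 i) j)) (Nat.pow 2 (Nat.add (Nat.mul 9 j) i))

/-- Does some bit of `r` (starting with the highest one) satisfy `p`? -/
noncomputable def anyBit (p : Nat → Bool) (n : Nat) : Nat → Bool :=
  Nat.rec (motive := fun _ => Nat → Bool) (fun _ => false)
    (fun _ ih r => Nat.rec (motive := fun _ => Bool) false
      (fun r _ => force (Nat.log2 (Nat.succ r)) fun w =>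
        Bool.rec (motive := fun _ => Bool)
          (force (Nat.xor (Nat.succ r) (Nat.pow 2 w)) fun r' => ih r') true (p w)) r) n

/-- Depth first search for a Hamiltonian cycle. -/
noncomputable def dfs (root : Nat) (g : Nat) (n : Nat) : Nat → Nat → Bool :=
  Nat.rec (motive := fun _ => Nat → Nat → Bool)
    (fun v _ => tb g (Nat.add (Nat.mul 9 v) root))
    (fun _ ih v av => 
        anyBit (fun w => force (Nat.xor av (Nat.pow 2 w)) fun av' => ih w av') 9
          (Nat.land (Nat.shiftRight g (Nat.mul 9 v)) av)) n

/-- Number of bits of a number below 512. -/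
def bits (r : Nat) : Nat :=
  Nat.mod (Nat.land (Nat.mul r 35185445863425) 76861433640456465) 15

/-- Degree of the vertex `i`. -/
def pop (g i : Nat) : Nat := bits (Nat.land (Nat.shiftRight g (Nat.mul 9 i)) 511)

/-- Branch over the pairs `ps`, keeping a lower bound `g` and an upper bound `u` of the graph;
`t` is the degree sequence. -/
noncomputable def srch (lo hi : Nat → Nat) (leaf : Nat → Nat → Bool) : List (Nat × Nat) → Nat → Nat → Bool
  | [], g, u => leaf g u
  | (i, j) :: ps, g, u =>
    (force (Nat.lor g (eb i j)) fun g2 =>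
      !(Nat.ble (pop g2 i) (hi i) && Nat.ble (pop g2 j) (hi j)) || srch lo hi leaf ps g2 u) &&
    (force (Nat.xor (Nat.lor u (eb i j)) (eb i j)) fun u2 =>
      !(Nat.ble (lo i) (pop u2 i) && Nat.ble (lo j) (pop u2 j)) || srch lo hi leaf ps g u2)

/-- Code of a list of edges. -/
def code (l : List (Nat × Nat)) : Nat := l.foldr (fun e s => Nat.lor (eb e.1 e.2) s) 0

/-- All pairs below `n`. -/
def prs (n : Nat) : List (Nat × Nat) :=
  (List.range n).flatMap fun i => (List.range i).map fun j => (j, i)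

/-- Pairs with one element below `nd` and one element in `[nd, 9)`. -/
def bip (nd : Nat) : List (Nat × Nat) :=
  (List.range nd).flatMap fun i => (List.range (9 - nd)).map fun j => (i, nd + j)

/-- Leaf test: some matching from the list destroys all Hamiltonian cycles
(the first component of an entry is the root of the search). -/
noncomputable def leafT (ms : List (Nat × Nat)) (g u : Nat) : Bool :=
  ms.any fun m => Nat.beq (Nat.land g m.2) m.2 && force (Nat.xor u m.2) fun u' =>
    force (Nat.xor 511 (Nat.pow 2 m.1)) fun av => !dfs m.1 u' 8 m.1 av

/-- Graphs of maximum degree at most two on four vertices. -/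
def canon4 : List (List (Nat × Nat)) :=
  [[], [(0, 1)], [(0, 1), (0, 2)], [(0, 1), (2, 3)], [(0, 1), (0, 2), (1, 2)],
   [(0, 1), (0, 2), (1, 3)], [(0, 1), (0, 2), (1, 3), (2, 3)]]

/-- Graphs of maximum degree at most two on five vertices. -/
def canon5 : List (List (Nat × Nat)) :=
  [[], [(0, 1)], [(0, 1), (0, 2)], [(0, 1), (2, 3)], [(0, 1), (0, 2), (1, 2)],
   [(0, 1), (0, 2), (1, 3)], [(0, 1), (0, 2), (3, 4)], [(0, 1), (0, 2), (1, 2), (3, 4)],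
   [(0, 1), (0, 2), (1, 3), (2, 3)], [(0, 1), (0, 2), (1, 3), (2, 4)],
   [(0, 1), (0, 2), (1, 3), (2, 4), (3, 4)]]

/-- The edges missing in `l`, shifted by `nd`. -/
def coShift (nd : Nat) (l : List (Nat × Nat)) : List (Nat × Nat) :=
  ((prs (9 - nd)).filter fun e => !l.contains e).map fun e => (nd + e.1, nd + e.2)

/-- Known part of the graph. -/
def base (nd : Nat) (cd cb : List (Nat × Nat)) : Nat :=
  Nat.lor (code cd) (code (coShift nd cb))

/-- Sum of `f` over a list. -/
def lsum (f : Nat → Nat) (l : List Nat) : Nat := l.foldr (fun i s => Nat.add (f i) s) 0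

/-- The search for one pair of known parts. -/
noncomputable def run (nd : Nat) (ms : List (Nat × Nat)) (t : Nat → Nat) (g : Nat) : Bool :=
  !((List.range (9 - nd)).all fun b => Nat.ble (t (nd + b)) (pop g (nd + b) + 2)) ||
  !(Nat.beq (lsum t (List.range nd) + lsum (fun b => pop g (nd + b)) (List.range (9 - nd)))
    (lsum (fun b => t (nd + b)) (List.range (9 - nd)) + lsum (pop g) (List.range nd))) ||
  force (Nat.lor g (code (bip nd))) fun u => srch t t (leafT ms) (bip nd) g u

/-- Degree sequence in the first case. -/
def t4 (i : Nat) : Nat := bif Nat.ble 4 i then 4 else 3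

/-- Degree sequence in the second case. -/
def t5 (x i : Nat) : Nat := bif Nat.ble 5 i then (bif Nat.beq i x then 5 else 4) else 3

/-- Matchings used for the case of four vertices of degree three. -/
def mcodes4 : List (Nat × Nat) :=
  [(5, 19037184008061083189762), (5, 37926577881971345588738), (5, 302383640551062029468162),
   (5, 9592451042321726046212), (4, 37816404063691091214850), (4, 18963831620342783148546),
   (4, 606824671761302066037250), (5, 37926541853174310141956), (8, 37037638665929498656),
   (8, 18590894729629597728), (5, 302383640551061759201284), (8, 73859104343536451600),
   (8, 9295500551556972672), (6, 19037040174343689077250), (8, 9259542123273814144),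
   (8, 36911784162672779328), (0, 9367557877146861696), (1, 73859069227883831328),
   (8, 9295711247620120704), (0, 9367628108456272000), (8, 18465040226372878400),
   (8, 36929552680747040800), (6, 9518519977510562824224), (0, 73823040568291262496),
   (1, 9259682588027551872), (8, 73823145915253293072), (8, 18591000076591628304),
   (4, 37797957319617348435972), (6, 37926505965114787627522), (8, 36911573466609631296),
   (4, 4759838683569483419904), (4, 18899268016067888287872), (1, 606824237199405329940512),
   (0, 37037673781582118928), (2, 302309853636425202810896), (0, 18908056790817742848016),
   (0, 18898689303652941701248), (4, 37926505859561663498272), (7, 75594775316421215797312),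
   (8, 302254513615503584460800), (4, 18908056825933395460128), (4, 37788227362991175123072),
   (4, 75567159243506163138688), (4, 75567123285077879980160), (1, 606824165176780928335888),
   (2, 10037334759913426124816), (0, 606824129218352645177360), (4, 9519098654603426004996),
   (1, 18518837404039708704), (4, 75557935836285204697120), (5, 302272960113144984772640),
   (0, 73805061354153852992), (8, 295440643553717387778), (4, 75557881898642784129088),
   (2, 38074102286306450088000), (0, 606824165141665275715616), (4, 37788733947580493858944),
   (6, 151134201217775002779712), (0, 606824111204022855147584), (5, 151152647961711302680640),
   (0, 302272960359439884361728), (5, 302254513474555646902288), (6, 75631650860556024283650),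
   (0, 4796153600056598995200), (7, 75631668874954533765184), (4, 4796189628716179030272),
   (4, 9481644749764524376128), (0, 9481626453955462692880), (1, 606824111133791545737280),
   (4, 4796225587144462188800), (0, 4796225516913156956416), (0, 5017554920720526508288),
   (4, 4869940725734686853376), (8, 74365689001574408196), (0, 18519083215755477008),
   (0, 4796153529825289584896), (8, 4870012501849737793792), (7, 76150465537612193992704),
   (1, 9454100453247693226112), (4, 302309853566262621241858), (8, 36929798492462809104),
   (5, 151189595492933974360578), (6, 151189559464136938913796), (5, 302309853636356483596292),
   (5, 302272960078375077020162), (5, 302254513334301334241284), (6, 75594757513133233799682),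
   (3, 151708338112533260148740), (4, 606824237304683572494850), (4, 75557900053782800400388),
   (5, 606824165106895367963138), (4, 75558007929071919710212), (7, 76150465678353700749316),
   (2, 151708338112947724222464), (4, 9454028676849471717504), (4, 4740957482877517365504)]

/-- Matchings used for the case of five vertices of degree three. -/
def mcodes5 : List (Nat × Nat) :=
  [(1, 37815861415120365191200), (1, 18963288971772057124896), (1, 37797450699843657859104),
   (1, 9518592034829735428128), (1, 37815843435906227781696), (1, 18963270992557919715392),
   (1, 37797396762201237291072), (1, 9518538097187314860096), (1, 37788227362991175123072),
   (1, 37788191404562891964544), (1, 4796225587144462188800), (1, 4796189628716179030272),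
   (1, 18908056825933395460128), (1, 9481770604267781095456), (1, 18907930971430138740800),
   (1, 9481644749764524376128), (1, 18898833489080912724096), (1, 18898725613791793414272),
   (1, 9454100593710307868800), (1, 9454028676849471717504), (1, 4759404156582507856128),
   (1, 4759296281293388546304), (1, 4740957482877517365504), (1, 4740885566016681214208),
   (0, 75594793295635353206816), (0, 19037075956845808484384), (0, 75576382580358645874720),
   (0, 9592379019903486787616), (0, 75594775316421215797312), (0, 19037057977631671074880),
   (0, 75576328642716225306688), (0, 9592325082261066219584), (0, 75567159243506163138688),
   (0, 75567123285077879980160), (0, 4870012572218213548288), (0, 4869976613789930389760),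
   (8, 76150465678353701013504), (5, 75567231230740030556288), (7, 302383640832540762703872),
   (5, 4870084559452080965888), (8, 38371534081508417996800), (7, 151263328434812181022784),
   (7, 302309854131136716343296), (8, 302531218999006605084672), (7, 151708338112947724748800),
   (7, 76150465396874967777794), (8, 302383640551062029468162), (5, 38074372506544700393472),
   (5, 151189811670114118404096), (8, 75853016152285758361604), (3, 9454244713287840301184),
   (3, 4741101602455049797888), (3, 9454028960519176716416), (3, 4740885849686386213120),
   (3, 18908200945510927892512), (3, 9481914723845313527840), (3, 18898977608658445156480),
   (3, 4759548276160040288512), (7, 151263310420413939716100), (3, 18907931255099843739712),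
   (3, 9481645033434229375040), (3, 18898725897461498413184), (3, 4759296564963093545216),
   (5, 606824671761576409170434), (7, 606824671761301795770372), (8, 38371533516634322895362),
   (8, 302245289961987726381184), (8, 75853088209879544365570), (8, 76150465537611925553666),
   (8, 38074372506544699867650), (8, 38371534081508417470978), (5, 38074120300567520903172),
   (6, 38371533586728185249796), (8, 75576454602776885133316), (6, 75576310769059491020804),
   (8, 5314968136512715100416), (7, 302383640691798987244034), (7, 151263382478007725720066),
   (8, 75853088209879812804608), (7, 151189523435614801756674), (6, 302309853636356483596292),
   (5, 151189559464136938913796), (8, 75853160267482155712516), (8, 76150465678353700749316),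
   (7, 151263454535610337067012), (7, 9444877116395210539040), (6, 9592307208604331933700),
   (7, 302383640832540762439684), (6, 302272960642972150399490), (7, 9444877646084933287940),
   (6, 10037335184256186843140), (7, 18889610611824290431490), (6, 19482068149995543986690)]

theorem run4 : (canon4.all fun cd => canon5.all fun cb =>
    force (base 4 cd cb) fun g => run 4 mcodes4 t4 g) = true := by
  decide +kernel

theorem run5 : ([5, 6, 7, 8].all fun x => canon5.all fun cd => canon4.all fun cb =>
    force (base 5 cd cb) fun g => run 5 mcodes5 (t5 x) g) = true := by
  decide +kernel

/-! ## Soundness of the search -/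

theorem force_eq {α : Type} (n : Nat) (k : Nat → α) : force n k = k n := rfl

theorem tb_eq (m n : Nat) : tb m n = m.testBit n := by
  have h : tb m n = Nat.beq ((m >>> n) &&& 1) 1 := rfl
  rw [Bool.eq_iff_iff, h, Nat.beq_eq, Nat.and_one_is_mod, Nat.testBit_eq_decide_div_mod_eq,
    Nat.shiftRight_eq_div_pow, decide_eq_true_eq]

theorem eb_testBit (i j a b : Nat) (hi : i < 9) (hj : j < 9) (ha : a < 9) (hb : b < 9) :
    (eb i j).testBit (9 * a + b) = true ↔ (a = i ∧ b = j) ∨ (a = j ∧ b = i) := by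
  have h : eb i j = 2 ^ (9 * i + j) ||| 2 ^ (9 * j + i) := rfl
  rw [h, Nat.testBit_or, Nat.testBit_two_pow, Nat.testBit_two_pow]
  simp only [Bool.or_eq_true, decide_eq_true_eq]
  omega

theorem code_testBit (l : List (Nat × Nat)) (hl : ∀ e ∈ l, e.1 < 9 ∧ e.2 < 9) (a b : Nat)
    (ha : a < 9) (hb : b < 9) :
    (code l).testBit (9 * a + b) = true ↔ (a, b) ∈ l ∨ (b, a) ∈ l := by
  induction l with
  | nil => simp [code]
  | cons e l ih =>
    have h : code (e :: l) = eb e.1 e.2 ||| code l := rfl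
    have he := hl e (by simp)
    rw [h, Nat.testBit_or, Bool.or_eq_true, eb_testBit _ _ _ _ he.1 he.2 ha hb,
      ih fun e he => hl e (by simp [he])]
    obtain ⟨i, j⟩ := e
    simp only [List.mem_cons, Prod.mk.injEq]
    tauto

theorem bits_eq : ∀ r < 512, bits r = ∑ k ∈ Finset.range 9, (r.testBit k).toNat := by
  decide +kernel

theorem pop_eq (g i : Nat) :
    pop g i = ∑ k ∈ Finset.range 9, (g.testBit (9 * i + k)).toNat := by
  have h : pop g i = bits ((g >>> (9 * i)) &&& 511) := rfl
  rw [h, bits_eq _ (lt_of_le_of_lt Nat.and_le_right (by norm_num))]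
  refine Finset.sum_congr rfl fun k hk => ?_
  have hk : k < 9 := by simpa using hk
  have h5 : (511).testBit k = true := by
    have : (511 : ℕ) = 2 ^ 9 - 1 := by norm_num
    rw [this, Nat.testBit_two_pow_sub_one]
    simpa using hk
  rw [Nat.testBit_and, Nat.testBit_shiftRight, h5, Bool.and_true]

/-- All edges coded by `g` are in `A`. -/
def Lo (g : Nat) (A : Nat → Nat → Prop) : Prop :=
  ∀ a b, a < 9 → b < 9 → g.testBit (9 * a + b) = true → A a b

/-- All edges in `A` are coded by `u`. -/
def Up (u : Nat) (A : Nat → Nat → Prop) : Prop :=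
  ∀ a b, a < 9 → b < 9 → A a b → u.testBit (9 * a + b) = true

open Classical in
/-- Degree of a vertex. -/
noncomputable def dg (A : Nat → Nat → Prop) (i : Nat) : Nat :=
  ∑ k ∈ Finset.range 9, if A i k then 1 else 0

theorem pop_le_dg (g : Nat) (A : Nat → Nat → Prop) (h : Lo g A) (i : Nat) (hi : i < 9) :
    pop g i ≤ dg A i := by
  rw [pop_eq, dg]
  refine Finset.sum_le_sum fun k hk => ?_
  have := h i k hi (by simpa using hk)
  cases hb : g.testBit (9 * i + k)
  · simp
  · simp [this hb]

theorem dg_le_pop (u : Nat) (A : Nat → Nat → Prop) (h : Up u A) (i : Nat) (hi : i < 9) :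
    dg A i ≤ pop u i := by
  rw [pop_eq, dg]
  refine Finset.sum_le_sum fun k hk => ?_
  have := h i k hi (by simpa using hk)
  split_ifs with hA
  · simp [this hA]
  · simp

theorem srch_sound (A : Nat → Nat → Prop) (hA : ∀ a b, A a b → A b a) (lo hi : Nat → Nat)
    (leaf : Nat → Nat → Bool) (hlo : ∀ i < 9, lo i ≤ dg A i) (hhi : ∀ i < 9, dg A i ≤ hi i)
    (ps : List (Nat × Nat)) (hps : ∀ e ∈ ps, e.1 < 9 ∧ e.2 < 9) (g u : Nat)
    (hg : Lo g A) (hu : Up u A) (h : srch lo hi leaf ps g u = true) :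
    ∃ g' u', Lo g' A ∧ Up u' A ∧ leaf g' u' = true := by
  induction ps generalizing g u with
  | nil => exact ⟨g, u, hg, hu, h⟩
  | cons e ps ih =>
    obtain ⟨i, j⟩ := e
    have hij := hps (i, j) (by simp)
    obtain ⟨hi9, hj9⟩ : i < 9 ∧ j < 9 := hij
    have ih := ih fun e he => hps e (by simp [he])
    have h' : ((!(Nat.ble (pop (g ||| eb i j) i) (hi i) && Nat.ble (pop (g ||| eb i j) j) (hi j)) ||
        srch lo hi leaf ps (g ||| eb i j) u) &&
      (!(Nat.ble (lo i) (pop ((u ||| eb i j) ^^^ eb i j) i) &&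
          Nat.ble (lo j) (pop ((u ||| eb i j) ^^^ eb i j) j)) ||
        srch lo hi leaf ps g ((u ||| eb i j) ^^^ eb i j))) = true := h
    rw [Bool.and_eq_true] at h'
    by_cases hAij : A i j
    · have hg' : Lo (g ||| eb i j) A := by
        intro a b ha hb hab
        rw [Nat.testBit_or, Bool.or_eq_true, eb_testBit _ _ _ _ hi9 hj9 ha hb] at hab
        rcases hab with hab | ⟨rfl, rfl⟩ | ⟨rfl, rfl⟩
        exacts [hg a b ha hb hab, hAij, hA _ _ hAij]
      have h1 : Nat.ble (pop (g ||| eb i j) i) (hi i) = true :=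
        Nat.ble_eq_true_of_le ((pop_le_dg _ A hg' i hi9).trans (hhi i hi9))
      have h2 : Nat.ble (pop (g ||| eb i j) j) (hi j) = true :=
        Nat.ble_eq_true_of_le ((pop_le_dg _ A hg' j hj9).trans (hhi j hj9))
      have h3 := h'.1
      rw [h1, h2] at h3
      exact ih _ _ hg' hu (by simpa using h3)
    · have hu' : Up ((u ||| eb i j) ^^^ eb i j) A := by
        intro a b ha hb hab
        have hne : (eb i j).testBit (9 * a + b) = false := by
          rw [← Bool.not_eq_true, eb_testBit _ _ _ _ hi9 hj9 ha hb]
          rintro (⟨rfl, rfl⟩ | ⟨rfl, rfl⟩)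
          exacts [hAij hab, hAij (hA _ _ hab)]
        rw [Nat.testBit_xor, Nat.testBit_or, hne, hu a b ha hb hab]
        rfl
      have h1 : Nat.ble (lo i) (pop ((u ||| eb i j) ^^^ eb i j) i) = true :=
        Nat.ble_eq_true_of_le ((hlo i hi9).trans (dg_le_pop _ A hu' i hi9))
      have h2 : Nat.ble (lo j) (pop ((u ||| eb i j) ^^^ eb i j) j) = true :=
        Nat.ble_eq_true_of_le ((hlo j hj9).trans (dg_le_pop _ A hu' j hj9))
      have h3 := h'.2
      rw [h1, h2] at h3
      exact ih _ _ hg hu' (by simpa using h3)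

theorem anyBit_sound (p : Nat → Bool) (n r w : Nat) (hr : r < 2 ^ n) (hw : r.testBit w = true)
    (hp : p w = true) : anyBit p n r = true := by
  induction n generalizing r with
  | zero =>
    have : r = 0 := by simpa using hr
    subst this
    simp at hw
  | succ n ih =>
    cases r with
    | zero => simp at hw
    | succ r =>
      have h : anyBit p (n + 1) (r + 1) = Bool.rec (motive := fun _ => Bool)
        (anyBit p n ((r + 1) ^^^ 2 ^ (Nat.log2 (r + 1)))) true (p (Nat.log2 (r + 1))) := rfl
      rw [h]
      cases hq : p (Nat.log2 (r + 1)) with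
      | true => rfl
      | false =>
        have hne : Nat.log2 (r + 1) ≠ w := by rintro rfl; simp [hp] at hq
        refine ih _ ?_ ?_
        · have h1 : (r + 1) < 2 ^ (Nat.log2 (r + 1) + 1) := Nat.lt_log2_self
          have h2 : 2 ^ Nat.log2 (r + 1) ≤ r + 1 := Nat.log2_self_le (by omega)
          have h3 : Nat.log2 (r + 1) ≤ n := by
            by_contra hc
            have : 2 ^ (n + 1) ≤ 2 ^ Nat.log2 (r + 1) := Nat.pow_le_pow_right (by norm_num) (by omega)
            omega
          have hbit : (r + 1).testBit (Nat.log2 (r + 1)) = true := Nat.testBit_log2 (by omega)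
          apply Nat.lt_pow_two_of_testBit
          intro i hi
          rw [Nat.testBit_xor, Nat.testBit_two_pow]
          by_cases hi' : Nat.log2 (r + 1) = i
          · subst hi'; simp [hbit]
          · have : (r + 1).testBit i = false :=
              Nat.testBit_lt_two_pow (lt_of_lt_of_le h1 (Nat.pow_le_pow_right (by norm_num) (by omega)))
            simp [this, hi']
        · rw [Nat.testBit_xor, Nat.testBit_two_pow, hw]
          simp [hne]

theorem dfs_sound (root g n : Nat) (q : Nat → Nat) (av : Nat) (hav : av < 512)
    (hq : ∀ i, q i < 9) (hin : ∀ i < n, av.testBit (q (i + 1)) = true)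
    (hd : ∀ i < n, ∀ j < n, q (i + 1) = q (j + 1) → i = j)
    (hadj : ∀ i < n, g.testBit (9 * q i + q (i + 1)) = true)
    (hlast : g.testBit (9 * q n + root) = true) : dfs root g n (q 0) av = true := by
  induction n generalizing q av with
  | zero =>
    have h : dfs root g 0 (q 0) av = tb g (9 * q 0 + root) := rfl
    rw [h, tb_eq, hlast]
  | succ n ih =>
    have h : dfs root g (n + 1) (q 0) av =
      anyBit (fun w => dfs root g n w (av ^^^ 2 ^ w)) 9 ((g >>> (9 * q 0)) &&& av) := rfl
    rw [h]
    refine anyBit_sound _ 9 _ (q 1) (lt_of_le_of_lt Nat.and_le_right (by norm_num; exact hav)) ?_ ?_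
    · rw [Nat.testBit_and, Nat.testBit_shiftRight, hadj 0 (by omega), hin 0 (by omega)]
      rfl
    · refine ih (fun i => q (i + 1)) _ ?_ (fun i => hq _) ?_ ?_ ?_ hlast
      · exact Nat.xor_lt_two_pow (n := 9) hav (Nat.pow_lt_pow_right (by norm_num) (hq 1))
      · intro i hi
        rw [Nat.testBit_xor, Nat.testBit_two_pow, hin (i + 1) (by omega)]
        have : q 1 ≠ q (i + 1 + 1) := fun he => by
          have := hd 0 (by omega) (i + 1) (by omega) he
          omega
        simp [this]
      · intro i hi j hj he
        have := hd (i + 1) (by omega) (j + 1) (by omega) he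
        omega
      · intro i hi
        exact hadj (i + 1) (by omega)

/-! ## The lower bound: local structure -/

/-- If `F` arrows, then deleting a matching leaves a Hamiltonian cycle. -/
theorem ham_of_arrows {V : Type} [Fintype V] (F : SimpleGraph V) (hV : Fintype.card V = 9)
    (h : Arrows F (pathGraph 3) (cycleGraph 9)) (R : SimpleGraph V) (hR : R ≤ F)
    (hm : ∀ a b c : V, R.Adj a b → R.Adj a c → b = c) :
    ∃ f : Fin 9 ≃ V, ∀ i, F.Adj (f i) (f (i + 1)) ∧ ¬ R.Adj (f i) (f (i + 1)) := by
  rcases h R hR with h | ⟨f, hf⟩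
  · exact absurd h (not_contains_of_matching R hm)
  · have hb : Function.Bijective f := by
      rw [Fintype.bijective_iff_injective_and_card]
      exact ⟨hf, by simp [hV]⟩
    refine ⟨Equiv.ofBijective f hb, fun i => ?_⟩
    have : (F \ R).Adj (f i) (f (i + 1)) := f.map_rel (by
      rw [cycleGraph_adj]; right; abel)
    exact ⟨this.1, this.2⟩

/-- Successor form of the previous lemma. -/
theorem succ_of_arrows {V : Type} [Fintype V] (F : SimpleGraph V) (hV : Fintype.card V = 9)
    (h : Arrows F (pathGraph 3) (cycleGraph 9)) (R : SimpleGraph V) (hR : R ≤ F)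
    (hm : ∀ a b c : V, R.Adj a b → R.Adj a c → b = c) :
    ∃ s p : V → V, (∀ v, s (p v) = v) ∧ (∀ v, p (s v) = v) ∧ (∀ v, s v ≠ p v) ∧
      (∀ v, F.Adj v (s v) ∧ ¬ R.Adj v (s v)) ∧ (∀ v, F.Adj v (p v) ∧ ¬ R.Adj v (p v)) ∧
      (∀ v, s (s (s (s v))) ≠ v) ∧ (∀ v, s (s (s (s (s (s v))))) ≠ v) := by
  obtain ⟨f, hf⟩ := ham_of_arrows F hV h R hR hm
  have hs : ∀ v, F.Adj v (f (f.symm v + 1)) ∧ ¬ R.Adj v (f (f.symm v + 1)) := by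
    intro v
    have := hf (f.symm v)
    rwa [f.apply_symm_apply] at this
  have e1 : ∀ x : Fin 9, x + 1 ≠ x - 1 := by decide
  have e2 : ∀ x : Fin 9, x + 1 + 1 + 1 + 1 ≠ x := by decide
  have e3 : ∀ x : Fin 9, x + 1 + 1 + 1 + 1 + 1 + 1 ≠ x := by decide
  refine ⟨fun v => f (f.symm v + 1), fun v => f (f.symm v - 1), ?_, ?_, ?_, hs, ?_, ?_, ?_⟩
  · intro v; simp
  · intro v; simp
  · intro v hv
    exact e1 _ (f.injective hv)
  · intro v
    have := hs (f (f.symm v - 1))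
    simp only [Equiv.symm_apply_apply, sub_add_cancel, Equiv.apply_symm_apply] at this
    exact ⟨this.1.symm, fun h => this.2 h.symm⟩
  · intro v hv
    simp only [Equiv.symm_apply_apply] at hv
    have := congrArg f.symm hv
    simp only [Equiv.symm_apply_apply] at this
    exact e2 _ this
  · intro v hv
    simp only [Equiv.symm_apply_apply] at hv
    have := congrArg f.symm hv
    simp only [Equiv.symm_apply_apply] at this
    exact e3 _ this

/-- The graph with (at most) the three edges `ai bi`. -/
def R3 {V : Type} (a1 b1 a2 b2 a3 b3 : V) (h1 : a1 ≠ b1) (h2 : a2 ≠ b2) (h3 : a3 ≠ b3) :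
    SimpleGraph V where
  Adj x y := (x = a1 ∧ y = b1) ∨ (x = b1 ∧ y = a1) ∨ (x = a2 ∧ y = b2) ∨ (x = b2 ∧ y = a2) ∨
    (x = a3 ∧ y = b3) ∨ (x = b3 ∧ y = a3)
  symm := ⟨fun x y h => by tauto⟩
  loopless := ⟨fun x h => by grind⟩

/-- Removing three edges that form a matching. -/
theorem succ3 {V : Type} [Fintype V] (F : SimpleGraph V) (hV : Fintype.card V = 9)
    (h : Arrows F (pathGraph 3) (cycleGraph 9)) (a1 b1 a2 b2 a3 b3 : V)
    (h1 : F.Adj a1 b1) (h2 : F.Adj a2 b2) (h3 : F.Adj a3 b3)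
    (hm : ∀ a b c : V, (R3 a1 b1 a2 b2 a3 b3 h1.ne h2.ne h3.ne).Adj a b →
      (R3 a1 b1 a2 b2 a3 b3 h1.ne h2.ne h3.ne).Adj a c → b = c) :
    ∃ s p : V → V, (∀ v, s (p v) = v) ∧ (∀ v, p (s v) = v) ∧ (∀ v, s v ≠ p v) ∧
      (∀ v, F.Adj v (s v)) ∧ (∀ v, F.Adj v (p v)) ∧
      (∀ v, s (s (s (s v))) ≠ v) ∧ (∀ v, s (s (s (s (s (s v))))) ≠ v) ∧
      (s a1 ≠ b1 ∧ p a1 ≠ b1) ∧ (s b1 ≠ a1 ∧ p b1 ≠ a1) ∧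
      (s a2 ≠ b2 ∧ p a2 ≠ b2) ∧ (s b2 ≠ a2 ∧ p b2 ≠ a2) ∧
      (s a3 ≠ b3 ∧ p a3 ≠ b3) ∧ (s b3 ≠ a3 ∧ p b3 ≠ a3) := by
  obtain ⟨s, p, e1, e2, e3, e4, e5, e6, e7⟩ := succ_of_arrows F hV h
    (R3 a1 b1 a2 b2 a3 b3 h1.ne h2.ne h3.ne) (by
      intro x y hxy
      rcases hxy with ⟨rfl, rfl⟩ | ⟨rfl, rfl⟩ | ⟨rfl, rfl⟩ | ⟨rfl, rfl⟩ | ⟨rfl, rfl⟩ | ⟨rfl, rfl⟩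
      exacts [h1, h1.symm, h2, h2.symm, h3, h3.symm]) hm
  refine ⟨s, p, e1, e2, e3, fun v => (e4 v).1, fun v => (e5 v).1, e6, e7, ?_⟩
  have k4 := fun v => (e4 v).2
  have k5 := fun v => (e5 v).2
  simp only [R3] at k4 k5
  refine ⟨⟨?_, ?_⟩, ⟨?_, ?_⟩, ⟨?_, ?_⟩, ⟨?_, ?_⟩, ⟨?_, ?_⟩, ⟨?_, ?_⟩⟩ <;> intro hh
  · exact k4 a1 (by simp [hh])
  · exact k5 a1 (by simp [hh])
  · exact k4 b1 (by simp [hh])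
  · exact k5 b1 (by simp [hh])
  · exact k4 a2 (by simp [hh])
  · exact k5 a2 (by simp [hh])
  · exact k4 b2 (by simp [hh])
  · exact k5 b2 (by simp [hh])
  · exact k4 a3 (by simp [hh])
  · exact k5 a3 (by simp [hh])
  · exact k4 b3 (by simp [hh])
  · exact k5 b3 (by simp [hh])

open Classical in
/-- The minimum degree is at least three. -/
theorem three_le_degree {V : Type} [Fintype V] (F : SimpleGraph V) (hV : Fintype.card V = 9)
    (h : Arrows F (pathGraph 3) (cycleGraph 9)) (v : V) : 3 ≤ F.degree v := by
  have hpos : ∃ w, F.Adj v w := by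
    obtain ⟨s, p, _, _, _, e4, _⟩ := succ_of_arrows F hV h ⊥ bot_le (by simp)
    exact ⟨_, (e4 v).1⟩
  obtain ⟨w, hw⟩ := hpos
  obtain ⟨s, p, e1, e2, e3, e4, e5, _, _, ⟨c1, c2⟩, _⟩ :=
    succ3 F hV h v w v w v w hw hw hw (by
      intro a b c; simp only [R3]; have := hw.ne; grind)
  have hsub : ({w, s v, p v} : Finset V) ⊆ F.neighborFinset v := by
    intro x hx
    simp only [Finset.mem_insert, Finset.mem_singleton] at hx
    rw [mem_neighborFinset]
    rcases hx with rfl | rfl | rfl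
    exacts [hw, e4 v, e5 v]
  have hc : ({w, s v, p v} : Finset V).card = 3 :=
    Finset.card_eq_three.2 ⟨w, s v, p v, c1.symm, c2.symm, e3 v, rfl⟩
  rw [← card_neighborFinset_eq_degree, ← hc]
  exact Finset.card_le_card hsub

open Classical in
theorem nbrs_three {V : Type} [Fintype V] (F : SimpleGraph V) (v u : V) (hd : F.degree v = 3)
    (hu : F.Adj v u) : ∃ a b, u ≠ a ∧ u ≠ b ∧ a ≠ b ∧ F.Adj v a ∧ F.Adj v b ∧
      ∀ x, F.Adj v x → x = u ∨ x = a ∨ x = b := by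
  have h1 : ((F.neighborFinset v).erase u).card = 2 := by
    rw [Finset.card_erase_of_mem (by simpa using hu), card_neighborFinset_eq_degree, hd]
  obtain ⟨a, b, hab, he⟩ := Finset.card_eq_two.1 h1
  have key : ∀ x, (x ≠ u ∧ F.Adj v x) ↔ (x = a ∨ x = b) := by
    intro x
    have := Finset.ext_iff.1 he x
    simpa using this
  refine ⟨a, b, ?_, ?_, hab, ?_, ?_, ?_⟩
  · exact ((key a).2 (Or.inl rfl)).1.symm
  · exact ((key b).2 (Or.inr rfl)).1.symm
  · exact ((key a).2 (Or.inl rfl)).2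
  · exact ((key b).2 (Or.inr rfl)).2
  · intro x hx
    by_cases hxu : x = u
    · exact Or.inl hxu
    · exact Or.inr ((key x).1 ⟨hxu, hx⟩)

/-- If the cycle misses one of the three edges at `v`, the edge `vu` is used. -/
theorem forced {V : Type} (u v a b : V) (s p : V → V) (e1 : ∀ v, s (p v) = v)
    (e2 : ∀ v, p (s v) = v) (e3 : ∀ v, s v ≠ p v)
    (hs : s v = u ∨ s v = a ∨ s v = b) (hp : p v = u ∨ p v = a ∨ p v = b)
    (hn : s v ≠ a ∧ p v ≠ a) : (s u = v ∨ p u = v) ∧ (s v = b ∨ p v = b) := by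
  have := e3 v
  have := e1 v
  have := e2 v
  grind

theorem no_three {V : Type} (u v1 v2 v3 : V) (s p : V → V) (h12 : v1 ≠ v2) (h13 : v1 ≠ v3)
    (h23 : v2 ≠ v3) (h1 : s u = v1 ∨ p u = v1) (h2 : s u = v2 ∨ p u = v2)
    (h3 : s u = v3 ∨ p u = v3) : False := by
  grind

/-- A special case of `not_three`. -/
theorem not_three_adj {V : Type} [Fintype V] (F : SimpleGraph V) (hV : Fintype.card V = 9)
    (h : Arrows F (pathGraph 3) (cycleGraph 9)) (u v1 v2 v3 a1 a2 a3 b3 : V)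
    (h12 : v1 ≠ v2) (h13 : v1 ≠ v3) (h23 : v2 ≠ v3)
    (n1 : ∀ x, F.Adj v1 x → x = u ∨ x = v2 ∨ x = a1) (n2 : ∀ x, F.Adj v2 x → x = u ∨ x = v1 ∨ x = a2)
    (n3 : ∀ x, F.Adj v3 x → x = u ∨ x = a3 ∨ x = b3)
    (m1 : F.Adj u v1) (m2 : F.Adj u v2) (m3 : F.Adj u v3) (m12 : F.Adj v1 v2)
    (ma : F.Adj v3 a3) (mb : F.Adj v3 b3) (hau : a3 ≠ u) (hbu : b3 ≠ u) (hab : a3 ≠ b3) : False := by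
  by_cases hA : a3 = v1 ∨ a3 = v2
  · by_cases hB : b3 = v1 ∨ b3 = v2
    · -- the four vertices form a complete graph
      obtain ⟨s, p, e1, e2, e3, e4, e5, e6, e7, c1, c2, -⟩ :=
        succ3 F hV h v1 v2 v1 v2 v1 v2 m12 m12 m12 (by
          intro a b c; simp only [R3]; grind)
      have q31 : a1 = v3 := by
        have hk : F.Adj v1 v3 := by
          rcases hA with rfl | rfl <;> rcases hB with rfl | rfl <;> first | exact ma.symm | exact mb.symm | exact absurd rfl hab
        rcases n1 v3 hk with e | e | e
        · exact absurd e m3.ne.symm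
        · exact absurd e h23.symm
        · exact e.symm
      have q32 : a2 = v3 := by
        have hk : F.Adj v2 v3 := by
          rcases hA with rfl | rfl <;> rcases hB with rfl | rfl <;> first | exact ma.symm | exact mb.symm | exact absurd rfl hab
        rcases n2 v3 hk with e | e | e
        · exact absurd e m3.ne.symm
        · exact absurd e h13.symm
        · exact e.symm
      subst q31
      subst q32
      have f1 := forced u v1 v2 a2 s p e1 e2 e3 (n1 _ (e4 _)) (n1 _ (e5 _)) c1
      have f2 := forced u v2 v1 a2 s p e1 e2 e3 (n2 _ (e4 _)) (n2 _ (e5 _)) c2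
      have k1 := e6 u
      have k2 := e6 v1
      have k3 := e6 v2
      have := e1 u
      have := e2 u
      have := e1 a2
      have := e2 a2
      have := e1 v1
      have := e2 v1
      have := e1 v2
      have := e2 v2
      have := m3.ne
      clear e1 e2 e3 e4 e5 e6 e7 n1 n2 n3 h c1 c2 hA hB ma mb hau hbu hab hV
      rcases f1 with ⟨f1 | f1, g1 | g1⟩ <;> rcases f2 with ⟨f2 | f2, g2 | g2⟩ <;> grind
    · obtain ⟨s, p, e1, e2, e3, e4, e5, e6, e7, c1, c2, c3, c4, -⟩ :=
        succ3 F hV h v1 v2 v3 b3 v3 b3 m12 mb mb (by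
          intro a b c; simp only [R3]; have := mb.ne; grind)
      exact no_three u v1 v2 v3 s p h12 h13 h23
        (forced u v1 v2 a1 s p e1 e2 e3 (n1 _ (e4 _)) (n1 _ (e5 _)) c1).1
        (forced u v2 v1 a2 s p e1 e2 e3 (n2 _ (e4 _)) (n2 _ (e5 _)) c2).1
        (forced u v3 b3 a3 s p e1 e2 e3 ((n3 _ (e4 _)).imp_right Or.symm)
          ((n3 _ (e5 _)).imp_right Or.symm) c3).1
  · obtain ⟨s, p, e1, e2, e3, e4, e5, e6, e7, c1, c2, c3, c4, -⟩ :=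
      succ3 F hV h v1 v2 v3 a3 v3 a3 m12 ma ma (by
        intro a b c; simp only [R3]; have := ma.ne; grind)
    exact no_three u v1 v2 v3 s p h12 h13 h23
      (forced u v1 v2 a1 s p e1 e2 e3 (n1 _ (e4 _)) (n1 _ (e5 _)) c1).1
      (forced u v2 v1 a2 s p e1 e2 e3 (n2 _ (e4 _)) (n2 _ (e5 _)) c2).1
      (forced u v3 a3 b3 s p e1 e2 e3 (n3 _ (e4 _)) (n3 _ (e5 _)) c3).1

/-- Removing an edge `vi ai` for three neighbours `vi` of `u` of degree three. -/
theorem not_three_sdr {V : Type} [Fintype V] (F : SimpleGraph V) (hV : Fintype.card V = 9)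
    (h : Arrows F (pathGraph 3) (cycleGraph 9)) (u v1 v2 v3 a1 b1 a2 b2 a3 b3 : V)
    (h12 : v1 ≠ v2) (h13 : v1 ≠ v3) (h23 : v2 ≠ v3)
    (n1 : ∀ x, F.Adj v1 x → x = u ∨ x = a1 ∨ x = b1) (n2 : ∀ x, F.Adj v2 x → x = u ∨ x = a2 ∨ x = b2)
    (n3 : ∀ x, F.Adj v3 x → x = u ∨ x = a3 ∨ x = b3)
    (m12 : ¬ F.Adj v1 v2) (m13 : ¬ F.Adj v1 v3) (m23 : ¬ F.Adj v2 v3)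
    (x1 : F.Adj v1 a1) (x2 : F.Adj v2 a2) (x3 : F.Adj v3 a3) :
    a1 = a2 ∨ a1 = a3 ∨ a2 = a3 := by
  by_contra hk
  push Not at hk
  obtain ⟨k12, k13, k23⟩ := hk
  have y12 : a1 ≠ v2 := by rintro rfl; exact m12 x1
  have y13 : a1 ≠ v3 := by rintro rfl; exact m13 x1
  have y21 : a2 ≠ v1 := by rintro rfl; exact m12 x2.symm
  have y23 : a2 ≠ v3 := by rintro rfl; exact m23 x2
  have y31 : a3 ≠ v1 := by rintro rfl; exact m13 x3.symm
  have y32 : a3 ≠ v2 := by rintro rfl; exact m23 x3.symm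
  obtain ⟨s, p, e1, e2, e3, e4, e5, e6, e7, c1, c2, c3, c4, c5, c6⟩ :=
    succ3 F hV h v1 a1 v2 a2 v3 a3 x1 x2 x3 (by
      intro a b c; simp only [R3]; have := x1.ne; have := x2.ne; have := x3.ne; grind)
  exact no_three u v1 v2 v3 s p h12 h13 h23
    (forced u v1 a1 b1 s p e1 e2 e3 (n1 _ (e4 _)) (n1 _ (e5 _)) c1).1
    (forced u v2 a2 b2 s p e1 e2 e3 (n2 _ (e4 _)) (n2 _ (e5 _)) c3).1
    (forced u v3 a3 b3 s p e1 e2 e3 (n3 _ (e4 _)) (n3 _ (e5 _)) c5).1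

/-- The case of three vertices with the same three neighbours. -/
theorem not_three_same {V : Type} [Fintype V] (F : SimpleGraph V) (hV : Fintype.card V = 9)
    (h : Arrows F (pathGraph 3) (cycleGraph 9)) (u v1 v2 v3 a b : V)
    (h12 : v1 ≠ v2) (h13 : v1 ≠ v3) (h23 : v2 ≠ v3)
    (n1 : ∀ x, F.Adj v1 x → x = u ∨ x = a ∨ x = b) (n2 : ∀ x, F.Adj v2 x → x = u ∨ x = a ∨ x = b)
    (n3 : ∀ x, F.Adj v3 x → x = u ∨ x = a ∨ x = b)
    (m12 : ¬ F.Adj v1 v2) (x1 : F.Adj v1 a) (x2 : F.Adj v2 b) (hab : a ≠ b) : False := by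
  have y12 : a ≠ v2 := by rintro rfl; exact m12 x1
  have y21 : b ≠ v1 := by rintro rfl; exact m12 x2.symm
  obtain ⟨s, p, e1, e2, e3, e4, e5, e6, e7, c1, c2, c3, c4, -⟩ :=
    succ3 F hV h v1 a v2 b v2 b x1 x2 x2 (by
      intro a b c; simp only [R3]; have := x1.ne; have := x2.ne; grind)
  have f1 := forced u v1 a b s p e1 e2 e3 (n1 _ (e4 _)) (n1 _ (e5 _)) c1
  have f2 := forced u v2 b a s p e1 e2 e3 ((n2 _ (e4 _)).imp_right Or.symm)
    ((n2 _ (e5 _)).imp_right Or.symm) c3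
  have f3 : s v3 ≠ u ∧ p v3 ≠ u := by
    have := e1 v3
    have := e2 v3
    have := e1 u
    have := e2 u
    clear e1 e2 e3 e4 e5 e6 e7 n1 n2 n3 h x1 x2 m12 hV
    grind
  have g1 := n3 _ (e4 v3)
  have g2 := n3 _ (e5 v3)
  have k1 := e7 u
  have := e3 v3
  have := e1 u
  have := e2 u
  have := e1 v1
  have := e2 v1
  have := e1 v2
  have := e2 v2
  have := e1 v3
  have := e2 v3
  have := e1 a
  have := e2 a
  have := e1 b
  have := e2 b
  clear e1 e2 e3 e4 e5 e6 e7 n1 n2 n3 h x1 x2 m12 hV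
  rcases f1 with ⟨f1 | f1, k2 | k2⟩ <;> rcases f2 with ⟨f2 | f2, k3 | k3⟩ <;> grind

open Classical in
/-- Every vertex has at most two neighbours of degree three. -/
theorem not_three {V : Type} [Fintype V] (F : SimpleGraph V) (hV : Fintype.card V = 9)
    (h : Arrows F (pathGraph 3) (cycleGraph 9)) (u v1 v2 v3 : V)
    (h12 : v1 ≠ v2) (h13 : v1 ≠ v3) (h23 : v2 ≠ v3)
    (m1 : F.Adj u v1) (m2 : F.Adj u v2) (m3 : F.Adj u v3)
    (d1 : F.degree v1 = 3) (d2 : F.degree v2 = 3) (d3 : F.degree v3 = 3) : False := by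
  obtain ⟨a1, b1, p1, q1, r1, x1, y1, n1⟩ := nbrs_three F v1 u d1 m1.symm
  obtain ⟨a2, b2, p2, q2, r2, x2, y2, n2⟩ := nbrs_three F v2 u d2 m2.symm
  obtain ⟨a3, b3, p3, q3, r3, x3, y3, n3⟩ := nbrs_three F v3 u d3 m3.symm
  have adj : ∀ v w z : V, v ≠ w → v ≠ z → w ≠ z → F.Adj u v → F.Adj u w → F.Adj u z →
      F.degree v = 3 → F.degree w = 3 → F.degree z = 3 → ¬ F.Adj v w := by
    intro v w z hvw hvz hwz mv mw mz dv dw dz hadj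
    obtain ⟨av, bv, pv, qv, rv, xv, yv, nv⟩ := nbrs_three F v u dv mv.symm
    obtain ⟨aw, bw, pw, qw, rw, xw, yw, nw⟩ := nbrs_three F w u dw mw.symm
    obtain ⟨az, bz, pz, qz, rz, xz, yz, nz⟩ := nbrs_three F z u dz mz.symm
    have k1 : ∃ c, ∀ x, F.Adj v x → x = u ∨ x = w ∨ x = c := by
      rcases nv w hadj with e | rfl | rfl
      · exact absurd e mw.ne.symm
      · exact ⟨bv, nv⟩
      · exact ⟨av, fun x hx => (nv x hx).imp_right Or.symm⟩
    have k2 : ∃ c, ∀ x, F.Adj w x → x = u ∨ x = v ∨ x = c := by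
      rcases nw v hadj.symm with e | rfl | rfl
      · exact absurd e mv.ne.symm
      · exact ⟨bw, nw⟩
      · exact ⟨aw, fun x hx => (nw x hx).imp_right Or.symm⟩
    obtain ⟨c, hc⟩ := k1
    obtain ⟨d, hd⟩ := k2
    exact not_three_adj F hV h u v w z c d az bz hvw hvz hwz hc hd nz mv mw mz hadj xz yz
      pz.symm qz.symm rz
  have m12 := adj v1 v2 v3 h12 h13 h23 m1 m2 m3 d1 d2 d3
  have m13 := adj v1 v3 v2 h13 h12 h23.symm m1 m3 m2 d1 d3 d2
  have m23 := adj v2 v3 v1 h23 h12.symm h13.symm m2 m3 m1 d2 d3 d1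
  have n1' := fun x hx => (n1 x hx).imp_right Or.symm
  have n2' := fun x hx => (n2 x hx).imp_right Or.symm
  have n3' := fun x hx => (n3 x hx).imp_right Or.symm
  have S := not_three_sdr F hV h u v1 v2 v3
  have z1 := S a1 b1 a2 b2 a3 b3 h12 h13 h23 n1 n2 n3 m12 m13 m23 x1 x2 x3
  have z2 := S a1 b1 a2 b2 b3 a3 h12 h13 h23 n1 n2 n3' m12 m13 m23 x1 x2 y3
  have z3 := S a1 b1 b2 a2 a3 b3 h12 h13 h23 n1 n2' n3 m12 m13 m23 x1 y2 x3
  have z4 := S a1 b1 b2 a2 b3 a3 h12 h13 h23 n1 n2' n3' m12 m13 m23 x1 y2 y3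
  have z5 := S b1 a1 a2 b2 a3 b3 h12 h13 h23 n1' n2 n3 m12 m13 m23 y1 x2 x3
  have z6 := S b1 a1 a2 b2 b3 a3 h12 h13 h23 n1' n2 n3' m12 m13 m23 y1 x2 y3
  have z7 := S b1 a1 b2 a2 a3 b3 h12 h13 h23 n1' n2' n3 m12 m13 m23 y1 y2 x3
  have z8 := S b1 a1 b2 a2 b3 a3 h12 h13 h23 n1' n2' n3' m12 m13 m23 y1 y2 y3
  clear S
  have same : (a2 = a1 ∧ b2 = b1 ∨ a2 = b1 ∧ b2 = a1) ∧ (a3 = a1 ∧ b3 = b1 ∨ a3 = b1 ∧ b3 = a1) := by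
    clear n1 n2 n3 n1' n2' n3' adj h hV x1 x2 x3 y1 y2 y3 m12 m13 m23 m1 m2 m3 d1 d2 d3
    grind
  obtain ⟨s2, s3⟩ := same
  have N2 : (∀ x, F.Adj v2 x → x = u ∨ x = a1 ∨ x = b1) ∧ F.Adj v2 b1 := by
    rcases s2 with ⟨rfl, rfl⟩ | ⟨rfl, rfl⟩
    · exact ⟨n2, y2⟩
    · exact ⟨n2', x2⟩
  have N3 : (∀ x, F.Adj v3 x → x = u ∨ x = a1 ∨ x = b1) := by
    rcases s3 with ⟨rfl, rfl⟩ | ⟨rfl, rfl⟩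
    · exact n3
    · exact n3'
  exact not_three_same F hV h u v1 v2 v3 a1 b1 h12 h13 h23 n1 N2.1 N3 m12 x1 N2.2 r1

/-- The adjacency relation of a graph on `Fin 9`, as a relation on the natural numbers. -/
def rel {n : Nat} (G : SimpleGraph (Fin n)) (i j : Nat) : Prop :=
  ∃ (hi : i < n) (hj : j < n), G.Adj ⟨i, hi⟩ ⟨j, hj⟩

theorem rel_symm {n : Nat} (G : SimpleGraph (Fin n)) (i j : Nat) (h : rel G i j) : rel G j i := by
  obtain ⟨hi, hj, h⟩ := h
  exact ⟨hj, hi, h.symm⟩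

/-- The number codes a matching. -/
def mOK (m : Nat × Nat) : Bool := decide (m.1 < 9 ∧ ∀ a b : Fin 9,
  m.2.testBit (9 * a.1 + b.1) = true → a ≠ b ∧ m.2.testBit (9 * b.1 + a.1) = true ∧
    ∀ c : Fin 9, m.2.testBit (9 * a.1 + c.1) = true → b = c)

theorem mcodes4_ok : mcodes4.all mOK = true := by decide +kernel

theorem mcodes5_ok : mcodes5.all mOK = true := by decide +kernel

theorem leafT_sound (G : SimpleGraph (Fin 9)) (ms : List (Nat × Nat)) (hms : ms.all mOK = true)
    (g u : Nat) (hg : Lo g (rel G)) (hu : Up u (rel G)) (h : leafT ms g u = true) :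
    ¬ Arrows G (pathGraph 3) (cycleGraph 9) := by
  intro harr
  have h : (ms.any fun m => Nat.beq (g &&& m.2) m.2 &&
    !dfs m.1 (u ^^^ m.2) 8 m.1 (511 ^^^ 2 ^ m.1)) = true := h
  rw [List.any_eq_true] at h
  obtain ⟨⟨root, m⟩, hm, h⟩ := h
  have hok := of_decide_eq_true (List.all_eq_true.1 hms _ hm)
  obtain ⟨hroot, hok⟩ := hok
  simp only at h hroot hok
  rw [Bool.and_eq_true, Nat.beq_eq, Bool.not_eq_true'] at h
  obtain ⟨hgm, hdfs⟩ := h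
  let R : SimpleGraph (Fin 9) :=
    { Adj := fun a b => m.testBit (9 * a.1 + b.1) = true
      symm := ⟨fun a b hab => (hok a b hab).2.1⟩
      loopless := ⟨fun a haa => (hok a a haa).1 rfl⟩ }
  have hR : R ≤ G := by
    intro a b hab
    have hab : m.testBit (9 * a.1 + b.1) = true := hab
    rw [← hgm, Nat.testBit_and, Bool.and_eq_true] at hab
    exact (hg a.1 b.1 a.2 b.2 hab.1).2.2
  obtain ⟨f, hf⟩ := ham_of_arrows G (by simp) harr R hR (by
    intro a b c hab hac
    exact (hok a b hab).2.2 c hac)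
  have hadj : ∀ i : Fin 9, (u ^^^ m).testBit (9 * (f i).1 + (f (i + 1)).1) = true := by
    intro i
    have h1 := hu (f i).1 (f (i + 1)).1 (f i).2 (f (i + 1)).2 ⟨(f i).2, (f (i + 1)).2, (hf i).1⟩
    have h2 : ¬ m.testBit (9 * (f i).1 + (f (i + 1)).1) = true := (hf i).2
    rw [Bool.not_eq_true] at h2
    rw [Nat.testBit_xor, h1, h2]
    rfl
  have hcast : ∀ i : Nat, Fin.ofNat 9 (i + 1) = Fin.ofNat 9 i + 1 := fun i => by
    apply Fin.ext
    simp [Fin.val_add]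
  have key : ∀ k < 9, ∀ l < 9, Fin.ofNat 9 k = Fin.ofNat 9 l → k = l := by
    decide
  have := dfs_sound root (u ^^^ m) 8 (fun i => (f (f.symm ⟨root, hroot⟩ + Fin.ofNat 9 i)).1)
    (511 ^^^ 2 ^ root) (Nat.xor_lt_two_pow (n := 9) (by norm_num)
      (Nat.pow_lt_pow_right (by norm_num) hroot)) (fun i => Fin.is_lt _) ?_ ?_ ?_ ?_
  · have h0 : Fin.ofNat 9 0 = 0 := rfl
    simp only [h0, add_zero, Equiv.apply_symm_apply] at this
    rw [this] at hdfs
    simp at hdfs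
  · intro i hi
    have h1 : root ≠ (f (f.symm ⟨root, hroot⟩ + Fin.ofNat 9 (i + 1))).1 := by
      intro he
      have he : (⟨root, hroot⟩ : Fin 9) = f (f.symm ⟨root, hroot⟩ + Fin.ofNat 9 (i + 1)) :=
        Fin.ext he
      have he := congrArg f.symm he
      rw [Equiv.symm_apply_apply] at he
      have he : Fin.ofNat 9 (i + 1) = Fin.ofNat 9 0 := by
        simpa using he
      have := key (i + 1) (by omega) 0 (by omega) he
      omega
    have h5 : ∀ k < 9, (511).testBit k = true := by decide
    rw [Nat.testBit_xor, Nat.testBit_two_pow, h5 _ (Fin.is_lt _),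
      decide_eq_false h1]
    rfl
  · intro i hi j hj he
    have he := f.injective (Fin.ext he)
    have he := add_left_cancel he
    have := key (i + 1) (by omega) (j + 1) (by omega) he
    omega
  · intro i hi
    have := hadj (f.symm ⟨root, hroot⟩ + Fin.ofNat 9 i)
    rwa [add_assoc, ← hcast] at this
  · have := hadj (f.symm ⟨root, hroot⟩ + Fin.ofNat 9 8)
    have h8 : Fin.ofNat 9 8 + 1 = 0 := by decide
    rw [add_assoc, h8, add_zero, Equiv.apply_symm_apply] at this
    exact this

/-! ## Small graphs of maximum degree at most two -/

theorem mem_prs (n a b : Nat) : (a, b) ∈ prs n ↔ a < b ∧ b < n := by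
  simp only [prs, List.mem_flatMap, List.mem_range, List.mem_map, Prod.mk.injEq]
  constructor
  · rintro ⟨i, hi, j, hj, rfl, rfl⟩
    exact ⟨hj, hi⟩
  · rintro ⟨h1, h2⟩
    exact ⟨b, h2, a, h1, rfl, rfl⟩

/-- The graph coded by `g`, relabelled by the list `p`. -/
def permuted (n g : Nat) (p : List Nat) : List (Nat × Nat) :=
  (prs n).filter fun e => tb g (Nat.add (Nat.mul 9 (p.getD e.1 0)) (p.getD e.2 0))

/-- Leaf test: the graph is isomorphic to a listed one. -/
noncomputable def leafC (n : Nat) (cs : List (List (Nat × Nat))) (g u : Nat) : Bool :=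
  Nat.beq g u && ((List.range n).permutations'.any fun p => force (code (permuted n g p)) fun k =>
    cs.any fun c => Nat.beq (code c) k)

theorem canon4_run : srch (fun _ => 0) (fun _ => 2) (leafC 4 canon4) (prs 4) 0 (code (prs 4)) = true := by
  decide +kernel

theorem canon5_run : srch (fun _ => 0) (fun _ => 2) (leafC 5 canon5) (prs 5) 0 (code (prs 5)) = true := by
  decide +kernel

theorem canon_sound (n : Nat) (hn : n ≤ 9) (cs : List (List (Nat × Nat)))
    (hcs : ∀ c ∈ cs, ∀ e ∈ c, e.1 < 9 ∧ e.2 < 9)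
    (hrun : srch (fun _ => 0) (fun _ => 2) (leafC n cs) (prs n) 0 (code (prs n)) = true)
    (H : SimpleGraph (Fin n)) (hH : ∀ i < 9, dg (rel H) i ≤ 2) :
    ∃ c ∈ cs, ∃ σ : Equiv.Perm (Fin n), ∀ i j : Fin n,
      H.Adj (σ i) (σ j) ↔ (i.1, j.1) ∈ c ∨ (j.1, i.1) ∈ c := by
  have hprs : ∀ e ∈ prs n, e.1 < 9 ∧ e.2 < 9 := by
    rintro ⟨a, b⟩ he
    rw [mem_prs] at he
    constructor <;> simp only <;> omega
  obtain ⟨g, u, hg, hu, hleaf⟩ := srch_sound (rel H) (rel_symm H) _ _ _ (by simp) hH (prs n) hprs 0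
    (code (prs n)) (by intro a b _ _ h; simp at h) (by
      rintro a b ha hb ⟨ha', hb', hab⟩
      rw [code_testBit _ hprs _ _ ha hb, mem_prs, mem_prs]
      have : a ≠ b := by rintro rfl; exact hab.ne rfl
      omega) hrun
  have hleaf : (Nat.beq g u && ((List.range n).permutations'.any fun p =>
    cs.any fun c => Nat.beq (code c) (code (permuted n g p)))) = true := hleaf
  rw [Bool.and_eq_true, Nat.beq_eq, List.any_eq_true] at hleaf
  obtain ⟨rfl, p, hp, hleaf⟩ := hleaf
  rw [List.any_eq_true] at hleaf
  obtain ⟨c, hc, hleaf⟩ := hleaf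
  rw [Nat.beq_eq] at hleaf
  rw [List.mem_permutations'] at hp
  have hlen : p.length = n := by rw [hp.length_eq, List.length_range]
  have hnd : p.Nodup := hp.nodup_iff.2 List.nodup_range
  have hlt : ∀ i : Fin n, p.getD i.1 0 < n := by
    intro i
    rw [List.getD_eq_getElem _ _ (by omega)]
    have := hp.subset (List.getElem_mem (l := p) (n := i.1) (by omega))
    simpa using this
  let s : Fin n → Fin n := fun i => ⟨p.getD i.1 0, hlt i⟩
  have hs : Function.Injective s := by
    intro i j hij
    have hij : p.getD i.1 0 = p.getD j.1 0 := congrArg Fin.val hij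
    rw [List.getD_eq_getElem _ _ (by omega), List.getD_eq_getElem _ _ (by omega)] at hij
    exact Fin.ext ((hnd.getElem_inj_iff).1 hij)
  refine ⟨c, hc, Equiv.ofBijective s (Finite.injective_iff_bijective.1 hs), fun i j => ?_⟩
  have hAg : ∀ a b : Fin n, g.testBit (9 * a.1 + b.1) = true ↔ H.Adj a b := by
    intro a b
    constructor
    · intro h
      exact (hg a.1 b.1 (by omega) (by omega) h).2.2
    · intro h
      exact hu a.1 b.1 (by omega) (by omega) ⟨a.2, b.2, h⟩
  have hmem : ∀ a b : Fin n, (a.1, b.1) ∈ permuted n g p ↔ a.1 < b.1 ∧ H.Adj (s a) (s b) := by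
    intro a b
    rw [permuted, List.mem_filter, mem_prs, tb_eq]
    have := hAg (s a) (s b)
    rw [← this]
    constructor
    · rintro ⟨⟨h1, _⟩, h2⟩
      exact ⟨h1, h2⟩
    · rintro ⟨h1, h2⟩
      exact ⟨⟨h1, b.2⟩, h2⟩
  rw [← code_testBit c (hcs c hc) i.1 j.1 (by omega) (by omega), hleaf,
    code_testBit (permuted n g p) (fun e he => hprs e (List.mem_of_mem_filter he)) i.1 j.1 (by omega) (by omega),
    hmem, hmem]
  simp only [Equiv.ofBijective_apply]
  constructor
  · intro h
    rcases lt_trichotomy i.1 j.1 with h1 | h1 | h1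
    · exact Or.inl ⟨h1, h⟩
    · exact absurd (congrArg s (Fin.ext h1)) h.ne
    · exact Or.inr ⟨h1, h.symm⟩
  · rintro (⟨_, h⟩ | ⟨_, h⟩)
    exacts [h, h.symm]

theorem canon4_lt : ∀ c ∈ canon4, ∀ e ∈ c, e.1 < 9 ∧ e.2 < 9 := by decide +kernel

theorem canon5_lt : ∀ c ∈ canon5, ∀ e ∈ c, e.1 < 9 ∧ e.2 < 9 := by decide +kernel

/-! ## The search applied to a labelled graph -/

theorem lsum_eq (f : Nat → Nat) (n : Nat) : lsum f (List.range n) = ∑ i ∈ Finset.range n, f i := by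
  have h : ∀ l : List Nat, lsum f l = (l.map f).sum := by
    intro l
    induction l with
    | nil => rfl
    | cons a l ih =>
      rw [List.map_cons, List.sum_cons, ← ih]
      rfl
  rw [h]
  induction n with
  | zero => rfl
  | succ n ih => rw [List.range_succ, List.map_append, List.sum_append, ih, Finset.sum_range_succ]; simp

theorem mem_bip (nd a b : Nat) (hnd : nd ≤ 9) : (a, b) ∈ bip nd ↔ a < nd ∧ nd ≤ b ∧ b < 9 := by
  simp only [bip, List.mem_flatMap, List.mem_range, List.mem_map, Prod.mk.injEq]
  constructor
  · rintro ⟨i, hi, j, hj, rfl, rfl⟩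
    omega
  · rintro ⟨h1, h2, h3⟩
    exact ⟨a, h1, b - nd, by omega, rfl, by omega⟩

theorem mem_coShift (nd a b : Nat) (cb : List (Nat × Nat)) : (a, b) ∈ coShift nd cb ↔
    nd ≤ a ∧ a < b ∧ b < nd + (9 - nd) ∧ (a - nd, b - nd) ∉ cb := by
  simp only [coShift, List.mem_map, List.mem_filter, Prod.mk.injEq, Prod.exists, mem_prs]
  constructor
  · rintro ⟨i, j, ⟨⟨h1, h2⟩, h3⟩, rfl, rfl⟩
    have h3 : (i, j) ∉ cb := by simpa using h3
    refine ⟨by omega, by omega, by omega, ?_⟩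
    simpa using h3
  · rintro ⟨h1, h2, h3, h4⟩
    refine ⟨a - nd, b - nd, ⟨⟨by omega, by omega⟩, ?_⟩, by omega, by omega⟩
    simpa using h4

open Classical in
theorem core (nd : Nat) (hnd : nd ≤ 9) (ms : List (Nat × Nat)) (hms : ms.all mOK = true)
    (t : Nat → Nat) (cd cb : List (Nat × Nat)) (hcd : ∀ e ∈ cd, e.1 < nd ∧ e.2 < nd)
    (hcb : ∀ e ∈ cb, e.1 < e.2)
    (hrun : run nd ms t (base nd cd cb) = true)
    (G : SimpleGraph (Fin 9)) (ht : ∀ i < 9, dg (rel G) i = t i)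
    (hD : ∀ i j, i < nd → j < nd → (rel G i j ↔ (i, j) ∈ cd ∨ (j, i) ∈ cd))
    (hB : ∀ i j, i < 9 - nd → j < 9 - nd → i ≠ j →
      (rel G (nd + i) (nd + j) ↔ ¬ ((i, j) ∈ cb ∨ (j, i) ∈ cb)))
    (h2 : ∀ b < 9 - nd, (∑ k ∈ Finset.range nd, if rel G (nd + b) k then 1 else 0) ≤ 2) :
    ¬ Arrows G (pathGraph 3) (cycleGraph 9) := by
  have hcd9 : ∀ e ∈ cd, e.1 < 9 ∧ e.2 < 9 := fun e he =>
    ⟨(hcd e he).1.trans_le hnd, (hcd e he).2.trans_le hnd⟩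
  have hco9 : ∀ e ∈ coShift nd cb, e.1 < 9 ∧ e.2 < 9 := by
    rintro ⟨a, b⟩ he
    rw [mem_coShift] at he
    constructor <;> simp only <;> omega
  have hne : ∀ a b, rel G a b → a ≠ b := by
    rintro a b ⟨_, _, h⟩ rfl
    exact h.ne rfl
  have hbase : ∀ a b, a < 9 → b < 9 → ((base nd cd cb).testBit (9 * a + b) = true ↔
      ((a < nd ∧ b < nd) ∨ (nd ≤ a ∧ nd ≤ b)) ∧ rel G a b) := by
    intro a b ha hb
    have h : base nd cd cb = code cd ||| code (coShift nd cb) := rfl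
    rw [h, Nat.testBit_or, Bool.or_eq_true, code_testBit _ hcd9 _ _ ha hb,
      code_testBit _ hco9 _ _ ha hb, mem_coShift, mem_coShift]
    constructor
    · rintro (h | h)
      · have : a < nd ∧ b < nd := by
          rcases h with h | h
          · exact hcd _ h
          · exact (hcd _ h).symm
        exact ⟨Or.inl this, (hD a b this.1 this.2).2 h⟩
      · have hab : nd ≤ a ∧ nd ≤ b ∧ a ≠ b := by omega
        refine ⟨Or.inr ⟨hab.1, hab.2.1⟩, ?_⟩
        have := hB (a - nd) (b - nd) (by omega) (by omega) (by omega)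
        rw [show nd + (a - nd) = a by omega, show nd + (b - nd) = b by omega] at this
        rw [this]
        rintro (h3 | h3)
        · have := hcb _ h3
          simp only at this
          rcases h with h | h
          · exact h.2.2.2 h3
          · omega
        · have := hcb _ h3
          simp only at this
          rcases h with h | h
          · omega
          · exact h.2.2.2 h3
    · rintro ⟨⟨h1, h3⟩ | ⟨h1, h3⟩, h4⟩
      · exact Or.inl ((hD a b h1 h3).1 h4)
      · right
        have hn := hne _ _ h4
        have := hB (a - nd) (b - nd) (by omega) (by omega) (by omega)
        rw [show nd + (a - nd) = a by omega, show nd + (b - nd) = b by omega] at this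
        rw [this] at h4
        push Not at h4
        rcases lt_or_gt_of_ne hn with h5 | h5
        · exact Or.inl ⟨h1, h5, by omega, h4.1⟩
        · exact Or.inr ⟨h3, h5, by omega, h4.2⟩
  have hsplit : ∀ f : Nat → Nat, ∑ k ∈ Finset.range 9, f k =
      ∑ k ∈ Finset.range nd, f k + ∑ k ∈ Finset.range (9 - nd), f (nd + k) := by
    intro f
    rw [← Finset.sum_range_add, Nat.add_sub_cancel' hnd]
  have hbt : ∀ a b, a < 9 → b < 9 → ((base nd cd cb).testBit (9 * a + b)).toNat =
      if ((a < nd ∧ b < nd) ∨ (nd ≤ a ∧ nd ≤ b)) ∧ rel G a b then 1 else 0 := by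
    intro a b ha hb
    have := hbase a b ha hb
    split_ifs with h
    · rw [this.2 h]; rfl
    · rw [← this, Bool.not_eq_true] at h
      rw [h]; rfl
  have hpD : ∀ i < nd, pop (base nd cd cb) i =
      ∑ k ∈ Finset.range nd, if rel G i k then 1 else 0 := by
    intro i hi
    have h0 : ∑ k ∈ Finset.range (9 - nd),
        ((base nd cd cb).testBit (9 * i + (nd + k))).toNat = 0 := by
      refine Finset.sum_eq_zero fun k hk => ?_
      have hk : k < 9 - nd := by simpa using hk
      rw [hbt _ _ (by omega) (by omega), if_neg]
      rintro ⟨h, _⟩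
      omega
    rw [pop_eq, hsplit, h0, add_zero]
    refine Finset.sum_congr rfl fun k hk => ?_
    have hk : k < nd := by simpa using hk
    rw [hbt _ _ (by omega) (by omega)]
    simp [hi, hk]
  have hpB : ∀ b < 9 - nd, pop (base nd cd cb) (nd + b) =
      ∑ k ∈ Finset.range (9 - nd), if rel G (nd + b) (nd + k) then 1 else 0 := by
    intro i hi
    have h0 : ∑ k ∈ Finset.range nd,
        ((base nd cd cb).testBit (9 * (nd + i) + k)).toNat = 0 := by
      refine Finset.sum_eq_zero fun k hk => ?_
      have hk : k < nd := by simpa using hk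
      rw [hbt _ _ (by omega) (by omega), if_neg]
      rintro ⟨h, _⟩
      omega
    rw [pop_eq, hsplit, h0, zero_add]
    refine Finset.sum_congr rfl fun k hk => ?_
    have hk : k < 9 - nd := by simpa using hk
    rw [hbt _ _ (by omega) (by omega)]
    simp
  have htD : ∀ i < nd, t i = pop (base nd cd cb) i +
      ∑ k ∈ Finset.range (9 - nd), if rel G i (nd + k) then 1 else 0 := by
    intro i hi
    rw [← ht i (by omega), dg, hsplit, hpD i hi]
  have htB : ∀ b < 9 - nd, t (nd + b) = (∑ k ∈ Finset.range nd, if rel G (nd + b) k then 1 else 0) +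
      pop (base nd cd cb) (nd + b) := by
    intro b hb
    rw [← ht (nd + b) (by omega), dg, hsplit, hpB b hb]
  have hcross : (∑ i ∈ Finset.range nd, ∑ k ∈ Finset.range (9 - nd),
        if rel G i (nd + k) then 1 else 0) =
      ∑ b ∈ Finset.range (9 - nd), ∑ k ∈ Finset.range nd, if rel G (nd + b) k then 1 else 0 := by
    rw [Finset.sum_comm]
    refine Finset.sum_congr rfl fun b _ => Finset.sum_congr rfl fun k _ => ?_
    have : rel G k (nd + b) ↔ rel G (nd + b) k := ⟨rel_symm G _ _, rel_symm G _ _⟩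
    simp only [this]
  have hbip : ∀ e ∈ bip nd, e.1 < 9 ∧ e.2 < 9 := by
    rintro ⟨a, b⟩ he
    rw [mem_bip _ _ _ hnd] at he
    constructor <;> simp only <;> omega
  have c1 : ((List.range (9 - nd)).all fun b =>
      Nat.ble (t (nd + b)) (pop (base nd cd cb) (nd + b) + 2)) = true := by
    rw [List.all_eq_true]
    intro b hb
    have hb : b < 9 - nd := by simpa using hb
    refine Nat.ble_eq_true_of_le ?_
    have := htB b hb
    have := h2 b hb
    omega
  have c2 : Nat.beq (lsum t (List.range nd) +
        lsum (fun b => pop (base nd cd cb) (nd + b)) (List.range (9 - nd)))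
      (lsum (fun b => t (nd + b)) (List.range (9 - nd)) +
        lsum (pop (base nd cd cb)) (List.range nd)) = true := by
    rw [Nat.beq_eq, lsum_eq, lsum_eq, lsum_eq, lsum_eq,
      Finset.sum_congr rfl fun i hi => htD i (by simpa using hi),
      Finset.sum_congr rfl fun i hi => htB i (by simpa using hi), Finset.sum_add_distrib,
      Finset.sum_add_distrib, hcross]
    ring
  have hrun : (!((List.range (9 - nd)).all fun b =>
      Nat.ble (t (nd + b)) (pop (base nd cd cb) (nd + b) + 2)) ||
    !(Nat.beq (lsum t (List.range nd) +
        lsum (fun b => pop (base nd cd cb) (nd + b)) (List.range (9 - nd)))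
      (lsum (fun b => t (nd + b)) (List.range (9 - nd)) +
        lsum (pop (base nd cd cb)) (List.range nd))) ||
    srch t t (leafT ms) (bip nd) (base nd cd cb) (base nd cd cb ||| code (bip nd))) = true := hrun
  rw [c1, c2] at hrun
  have hrun : srch t t (leafT ms) (bip nd) (base nd cd cb)
    (base nd cd cb ||| code (bip nd)) = true := by simpa using hrun
  obtain ⟨g', u', hg, hu, hleaf⟩ := srch_sound (rel G) (rel_symm G) t t (leafT ms)
    (fun i hi => (ht i hi).ge) (fun i hi => (ht i hi).le) (bip nd) hbip _ _
    (fun a b ha hb h => ((hbase a b ha hb).1 h).2) (by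
      intro a b ha hb h
      rw [Nat.testBit_or, Bool.or_eq_true, hbase a b ha hb, code_testBit _ hbip _ _ ha hb,
        mem_bip _ _ _ hnd, mem_bip _ _ _ hnd]
      by_cases h1 : a < nd <;> by_cases h3 : b < nd
      · exact Or.inl ⟨Or.inl ⟨h1, h3⟩, h⟩
      · right; omega
      · right; omega
      · exact Or.inl ⟨Or.inr ⟨by omega, by omega⟩, h⟩) hrun
  exact leafT_sound G ms hms g' u' hg hu hleaf

/-- Arrowing is monotone. -/
theorem arrows_mono {V : Type} (F F' : SimpleGraph V) (hF : F ≤ F')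
    (h : Arrows F (pathGraph 3) (cycleGraph 9)) : Arrows F' (pathGraph 3) (cycleGraph 9) := by
  intro R hR
  rcases h (R ⊓ F) inf_le_right with ⟨f, hf⟩ | ⟨f, hf⟩
  · exact Or.inl ⟨(Hom.ofLE inf_le_left).comp f, hf⟩
  · refine Or.inr ⟨(Hom.ofLE ?_).comp f, hf⟩
    intro a b hab
    exact ⟨hF hab.1, fun hr => hab.2 ⟨hr, hab.1⟩⟩

/-- Arrowing is invariant under relabelling. -/
theorem arrows_comap {V : Type} (F : SimpleGraph V) (x : Fin 9 ≃ V)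
    (h : Arrows F (pathGraph 3) (cycleGraph 9)) :
    Arrows (F.comap x) (pathGraph 3) (cycleGraph 9) := by
  intro R hR
  rcases h (R.comap x.symm) (by
    intro a b hab
    have := hR (show R.Adj (x.symm a) (x.symm b) from hab)
    simpa using this) with ⟨f, hf⟩ | ⟨f, hf⟩
  · exact Or.inl ⟨⟨fun i => x.symm (f i), fun hij => f.map_rel hij⟩,
      fun i j hij => hf (x.symm.injective hij)⟩
  · refine Or.inr ⟨⟨fun i => x.symm (f i), fun hij => ?_⟩,
      fun i j hij => hf (x.symm.injective hij)⟩
    have := f.map_rel hij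
    refine ⟨?_, this.2⟩
    have := this.1
    simpa using this

theorem exists_sixteen {V : Type} [Fintype V] (F : SimpleGraph V) (hV : Fintype.card V = 9)
    (hF : F.edgeSet.ncard < 17) : ∃ F' : SimpleGraph V, F ≤ F' ∧ F'.edgeSet.ncard = 16 := by
  classical
  have htop : (⊤ : SimpleGraph V).edgeFinset.card = 36 := by
    rw [card_edgeFinset_top_eq_card_choose_two, hV]; rfl
  have hF' : F.edgeFinset.card ≤ 16 := by
    rw [Set.ncard_eq_toFinset_card'] at hF
    exact Nat.le_of_lt_succ hF
  obtain ⟨S, h1, h2, h3⟩ := Finset.exists_subsuperset_card_eq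
    (edgeFinset_mono (le_top : F ≤ ⊤)) hF' (by rw [htop]; norm_num)
  have hS : (fromEdgeSet (S : Set (Sym2 V))).edgeSet = S := by
    rw [edgeSet_fromEdgeSet]
    ext e
    simp only [Set.mem_sdiff, Finset.mem_coe]
    refine ⟨fun h => h.1, fun h => ⟨h, ?_⟩⟩
    have := h2 h
    rw [mem_edgeFinset] at this
    exact not_isDiag_of_mem_edgeSet _ this
  refine ⟨fromEdgeSet S, ?_, ?_⟩
  · rw [← edgeSet_subset_edgeSet, hS]
    intro e he
    exact h1 (by simpa using he)
  · rw [hS, Set.ncard_coe_finset, h3]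

/-! ## Counting -/

open Classical in
theorem dg_eq_card (A : Nat → Nat → Prop) (i : Nat) :
    dg A i = ((Finset.range 9).filter (A i)).card := by
  rw [dg, Finset.card_filter]

open Classical in
theorem dg_comap {V : Type} [Fintype V] (F : SimpleGraph V) (x : Fin 9 ≃ V) (i : Fin 9) :
    dg (rel (F.comap x)) i.1 = F.degree (x i) := by
  rw [dg, Finset.sum_range, ← card_neighborFinset_eq_degree, neighborFinset_eq_filter,
    Finset.card_filter, ← x.sum_comp]
  refine Finset.sum_congr rfl fun k _ => ?_
  have : rel (F.comap x) i.1 k.1 ↔ F.Adj (x i) (x k) := by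
    constructor
    · rintro ⟨_, _, h⟩
      exact h
    · intro h
      exact ⟨i.2, k.2, h⟩
  simp only [this]

open Classical in
theorem nbrD_le {V : Type} [Fintype V] (F : SimpleGraph V) (hV : Fintype.card V = 9)
    (h : Arrows F (pathGraph 3) (cycleGraph 9)) (u : V) :
    ((F.neighborFinset u).filter fun v => F.degree v = 3).card ≤ 2 := by
  by_contra hcc
  push Not at hcc
  obtain ⟨a, ha, b, hb, c, hc, hab, hac, hbc⟩ := Finset.two_lt_card.1 hcc
  rw [Finset.mem_filter, mem_neighborFinset] at ha hb hc
  exact not_three F hV h u a b c hab hac hbc ha.1 hb.1 hc.1 ha.2 hb.2 hc.2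

open Classical in
/-- Vertices in `S` of large degree that are not adjacent to `u`. -/
theorem degree_add_le {V : Type} [Fintype V] (F : SimpleGraph V) (hV : Fintype.card V = 9)
    (h : Arrows F (pathGraph 3) (cycleGraph 9)) (u : V) (S : Finset V)
    (hS : ∀ v ∈ S, ¬ F.degree v = 3 ∧ ¬ F.Adj u v) :
    F.degree u + S.card ≤ 2 + Fintype.card {v // ¬ F.degree v = 3} := by
  have h1 := nbrD_le F hV h u
  have h2 : ((F.neighborFinset u).filter fun v => ¬ F.degree v = 3).card + S.card ≤
      Fintype.card {v // ¬ F.degree v = 3} := by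
    rw [Fintype.card_subtype, ← Finset.card_union_of_disjoint]
    · refine Finset.card_le_card fun v hv => ?_
      rw [Finset.mem_union, Finset.mem_filter] at hv
      rw [Finset.mem_filter]
      refine ⟨Finset.mem_univ _, ?_⟩
      rcases hv with hv | hv
      exacts [hv.2, (hS v hv).1]
    · rw [Finset.disjoint_left]
      intro v hv hv'
      rw [Finset.mem_filter, mem_neighborFinset] at hv
      exact (hS v hv').2 hv.1
  have := Finset.card_filter_add_card_filter_not (s := F.neighborFinset u)
    (fun v => F.degree v = 3)
  rw [card_neighborFinset_eq_degree] at this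
  omega

open Classical in
/-- Labelling of the vertices, for given numbers of vertices of degree three. -/
theorem labelling {V : Type} [Fintype V] (F : SimpleGraph V) (hV : Fintype.card V = 9)
    (h : Arrows F (pathGraph 3) (cycleGraph 9)) (nd nb : Nat) (hn : nd + nb = 9) (hnb : nb ≤ 5)
    (hd : Fintype.card {v // F.degree v = 3} = nd)
    (csd csb : List (List (Nat × Nat)))
    (hcsd : ∀ c ∈ csd, ∀ e ∈ c, e.1 < 9 ∧ e.2 < 9)
    (hrund : srch (fun _ => 0) (fun _ => 2) (leafC nd csd) (prs nd) 0 (code (prs nd)) = true)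
    (hcsb : ∀ c ∈ csb, ∀ e ∈ c, e.1 < 9 ∧ e.2 < 9)
    (hrunb : srch (fun _ => 0) (fun _ => 2) (leafC nb csb) (prs nb) 0 (code (prs nb)) = true) :
    ∃ x : Fin 9 ≃ V, (∀ i, i.1 < nd ↔ F.degree (x i) = 3) ∧
      (∃ cd ∈ csd, ∀ i j : Fin 9, i.1 < nd → j.1 < nd →
        (F.Adj (x i) (x j) ↔ (i.1, j.1) ∈ cd ∨ (j.1, i.1) ∈ cd)) ∧
      (∃ cb ∈ csb, ∀ i j : Fin 9, nd ≤ i.1 → nd ≤ j.1 → i ≠ j →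
        (F.Adj (x i) (x j) ↔ ¬ ((i.1 - nd, j.1 - nd) ∈ cb ∨ (j.1 - nd, i.1 - nd) ∈ cb))) := by
  have hb : Fintype.card {v // ¬ F.degree v = 3} = nb := by
    rw [Fintype.card_subtype_compl, hV, hd]; omega
  let e1 : Fin nd ≃ {v // F.degree v = 3} := (Fintype.equivFinOfCardEq hd).symm
  let e2 : Fin nb ≃ {v // ¬ F.degree v = 3} := (Fintype.equivFinOfCardEq hb).symm
  obtain ⟨cd, hcd, σ, hσ⟩ := canon_sound nd (by omega) csd hcsd hrund
    (F.comap fun i => (e1 i).1) (by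
      intro i _
      rw [dg_eq_card]
      by_contra hc
      push Not at hc
      obtain ⟨a, ha, b, hb, c, hc, hab, hac, hbc⟩ := Finset.two_lt_card.1 hc
      rw [Finset.mem_filter] at ha hb hc
      obtain ⟨_, hi, ha', ha⟩ := ha
      obtain ⟨_, _, hb', hb⟩ := hb
      obtain ⟨_, _, hc', hc⟩ := hc
      have inj : ∀ p q : Fin nd, p ≠ q → (e1 p).1 ≠ (e1 q).1 := fun p q hpq he =>
        hpq (e1.injective (Subtype.ext he))
      exact not_three F hV h _ _ _ _ (inj _ _ (by simpa using hab)) (inj _ _ (by simpa using hac))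
        (inj _ _ (by simpa using hbc)) ha hb hc (e1 _).2 (e1 _).2 (e1 _).2)
  obtain ⟨cb, hcb, τ, hτ⟩ := canon_sound nb (by omega) csb hcsb hrunb
    (Fᶜ.comap fun i => (e2 i).1) (by
      intro i _
      rw [dg_eq_card]
      by_contra hcc
      push Not at hcc
      obtain ⟨a, ha, b, hb, c, hc, hab, hac, hbc⟩ := Finset.two_lt_card.1 hcc
      rw [Finset.mem_filter] at ha hb hc
      obtain ⟨_, hi, ha', ha⟩ := ha
      obtain ⟨_, _, hb', hb⟩ := hb
      obtain ⟨_, _, hc', hc⟩ := hc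
      have inj : ∀ p q : Fin nb, p ≠ q → (e2 p).1 ≠ (e2 q).1 := fun p q hpq he =>
        hpq (e2.injective (Subtype.ext he))
      have iab := inj ⟨a, ha'⟩ ⟨b, hb'⟩ (by simpa using hab)
      have iac := inj ⟨a, ha'⟩ ⟨c, hc'⟩ (by simpa using hac)
      have ibc := inj ⟨b, hb'⟩ ⟨c, hc'⟩ (by simpa using hbc)
      have hdu := (e2 ⟨i, hi⟩).2
      have hda := (e2 ⟨a, ha'⟩).2
      have hdb := (e2 ⟨b, hb'⟩).2
      have hdc := (e2 ⟨c, hc'⟩).2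
      simp only [comap_adj] at ha hb hc
      generalize (e2 ⟨i, hi⟩).1 = u at *
      generalize (e2 ⟨a, ha'⟩).1 = p at *
      generalize (e2 ⟨b, hb'⟩).1 = q at *
      generalize (e2 ⟨c, hc'⟩).1 = r at *
      have hdeg : 4 ≤ F.degree u := by
        have := three_le_degree F hV h u
        omega
      have h4 : ({u, p, q, r} : Finset V).card = 4 := by
        rw [Finset.card_insert_of_notMem, Finset.card_eq_three.2 ⟨p, q, r, iab, iac, ibc, rfl⟩]
        simp only [Finset.mem_insert, Finset.mem_singleton]
        rintro (rfl | rfl | rfl)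
        exacts [ha.ne rfl, hb.ne rfl, hc.ne rfl]
      have := degree_add_le F hV h u {u, p, q, r} (by
        intro v hv
        simp only [Finset.mem_insert, Finset.mem_singleton] at hv
        rw [compl_adj] at ha hb hc
        rcases hv with rfl | rfl | rfl | rfl
        · exact ⟨hdu, fun h => h.ne rfl⟩
        · exact ⟨hda, ha.2⟩
        · exact ⟨hdb, hb.2⟩
        · exact ⟨hdc, hc.2⟩)
      omega)
  let x : Fin 9 ≃ V := ((finCongr hn.symm).trans (finSumFinEquiv.symm.trans
    (Equiv.sumCongr (σ.trans e1) (τ.trans e2)))).trans (Equiv.sumCompl fun v => F.degree v = 3)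
  have x1 : ∀ (i : Fin 9) (hi : i.1 < nd), x i = (e1 (σ ⟨i.1, hi⟩)).1 := by
    intro i hi
    have : finCongr hn.symm i = Fin.castAdd nb ⟨i.1, hi⟩ := Fin.ext rfl
    simp only [x, Equiv.trans_apply, this, finSumFinEquiv_symm_apply_castAdd, Equiv.sumCongr_apply,
      Sum.map_inl, Equiv.sumCompl_apply_inl]
  have x2 : ∀ (i : Fin 9) (hi : nd ≤ i.1), x i = (e2 (τ ⟨i.1 - nd, by omega⟩)).1 := by
    intro i hi
    have : finCongr hn.symm i = Fin.natAdd nd ⟨i.1 - nd, by omega⟩ :=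
      Fin.ext (by simp; omega)
    simp only [x, Equiv.trans_apply, this, finSumFinEquiv_symm_apply_natAdd, Equiv.sumCongr_apply,
      Sum.map_inr, Equiv.sumCompl_apply_inr]
  refine ⟨x, fun i => ?_, ⟨cd, hcd, fun i j hi hj => ?_⟩, ⟨cb, hcb, fun i j hi hj hij => ?_⟩⟩
  · constructor
    · intro hi
      rw [x1 i hi]
      exact (e1 _).2
    · intro hx
      by_contra hi
      push Not at hi
      rw [x2 i hi] at hx
      exact (e2 _).2 hx
  · rw [x1 i hi, x1 j hj, ← hσ ⟨i.1, hi⟩ ⟨j.1, hj⟩, comap_adj]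
  · rw [← hτ ⟨i.1 - nd, by omega⟩ ⟨j.1 - nd, by omega⟩, comap_adj, compl_adj, ← x2 i hi, ← x2 j hj]
    have : x i ≠ x j := fun he => hij (x.injective he)
    tauto

open Classical in
/-- Everything that is needed to start the search. -/
theorem labelled {V : Type} [Fintype V] (F : SimpleGraph V) (hV : Fintype.card V = 9)
    (h : Arrows F (pathGraph 3) (cycleGraph 9)) (nd nb : Nat) (hn : nd + nb = 9) (hnb : nb ≤ 5)
    (hd : Fintype.card {v // F.degree v = 3} = nd)
    (csd csb : List (List (Nat × Nat)))
    (hcsd : ∀ c ∈ csd, ∀ e ∈ c, e.1 < nd ∧ e.2 < nd)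
    (hrund : srch (fun _ => 0) (fun _ => 2) (leafC nd csd) (prs nd) 0 (code (prs nd)) = true)
    (hcsb : ∀ c ∈ csb, ∀ e ∈ c, e.1 < e.2 ∧ e.2 < 9)
    (hrunb : srch (fun _ => 0) (fun _ => 2) (leafC nb csb) (prs nb) 0 (code (prs nb)) = true)
    (ms : List (Nat × Nat)) (hms : ms.all mOK = true) :
    ∃ x : Fin 9 ≃ V, (∀ i, i.1 < nd ↔ F.degree (x i) = 3) ∧ ∃ cd ∈ csd, ∃ cb ∈ csb,
      ∀ t : Nat → Nat, (∀ i : Fin 9, F.degree (x i) = t i.1) →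
        ¬ run nd ms t (base nd cd cb) = true := by
  obtain ⟨x, hx, ⟨cd, hcd, hD⟩, ⟨cb, hcb, hB⟩⟩ := labelling F hV h nd nb hn hnb hd csd csb
    (fun c hc e he => by have := hcsd c hc e he; omega) hrund
    (fun c hc e he => by have := hcsb c hc e he; omega) hrunb
  refine ⟨x, hx, cd, hcd, cb, hcb, fun t ht hrun => ?_⟩
  refine core nd (by omega) ms hms t cd cb (hcsd cd hcd) (fun e he => (hcsb cb hcb e he).1) hrun
    (F.comap x) ?_ ?_ ?_ ?_ (arrows_comap F x h)
  · intro i hi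
    rw [dg_comap F x ⟨i, hi⟩, ht]
  · intro i j hi hj
    rw [← hD ⟨i, by omega⟩ ⟨j, by omega⟩ hi hj]
    exact ⟨fun h => h.2.2, fun h => ⟨by omega, by omega, h⟩⟩
  · intro i j hi hj hij
    have := hB ⟨nd + i, by omega⟩ ⟨nd + j, by omega⟩ (by simp) (by simp)
      (by simpa using hij)
    simp only [Nat.add_sub_cancel_left] at this
    rw [← this]
    exact ⟨fun h => h.2.2, fun h => ⟨by omega, by omega, h⟩⟩
  · intro b hb
    rw [← Finset.card_filter]
    by_contra hcc
    push Not at hcc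
    obtain ⟨p, hp, q, hq, r, hr, hpq, hpr, hqr⟩ := Finset.two_lt_card.1 hcc
    rw [Finset.mem_filter, Finset.mem_range] at hp hq hr
    obtain ⟨hp1, _, hp2, hp⟩ := hp
    obtain ⟨hq1, _, hq2, hq⟩ := hq
    obtain ⟨hr1, _, hr2, hr⟩ := hr
    have inj : ∀ i j : Fin 9, i.1 ≠ j.1 → x i ≠ x j := fun i j hij he =>
      hij (congrArg Fin.val (x.injective he))
    exact not_three F hV h _ _ _ _ (inj ⟨p, hp2⟩ ⟨q, hq2⟩ hpq) (inj ⟨p, hp2⟩ ⟨r, hr2⟩ hpr)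
      (inj ⟨q, hq2⟩ ⟨r, hr2⟩ hqr) hp hq hr ((hx _).1 hp1) ((hx _).1 hq1) ((hx _).1 hr1)

theorem canon4_bd : ∀ c ∈ canon4, ∀ e ∈ c, (e.1 < 4 ∧ e.2 < 4) ∧ (e.1 < e.2 ∧ e.2 < 9) := by
  decide +kernel

theorem canon5_bd : ∀ c ∈ canon5, ∀ e ∈ c, (e.1 < 5 ∧ e.2 < 5) ∧ (e.1 < e.2 ∧ e.2 < 9) := by
  decide +kernel

open Classical in
/-- The main lower bound for graphs with exactly 16 edges. -/
theorem not_arrows_sixteen {V : Type} [Fintype V] (F : SimpleGraph V) (hV : Fintype.card V = 9)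
    (hF : F.edgeSet.ncard = 16) : ¬ Arrows F (pathGraph 3) (cycleGraph 9) := by
  intro h
  have hsum : ∑ v, F.degree v = 32 := by
    rw [sum_degrees_eq_twice_card_edges]
    rw [Set.ncard_eq_toFinset_card'] at hF
    rw [edgeFinset, hF]
  obtain ⟨D, hD⟩ : ∃ D : Finset V, D = Finset.univ.filter fun v => F.degree v = 3 := ⟨_, rfl⟩
  obtain ⟨B, hB⟩ : ∃ B : Finset V, B = Finset.univ.filter fun v => ¬ F.degree v = 3 := ⟨_, rfl⟩
  have hDc : Fintype.card {v // F.degree v = 3} = D.card := by rw [hD, Fintype.card_subtype]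
  have hBc : Fintype.card {v // ¬ F.degree v = 3} = B.card := by rw [hB, Fintype.card_subtype]
  have hDB : D.card + B.card = 9 := by
    rw [hD, hB, Finset.card_filter_add_card_filter_not, Finset.card_univ, hV]
  have hsD : ∑ v ∈ D, F.degree v = 3 * D.card := by
    rw [Finset.sum_congr rfl (g := fun _ => 3), Finset.sum_const, smul_eq_mul, mul_comm]
    intro v hv
    rw [hD, Finset.mem_filter] at hv
    exact hv.2
  have hsDB : ∑ v ∈ D, F.degree v + ∑ v ∈ B, F.degree v = 32 := by
    rw [hD, hB, Finset.sum_filter_add_sum_filter_not, hsum]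
  have hmB : ∀ v, v ∈ B ↔ ¬ F.degree v = 3 := by
    intro v
    rw [hB, Finset.mem_filter]
    simp
  have hB4 : ∀ v ∈ B, 4 ≤ F.degree v := by
    intro v hv
    rw [hmB] at hv
    have := three_le_degree F hV h v
    omega
  have hBle : ∀ v ∈ B, F.degree v ≤ B.card + 1 := by
    intro v hv
    rw [hmB] at hv
    have := degree_add_le F hV h v {v} (by
      intro w hw
      rw [Finset.mem_singleton] at hw
      subst hw
      exact ⟨hv, fun h => h.ne rfl⟩)
    rw [Finset.card_singleton, hBc] at this
    omega
  have l1 := Finset.card_nsmul_le_sum B (fun v => F.degree v) 4 hB4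
  have l2 := Finset.sum_le_card_nsmul B (fun v => F.degree v) _ hBle
  rw [smul_eq_mul] at l1 l2
  have hb5 : B.card ≤ 5 := by omega
  have hb : B.card = 4 ∨ B.card = 5 := by
    generalize B.card = b at *
    interval_cases b <;> omega
  have erase : ∀ v ∈ B, F.degree v + 4 * (B.card - 1) ≤ ∑ v ∈ B, F.degree v := by
    intro v hv
    rw [← Finset.add_sum_erase B _ hv, ← Finset.card_erase_of_mem hv]
    have := Finset.card_nsmul_le_sum (B.erase v) (fun v => F.degree v) 4
      (fun w hw => hB4 w (Finset.mem_of_mem_erase hw))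
    rw [smul_eq_mul] at this
    omega
  rcases hb with hb | hb
  · -- four vertices of degree at least four
    have hB5 : ∃ v0 ∈ B, 5 ≤ F.degree v0 := by
      by_contra hc
      push Not at hc
      have := Finset.sum_le_card_nsmul B (fun v => F.degree v) 4
        (fun v hv => by have := hc v hv; omega)
      rw [smul_eq_mul] at this
      omega
    obtain ⟨v0, hv0, hd0⟩ := hB5
    have hd0' : F.degree v0 = 5 := by
      have := erase v0 hv0
      omega
    have hother : ∀ v ∈ B, v ≠ v0 → F.degree v = 4 := by
      intro v hv hne
      have h1 := Finset.add_sum_erase B (fun v => F.degree v) hv0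
      have hv' : v ∈ B.erase v0 := Finset.mem_erase.2 ⟨hne, hv⟩
      have h2 := Finset.add_sum_erase (B.erase v0) (fun v => F.degree v) hv'
      have h3 := Finset.card_nsmul_le_sum ((B.erase v0).erase v) (fun v => F.degree v) 4
        (fun w hw => hB4 w (Finset.mem_of_mem_erase (Finset.mem_of_mem_erase hw)))
      rw [Finset.card_erase_of_mem hv', Finset.card_erase_of_mem hv0, smul_eq_mul] at h3
      have := hB4 v hv
      omega
    obtain ⟨x, hx, cd, hcd, cb, hcb, hrun⟩ := labelled F hV h 5 4 rfl (by norm_num)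
      (by omega) canon5 canon4 (fun c hc e he => (canon5_bd c hc e he).1) canon5_run
      (fun c hc e he => (canon4_bd c hc e he).2) canon4_run mcodes5 mcodes5_ok
    have hi0 : ¬ (x.symm v0).1 < 5 := by
      rw [hx, x.apply_symm_apply]
      omega
    have hi9 := (x.symm v0).2
    refine hrun (t5 (x.symm v0).1) (fun i => ?_) ?_
    · by_cases hi : i.1 < 5
      · rw [(hx i).1 hi]
        have : Nat.ble 5 i.1 = false := by
          rw [← Bool.not_eq_true, Nat.ble_eq]; omega
        simp [t5, this]
      · have hiB : x i ∈ B := by rw [hmB, ← hx]; exact hi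
        have h5 : Nat.ble 5 i.1 = true := by rw [Nat.ble_eq]; omega
        by_cases hi0 : x i = v0
        · have : Nat.beq i.1 (x.symm v0).1 = true := by
            rw [Nat.beq_eq, ← hi0, x.symm_apply_apply]
          rw [hi0, hd0']
          simp [t5, this, h5]
        · have : Nat.beq i.1 (x.symm v0).1 = false := by
            rw [← Bool.not_eq_true, Nat.beq_eq]
            intro he
            apply hi0
            rw [Fin.ext he, x.apply_symm_apply]
          rw [hother _ hiB hi0]
          simp [t5, this, h5]
    · have hmem : (x.symm v0).1 ∈ [5, 6, 7, 8] := by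
        simp only [List.mem_cons, List.not_mem_nil, or_false]
        omega
      have h1 := List.all_eq_true.1 run5 _ hmem
      have h2 := List.all_eq_true.1 h1 cd hcd
      exact List.all_eq_true.1 h2 cb hcb
  · -- five vertices of degree at least four
    have hother : ∀ v ∈ B, F.degree v = 4 := by
      intro v hv
      have := erase v hv
      have := hB4 v hv
      omega
    obtain ⟨x, hx, cd, hcd, cb, hcb, hrun⟩ := labelled F hV h 4 5 rfl (by norm_num)
      (by omega) canon4 canon5 (fun c hc e he => (canon4_bd c hc e he).1) canon4_run
      (fun c hc e he => (canon5_bd c hc e he).2) canon5_run mcodes4 mcodes4_ok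
    refine hrun t4 (fun i => ?_) ?_
    · by_cases hi : i.1 < 4
      · rw [(hx i).1 hi]
        have : Nat.ble 4 i.1 = false := by
          rw [← Bool.not_eq_true, Nat.ble_eq]; omega
        simp [t4, this]
      · have hiB : x i ∈ B := by rw [hmB, ← hx]; exact hi
        have h5 : Nat.ble 4 i.1 = true := by rw [Nat.ble_eq]; omega
        rw [hother _ hiB]
        simp [t4, h5]
    · have h2 := List.all_eq_true.1 run4 cd hcd
      exact List.all_eq_true.1 h2 cb hcb

theorem stmt_9 :
    (∃ F : SimpleGraph (Fin 9), F.edgeSet.ncard = 17 ∧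
      Arrows F (pathGraph 3) (cycleGraph 9)) ∧
    (∀ (V : Type) [Fintype V] (F : SimpleGraph V), Fintype.card V = 9 →
      F.edgeSet.ncard < 17 → ¬ Arrows F (pathGraph 3) (cycleGraph 9)) := by
  refine ⟨⟨wGraph, wGraph_card, wGraph_arrows⟩, ?_⟩
  intro V _ F hV hF h
  obtain ⟨F', h1, h2⟩ := exists_sixteen F hV hF
  exact not_arrows_sixteen F' hV h2 (arrows_mono F F' h1 h)
end

section
/- The restricted size Ramsey number r*(P_3, C_10) equals 18: there exists a simple graph F on 10 vertices with 18 edges such that F → (P_3, C_10), and every simple graph on 10 vertices with fewer than 18 edges fails to arrow (P_3, C_10). -/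
open SimpleGraph

namespace RP

/-- bit test -/
def tb (x i : Nat) : Bool := Nat.beq (Nat.land (Nat.shiftRight x i) 1) 1

def enc : List Bool → Nat
  | [] => 0
  | b :: l => Nat.add (cond b 1 0) (Nat.mul 2 (enc l))

/-- bits allowed: x (row of the current vertex restricted to unvisited) -/
def stepD (ih : Nat → Nat → Bool) (x un : Nat) : Bool :=
  (tb x 1 && ih 1 (Nat.land un 1021)) || ((tb x 2 && ih 2 (Nat.land un 1019)) ||
  ((tb x 3 && ih 3 (Nat.land un 1015)) || ((tb x 4 && ih 4 (Nat.land un 1007)) ||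
  ((tb x 5 && ih 5 (Nat.land un 991)) || ((tb x 6 && ih 6 (Nat.land un 959)) ||
  ((tb x 7 && ih 7 (Nat.land un 895)) || ((tb x 8 && ih 8 (Nat.land un 767)) ||
  (tb x 9 && ih 9 (Nat.land un 511)))))))))

def force (n : Nat) (f : Nat → Bool) : Bool :=
  Nat.rec (f 0) (fun k _ => f (Nat.succ k)) n

def forceX (n : Nat) (f : Nat → Bool) : Bool :=
  Nat.rec false (fun k _ => f (Nat.succ k)) n

def dfs (N : Nat) : Nat → Nat → Nat → Bool
  | 0, v, _ => tb N (Nat.mul 10 v)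
  | k+1, v, un => force un fun un =>
      forceX (Nat.land (Nat.shiftRight N (Nat.mul 10 v)) un) fun x => stepD (dfs N k) x un

def allB (p : Bool → Bool) : Bool := p true && p false

def all1 (p : Bool → Bool → Bool → Bool → Bool) : Bool :=
  p true false false false && (p false true false false &&
  (p false false true false && p false false false true))
def all2 (p : Bool → Bool → Bool → Bool → Bool) : Bool :=
  p true true false false && (p true false true false && (p true false false true &&
  (p false true true false && (p false true false true && p false false true true))))
def all3 (p : Bool → Bool → Bool → Bool → Bool) : Bool :=
  p false true true true && (p true false true true &&
  (p true true false true && p true true true false))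

def allK : Nat → (Bool → Bool → Bool → Bool → Bool) → Bool
  | 1, p => all1 p
  | 2, p => all2 p
  | 3, p => all3 p
  | _, _ => false

def imp (a b : Bool) : Bool := cond a b true

/-- number of true values -/
def cnt : List Bool → Nat
  | [] => 0
  | b :: l => Nat.add (cond b 1 0) (cnt l)

def le2 (l : List Bool) : Bool := Nat.ble (cnt l) 2
def eq4 (l : List Bool) : Bool := Nat.beq (cnt l) 4

def kill (Ms : List Nat) (N : Nat) : Bool :=
  Ms.any fun M => !(force (Nat.land N M) fun N => dfs N 9 0 1022)


theorem tb_eq (x i : Nat) : tb x i = x.testBit i := by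
  have h : Nat.land (Nat.shiftRight x i) 1 = (x >>> i) % 2 := Nat.and_one_is_mod _
  unfold tb
  rw [h, Nat.testBit_eq_decide_div_mod_eq, Nat.shiftRight_eq_div_pow]
  rcases Nat.mod_two_eq_zero_or_one (x / 2 ^ i) with h' | h' <;> rw [h'] <;> rfl

theorem tb_land (x y i : Nat) : tb (Nat.land x y) i = (tb x i && tb y i) := by
  simp only [tb_eq]; exact Nat.testBit_and x y i

theorem tb_shift (x k i : Nat) : tb (Nat.shiftRight x k) i = tb x (k + i) := by
  simp only [tb_eq]; exact Nat.testBit_shiftRight x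

theorem tb_zero (i : Nat) : tb 0 i = false := by simp [tb_eq]

theorem tb_enc (l : List Bool) (k : Nat) : tb (enc l) k = l.getD k false := by
  induction l generalizing k with
  | nil => simp [enc, tb_zero]
  | cons b l ih =>
    have h : enc (b :: l) = Nat.bit b (enc l) := by
      cases b <;> simp [enc, Nat.bit] <;> omega
    rw [tb_eq, h]
    cases k with
    | zero => simp
    | succ k => rw [Nat.testBit_bit_succ, ← tb_eq, ih]; simp

theorem force_eq (n : Nat) (f : Nat → Bool) : force n f = f n := by
  cases n <;> rfl

theorem forceX_eq (n : Nat) (f : Nat → Bool) (hn : n ≠ 0) : forceX n f = f n := by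
  cases n with
  | zero => exact absurd rfl hn
  | succ k => rfl

theorem stepD_sound (ih : Nat → Nat → Bool) (x un w : Nat) (h1 : 1 ≤ w) (h9 : w < 10)
    (hx : tb x w = true) (hi : ih w (Nat.land un (1023 - 2 ^ w)) = true) :
    stepD ih x un = true := by
  unfold stepD
  interval_cases w <;> norm_num at hi <;> simp [hx, hi]

theorem tb_mask (w u : Nat) (hw : w < 10) (hu : u < 10) (h : u ≠ w) :
    tb (1023 - 2 ^ w) u = true := by
  interval_cases w <;> interval_cases u <;> first | rfl | exact absurd rfl h

theorem dfs_sound (N : Nat) (f : Nat → Nat) (hlt : ∀ i, i < 10 → f i < 10) (h0 : f 0 = 0)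
    (hinj : ∀ i j, i < 10 → j < 10 → f i = f j → i = j)
    (hadj : ∀ i, i < 9 → tb N (10 * f i + f (i+1)) = true)
    (hclose : tb N (10 * f 9) = true) :
    ∀ k, k ≤ 9 → ∀ un, (∀ j, 9 - k < j → j < 10 → tb un (f j) = true) →
      dfs N k (f (9 - k)) un = true := by
  intro k
  induction k with
  | zero => intro _ un _; exact hclose
  | succ k ih =>
    intro hk un hun
    obtain ⟨i, hi⟩ : ∃ i, i = 9 - (k+1) := ⟨_, rfl⟩
    have hi' : 9 - k = i + 1 := by omega
    have hw := hlt (i+1) (by omega)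
    have hw1 : 1 ≤ f (i+1) := by
      rcases Nat.eq_zero_or_pos (f (i+1)) with h | h
      · have := hinj (i+1) 0 (by omega) (by omega) (by rw [h, h0]); omega
      · exact h
    rw [← hi]
    have hx : tb (Nat.land (Nat.shiftRight N (Nat.mul 10 (f i))) un) (f (i+1)) = true := by
      rw [tb_land, tb_shift]
      have := hadj i (by omega)
      have h2 := hun (i+1) (by omega) (by omega)
      simp only [Bool.and_eq_true]
      exact ⟨this, h2⟩
    have hne : Nat.land (Nat.shiftRight N (Nat.mul 10 (f i))) un ≠ 0 := by
      intro h; rw [h, tb_zero] at hx; exact Bool.noConfusion hx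
    unfold dfs
    rw [force_eq, forceX_eq _ _ hne]
    refine stepD_sound _ _ _ (f (i+1)) hw1 hw hx ?_
    have := ih (by omega) (Nat.land un (1023 - 2 ^ f (i+1))) ?_
    · rwa [hi'] at this
    · intro j hj hj2
      rw [tb_land, hun j (by omega) hj2, tb_mask _ _ hw (hlt j hj2)]
      · rfl
      · intro h; have := hinj _ _ hj2 (by omega) h; omega

theorem allB_sound {p : Bool → Bool} (h : allB p = true) (b : Bool) : p b = true := by
  unfold allB at h; cases b <;> simp_all

theorem allK_sound {d : Nat} {p : Bool → Bool → Bool → Bool → Bool} (h : allK d p = true)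
    (a b c e : Bool) (hd : cnt [a, b, c, e] = d) : p a b c e = true := by
  subst hd
  cases a <;> cases b <;> cases c <;> cases e <;>
    simp_all [cnt, allK, all1, all2, all3]

theorem imp_sound {a b : Bool} (h : imp a b = true) (ha : a = true) : b = true := by
  subst ha; exact h

theorem kill_sound {Ms : List Nat} {N : Nat} (h : kill Ms N = true) :
    ∃ M ∈ Ms, dfs (Nat.land N M) 9 0 1022 = false := by
  unfold kill at h
  rw [List.any_eq_true] at h
  obtain ⟨M, hM, h⟩ := h
  rw [force_eq] at h
  exact ⟨M, hM, by simpa using h⟩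

/-- If the search fails there is no Hamiltonian cycle. -/
theorem dfs_false {N : Nat} (h : dfs N 9 0 1022 = false) (f : Fin 10 → Fin 10)
    (hinj : Function.Injective f)
    (hadj : ∀ i, tb N (10 * (f i).val + (f (i+1)).val) = true) : False := by
  obtain ⟨i0, hi0⟩ := (Finite.injective_iff_surjective.mp hinj) 0
  let g : Nat → Nat := fun n => (f (i0 + Fin.ofNat 10 n)).val
  have key := dfs_sound N g (fun i _ => (f _).isLt) (by simp [g, hi0]) ?_ ?_ ?_ 9 (by omega) 1022 ?_
  · have g0 : g 0 = 0 := by simp [g, hi0]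
    rw [show 9 - 9 = 0 from rfl, g0, h] at key
    exact Bool.noConfusion key
  · intro i j hi hj hij
    have h1 := hinj (Fin.ext hij)
    have h2 := add_left_cancel h1
    have h3 := congrArg Fin.val h2
    simp only [Fin.ofNat] at h3
    omega
  · intro i hi
    have := hadj (i0 + Fin.ofNat 10 i)
    have e : i0 + Fin.ofNat 10 i + 1 = i0 + Fin.ofNat 10 (i+1) := by
      rw [add_assoc]; congr 1; apply Fin.ext; simp [Fin.ofNat, Fin.val_add]
    rw [e] at this; exact this
  · have := hadj (i0 + Fin.ofNat 10 9)
    have e : i0 + Fin.ofNat 10 9 + 1 = i0 := by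
      rw [add_assoc]; exact add_zero _
    rw [e, hi0] at this; exact this
  · intro j hj hj2
    have h1 : g j < 10 := (f _).isLt
    have h2 : g j ≠ 0 := by
      intro hh
      have h3 : f (i0 + Fin.ofNat 10 j) = f i0 := by rw [hi0]; exact Fin.ext hh
      have h4 := hinj h3
      have h5 : Fin.ofNat 10 j = 0 := by simpa using h4
      have h6 := congrArg Fin.val h5
      simp [Fin.ofNat] at h6
      omega
    generalize g j = t at h1 h2
    interval_cases t <;> first | rfl | exact absurd rfl h2

/-! ### Shapes of graphs on six vertices -/

def deg6 (N v : Nat) : Nat :=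
  cnt [tb N (6*v), tb N (6*v+1), tb N (6*v+2), tb N (6*v+3), tb N (6*v+4), tb N (6*v+5)]

def pick (N : Nat) (vis : List Nat) (last : Nat) : Nat :=
  let un := [0,1,2,3,4,5].filter fun w => !vis.contains w
  match un.find? (fun w => tb N (6*last+w)) with
  | some w => w
  | none => match un.find? (fun w => Nat.beq (deg6 N w) 0) with
    | some w => w
    | none => match un.find? (fun w => Nat.beq (deg6 N w) 1) with
      | some w => w
      | none => un.headD 0

def walk (N : Nat) : Nat → List Nat → List Nat
  | 0, vis => vis
  | k+1, vis => walk N k (pick N vis (vis.headD 6) :: vis)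

def relabel (N : Nat) (o : Nat → Nat) : Nat :=
  enc (([0,1,2,3,4,5] : List Nat).flatMap fun i =>
    ([0,1,2,3,4,5] : List Nat).map fun j => tb N (6 * o i + o j))

def shapeCodes : List Nat := [17856241986, 18929983842, 22151331906, 26453483842, 20003727616, 26453487942]

def leaf (N : Nat) : Bool :=
  let l := (walk N 6 []).reverse
  (Nat.beq l.length 6 && (decide l.Nodup && l.all fun x => Nat.blt x 6)) &&
    shapeCodes.contains (relabel N fun i => l.getD i 0)

def chkL : Bool :=
  allB fun x01 => allB fun x02 => allB fun x03 => imp (le2 [x01,x02,x03]) <|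
  allB fun x04 => allB fun x05 => imp (le2 [x01,x02,x03,x04,x05]) <|
  allB fun x12 => allB fun x13 => allB fun x14 => allB fun x15 =>
  imp (le2 [x01,x12,x13,x14,x15]) <|
  allB fun x23 => allB fun x24 => allB fun x25 => imp (le2 [x02,x12,x23,x24,x25]) <|
  allB fun x34 => allB fun x35 => imp (le2 [x03,x13,x23,x34,x35]) <|
  allB fun x45 => imp (le2 [x04,x14,x24,x34,x45] && le2 [x05,x15,x25,x35,x45]) <|
  imp (Nat.ble 5 (cnt [x01,x02,x03,x04,x05,x12,x13,x14,x15,x23,x24,x25,x34,x35,x45])) <|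
  force (enc [false,x01,x02,x03,x04,x05,
    x01,false,x12,x13,x14,x15,
    x02,x12,false,x23,x24,x25,
    x03,x13,x23,false,x34,x35,
    x04,x14,x24,x34,false,x45,
    x05,x15,x25,x35,x45,false]) leaf

theorem chkL_true : chkL = true := by decide +kernel

theorem shape_exists (B : Fin 6 → Fin 6 → Bool) (hs : ∀ i j, B i j = B j i)
    (hi : ∀ i, B i i = false)
    (hdeg : ∀ i, cnt [B i 0, B i 1, B i 2, B i 3, B i 4, B i 5] ≤ 2)
    (hE : 5 ≤ cnt [B 0 1, B 0 2, B 0 3, B 0 4, B 0 5, B 1 2, B 1 3, B 1 4, B 1 5,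
      B 2 3, B 2 4, B 2 5, B 3 4, B 3 5, B 4 5]) :
    ∃ σ : Fin 6 ≃ Fin 6, ∃ s ∈ shapeCodes, ∀ i j : Fin 6,
      B (σ i) (σ j) = tb s (6 * i.val + j.val) := by
  have d0 := hdeg 0
  have d1 := hdeg 1
  have d2 := hdeg 2
  have d3 := hdeg 3
  have d4 := hdeg 4
  have d5 := hdeg 5
  simp only [cnt, hi, hs 1 0, hs 2 0, hs 2 1, hs 3 0, hs 3 1, hs 3 2, hs 4 0, hs 4 1, hs 4 2,
    hs 4 3, hs 5 0, hs 5 1, hs 5 2, hs 5 3, hs 5 4, Nat.add_eq, cond_false] at d0 d1 d2 d3 d4 d5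
  have h := chkL_true
  unfold chkL at h
  have h := allB_sound (allB_sound (allB_sound h (B 0 1)) (B 0 2)) (B 0 3)
  have h := imp_sound h (by simp only [le2, cnt, Nat.ble_eq, Nat.add_eq]; omega)
  have h := allB_sound (allB_sound h (B 0 4)) (B 0 5)
  have h := imp_sound h (by simp only [le2, cnt, Nat.ble_eq, Nat.add_eq]; omega)
  have h := allB_sound (allB_sound (allB_sound (allB_sound h (B 1 2)) (B 1 3)) (B 1 4)) (B 1 5)
  have h := imp_sound h (by simp only [le2, cnt, Nat.ble_eq, Nat.add_eq]; omega)
  have h := allB_sound (allB_sound (allB_sound h (B 2 3)) (B 2 4)) (B 2 5)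
  have h := imp_sound h (by simp only [le2, cnt, Nat.ble_eq, Nat.add_eq]; omega)
  have h := allB_sound (allB_sound h (B 3 4)) (B 3 5)
  have h := imp_sound h (by simp only [le2, cnt, Nat.ble_eq, Nat.add_eq]; omega)
  have h := allB_sound h (B 4 5)
  have h := imp_sound h (by
    simp only [le2, cnt, Nat.ble_eq, Nat.add_eq, Bool.and_eq_true]; omega)
  have h := imp_sound h (by rw [Nat.ble_eq]; exact hE)
  rw [force_eq] at h
  generalize hN : enc _ = N at h
  have hB : ∀ i j : Fin 6, tb N (6 * i.val + j.val) = B i j := by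
    intro i j
    rw [← hN, tb_enc]
    fin_cases i <;> fin_cases j <;> first | rfl | exact hs _ _ | exact (hi _).symm
  unfold leaf at h
  generalize hl : (walk N 6 []).reverse = l at h
  simp only [Bool.and_eq_true, Nat.beq_eq, decide_eq_true_eq, List.all_eq_true,
    List.contains_iff_mem] at h
  obtain ⟨⟨hlen, hnd, hlt⟩, hc⟩ := h
  have hlt' : ∀ i : Fin 6, l.getD i.val 0 < 6 := by
    intro i
    have hi : i.val < l.length := by omega
    rw [List.getD_eq_getElem _ _ hi]
    have := hlt _ (List.getElem_mem hi)
    simpa [Nat.blt_eq] using this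
  let o : Fin 6 → Fin 6 := fun i => ⟨l.getD i.val 0, hlt' i⟩
  have hinj : Function.Injective o := by
    intro i j hij
    have hij := congrArg Fin.val hij
    have hi : i.val < l.length := by omega
    have hj : j.val < l.length := by omega
    simp only [o] at hij
    rw [List.getD_eq_getElem _ _ hi, List.getD_eq_getElem _ _ hj] at hij
    exact Fin.ext ((hnd.getElem_inj_iff).mp hij)
  refine ⟨Equiv.ofBijective o (Finite.injective_iff_bijective.mp hinj), _, hc, ?_⟩
  intro i j
  simp only [Equiv.ofBijective_apply]
  rw [← hB, relabel, tb_enc]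
  fin_cases i <;> fin_cases j <;> rfl

/-! ### Four vertices of large degree -/

theorem four_label (B : Fin 4 → Fin 4 → Bool) (hs : ∀ i j, B i j = B j i)
    (hi : ∀ i, B i i = false) (hdeg : ∀ i, 2 ≤ cnt [B i 0, B i 1, B i 2, B i 3]) :
    ∃ σ : Fin 4 ≃ Fin 4, B (σ 0) (σ 1) = true ∧ B (σ 1) (σ 2) = true ∧
      B (σ 2) (σ 3) = true ∧ B (σ 0) (σ 3) = true := by
  have d0 := hdeg 0
  have d1 := hdeg 1
  have d2 := hdeg 2
  have d3 := hdeg 3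
  have s01 := hs 0 1
  have s02 := hs 0 2
  have s03 := hs 0 3
  have s12 := hs 1 2
  have s13 := hs 1 3
  have s23 := hs 2 3
  by_cases h1 : B 0 1 = true ∧ B 1 2 = true ∧ B 2 3 = true ∧ B 0 3 = true
  · exact ⟨Equiv.refl _, h1⟩
  by_cases h2 : B 0 2 = true ∧ B 2 1 = true ∧ B 1 3 = true ∧ B 0 3 = true
  · exact ⟨Equiv.swap 1 2, h2⟩
  by_cases h3 : B 0 1 = true ∧ B 1 3 = true ∧ B 3 2 = true ∧ B 0 2 = true
  · exact ⟨Equiv.swap 2 3, h3⟩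
  exfalso
  simp only [cnt, hi, ← s01, ← s02, ← s03, ← s12, ← s13, ← s23, Nat.add_eq, cond_false] at *
  generalize B 0 1 = x at *
  generalize B 0 2 = y at *
  generalize B 0 3 = z at *
  generalize B 1 2 = u at *
  generalize B 1 3 = v at *
  generalize B 2 3 = w at *
  revert x y z u v w
  decide

def chk (sh : Nat → Nat → Bool) (d0 d1 d2 d3 d4 d5 : Nat) (Ms : List Nat) : Bool :=
  allK d0 fun a0 a1 a2 a3 => allK d1 fun b0 b1 b2 b3 => allK d2 fun c0 c1 c2 c3 =>
  imp (le2 [a0,b0,c0] && (le2 [a1,b1,c1] && (le2 [a2,b2,c2] && le2 [a3,b3,c3]))) <|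
  allK d3 fun e0 e1 e2 e3 =>
  imp (le2 [a0,b0,c0,e0] && (le2 [a1,b1,c1,e1] && (le2 [a2,b2,c2,e2] && le2 [a3,b3,c3,e3]))) <|
  allK d4 fun f0 f1 f2 f3 =>
  imp (le2 [a0,b0,c0,e0,f0] && (le2 [a1,b1,c1,e1,f1] && (le2 [a2,b2,c2,e2,f2] && le2 [a3,b3,c3,e3,f3]))) <|
  allK d5 fun g0 g1 g2 g3 =>
  imp (le2 [a0,b0,c0,e0,f0,g0] && (le2 [a1,b1,c1,e1,f1,g1] && (le2 [a2,b2,c2,e2,f2,g2] && le2 [a3,b3,c3,e3,f3,g3]))) <|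
  allB fun h02 => imp (eq4 [a0,b0,c0,e0,f0,g0,true,h02,true] && eq4 [a2,b2,c2,e2,f2,g2,h02,true,true]) <|
  allB fun h13 => imp (eq4 [a1,b1,c1,e1,f1,g1,true,true,h13] && eq4 [a3,b3,c3,e3,f3,g3,true,h13,true]) <|
  force (enc [
    sh 0 0, sh 0 1, sh 0 2, sh 0 3, sh 0 4, sh 0 5, a0, a1, a2, a3,
    sh 1 0, sh 1 1, sh 1 2, sh 1 3, sh 1 4, sh 1 5, b0, b1, b2, b3,
    sh 2 0, sh 2 1, sh 2 2, sh 2 3, sh 2 4, sh 2 5, c0, c1, c2, c3,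
    sh 3 0, sh 3 1, sh 3 2, sh 3 3, sh 3 4, sh 3 5, e0, e1, e2, e3,
    sh 4 0, sh 4 1, sh 4 2, sh 4 3, sh 4 4, sh 4 5, f0, f1, f2, f3,
    sh 5 0, sh 5 1, sh 5 2, sh 5 3, sh 5 4, sh 5 5, g0, g1, g2, g3,
    a0, b0, c0, e0, f0, g0, false, true, h02, true,
    a1, b1, c1, e1, f1, g1, true, false, true, h13,
    a2, b2, c2, e2, f2, g2, h02, true, false, true,
    a3, b3, c3, e3, f3, g3, true, h13, true, false]) (kill Ms)

def msP6 : List Nat := [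
  1188267392387303668539524643837,
  950118904446091673667805117437,
  1267650600228211351913819533311,
  950118980151511311402196270077,
  1267650562448000501842555436991,
  950118978933972194521906151295,
  1228017100451968977897552609279,
  1266373898856990444203758583295]

theorem chkP6 : chk (fun i j => tb 17856241986 (Nat.add (Nat.mul 6 i) j)) 2 1 1 1 1 2 msP6 = true := by
  decide +kernel

def msC6 : List Nat := [
  1188267392387303668539524643837,
  950118904446091673667805117437,
  950118904446090556576867811295,
  1267650600228211351913819533311]

theorem chkC6 : chk (fun i j => tb 18929983842 (Nat.add (Nat.mul 6 i) j)) 1 1 1 1 1 1 msC6 = true := by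
  decide +kernel

def msP2C4 : List Nat := [
  950118980151524848572144024573,
  1267650524522773673405518445565,
  1267648182375432738320812867519,
  1267649391300085894271129812735,
  1265174718969062507816559312767,
  1266412657827756267374047526399,
  1265173511223834513904795909887,
  1267649388941222033019771944703,
  1267648181195980501933757300607,
  1266410242337286742376269479423]

theorem chkP2C4 : chk (fun i j => tb 22151331906 (Nat.add (Nat.mul 6 i) j)) 2 2 1 1 1 1 msP2C4 = true := by
  decide +kernel

def msP3C3 : List Nat := [
  1188267392387294670119183055869,
  1188267392387294670119180955647,
  950118904446073632898194337791,
  1188422437123669244731180710909]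

theorem chkP3C3 : chk (fun i j => tb 26453483842 (Nat.add (Nat.mul 6 i) j)) 2 1 2 1 1 1 msP3C3 = true := by
  decide +kernel

def msK1C5 : List Nat := [
  1267495555490692854217556619199,
  1267649315596969856559411592959,
  1267649315596969847750442057471,
  1267495555490710894987165298623]

theorem chkK1C5 : chk (fun i j => tb 20003727616 (Nat.add (Nat.mul 6 i) j)) 3 1 1 1 1 1 msK1C5 = true := by
  decide +kernel

def msC3C3 : List Nat := [
  1188267392387285627769914916859,
  950118904446073632898195390459,
  1188267392387294670119183055869,
  1188267392387303668539524643837]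

theorem chkC3C3 : chk (fun i j => tb 26453487942 (Nat.add (Nat.mul 6 i) j)) 1 1 1 1 1 1 msC3C3 = true := by
  decide +kernel

theorem chk_bool (sh : Nat → Nat → Bool) (d0 d1 d2 d3 d4 d5 : Nat) (Ms : List Nat)
    (h : chk sh d0 d1 d2 d3 d4 d5 Ms = true)
    (a0 a1 a2 a3 b0 b1 b2 b3 c0 c1 c2 c3 e0 e1 e2 e3 f0 f1 f2 f3 g0 g1 g2 g3 h02 h13 : Bool)
    (k0 : cnt [a0, a1, a2, a3] = d0)
    (k1 : cnt [b0, b1, b2, b3] = d1)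
    (k2 : cnt [c0, c1, c2, c3] = d2)
    (k3 : cnt [e0, e1, e2, e3] = d3)
    (k4 : cnt [f0, f1, f2, f3] = d4)
    (k5 : cnt [g0, g1, g2, g3] = d5)
    (r0 : cnt [a0, b0, c0, e0, f0, g0] ≤ 2)
    (r1 : cnt [a1, b1, c1, e1, f1, g1] ≤ 2)
    (r2 : cnt [a2, b2, c2, e2, f2, g2] ≤ 2)
    (r3 : cnt [a3, b3, c3, e3, f3, g3] ≤ 2)
    (q0 : cnt [a0, b0, c0, e0, f0, g0, true, h02, true] = 4)
    (q1 : cnt [a1, b1, c1, e1, f1, g1, true, true, h13] = 4)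
    (q2 : cnt [a2, b2, c2, e2, f2, g2, h02, true, true] = 4)
    (q3 : cnt [a3, b3, c3, e3, f3, g3, true, h13, true] = 4) :
    kill Ms (enc [
    sh 0 0, sh 0 1, sh 0 2, sh 0 3, sh 0 4, sh 0 5, a0, a1, a2, a3,
    sh 1 0, sh 1 1, sh 1 2, sh 1 3, sh 1 4, sh 1 5, b0, b1, b2, b3,
    sh 2 0, sh 2 1, sh 2 2, sh 2 3, sh 2 4, sh 2 5, c0, c1, c2, c3,
    sh 3 0, sh 3 1, sh 3 2, sh 3 3, sh 3 4, sh 3 5, e0, e1, e2, e3,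
    sh 4 0, sh 4 1, sh 4 2, sh 4 3, sh 4 4, sh 4 5, f0, f1, f2, f3,
    sh 5 0, sh 5 1, sh 5 2, sh 5 3, sh 5 4, sh 5 5, g0, g1, g2, g3,
    a0, b0, c0, e0, f0, g0, false, true, h02, true,
    a1, b1, c1, e1, f1, g1, true, false, true, h13,
    a2, b2, c2, e2, f2, g2, h02, true, false, true,
    a3, b3, c3, e3, f3, g3, true, h13, true, false]) = true := by
  have m3 : ∀ {x y z u v w : Bool}, cnt [x, y, z, u, v, w] ≤ 2 → le2 [x, y, z] = true := by
    intro x y z u v w hh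
    cases x <;> cases y <;> cases z <;> first | rfl | (cases u <;> cases v <;> cases w <;> exact absurd hh (by decide))
  have m4 : ∀ {x y z u v w : Bool}, cnt [x, y, z, u, v, w] ≤ 2 → le2 [x, y, z, u] = true := by
    intro x y z u v w hh
    cases x <;> cases y <;> cases z <;> cases u <;> first | rfl | (cases v <;> cases w <;> exact absurd hh (by decide))
  have m5 : ∀ {x y z u v w : Bool}, cnt [x, y, z, u, v, w] ≤ 2 → le2 [x, y, z, u, v] = true := by
    intro x y z u v w hh
    cases x <;> cases y <;> cases z <;> cases u <;> cases v <;> first | rfl | (cases w <;> exact absurd hh (by decide))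
  have m6 : ∀ {x y z u v w : Bool}, cnt [x, y, z, u, v, w] ≤ 2 → le2 [x, y, z, u, v, w] = true := by
    intro x y z u v w hh
    exact Nat.ble_eq.mpr hh
  have aa4 : ∀ {x y z w : Bool}, x = true → y = true → z = true → w = true →
      (x && (y && (z && w))) = true := by
    rintro _ _ _ _ rfl rfl rfl rfl
    rfl
  have aa2 : ∀ {x y : Bool}, x = true → y = true → (x && y) = true := by
    rintro _ _ rfl rfl
    rfl
  have m9 : ∀ {l : List Bool}, cnt l = 4 → eq4 l = true := by
    intro l hh
    exact Nat.beq_eq.mpr hh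
  unfold chk at h
  have h := allK_sound h a0 a1 a2 a3 k0
  have h := allK_sound h b0 b1 b2 b3 k1
  have h := allK_sound h c0 c1 c2 c3 k2
  have h := imp_sound h (aa4 (m3 r0) (m3 r1) (m3 r2) (m3 r3))
  have h := allK_sound h e0 e1 e2 e3 k3
  have h := imp_sound h (aa4 (m4 r0) (m4 r1) (m4 r2) (m4 r3))
  have h := allK_sound h f0 f1 f2 f3 k4
  have h := imp_sound h (aa4 (m5 r0) (m5 r1) (m5 r2) (m5 r3))
  have h := allK_sound h g0 g1 g2 g3 k5
  have h := imp_sound h (aa4 (m6 r0) (m6 r1) (m6 r2) (m6 r3))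
  have h := allB_sound h h02
  have h := imp_sound h (aa2 (m9 q0) (m9 q2))
  have h := allB_sound h h13
  have h := imp_sound h (aa2 (m9 q1) (m9 q3))
  rw [force_eq] at h
  exact h
theorem tb_tab (B : Fin 10 → Fin 10 → Bool) (i j : Fin 10) :
    tb (enc [
      B 0 0, B 0 1, B 0 2, B 0 3, B 0 4, B 0 5, B 0 6, B 0 7, B 0 8, B 0 9,
      B 1 0, B 1 1, B 1 2, B 1 3, B 1 4, B 1 5, B 1 6, B 1 7, B 1 8, B 1 9,
      B 2 0, B 2 1, B 2 2, B 2 3, B 2 4, B 2 5, B 2 6, B 2 7, B 2 8, B 2 9,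
      B 3 0, B 3 1, B 3 2, B 3 3, B 3 4, B 3 5, B 3 6, B 3 7, B 3 8, B 3 9,
      B 4 0, B 4 1, B 4 2, B 4 3, B 4 4, B 4 5, B 4 6, B 4 7, B 4 8, B 4 9,
      B 5 0, B 5 1, B 5 2, B 5 3, B 5 4, B 5 5, B 5 6, B 5 7, B 5 8, B 5 9,
      B 6 0, B 6 1, B 6 2, B 6 3, B 6 4, B 6 5, B 6 6, B 6 7, B 6 8, B 6 9,
      B 7 0, B 7 1, B 7 2, B 7 3, B 7 4, B 7 5, B 7 6, B 7 7, B 7 8, B 7 9,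
      B 8 0, B 8 1, B 8 2, B 8 3, B 8 4, B 8 5, B 8 6, B 8 7, B 8 8, B 8 9,
      B 9 0, B 9 1, B 9 2, B 9 3, B 9 4, B 9 5, B 9 6, B 9 7, B 9 8, B 9 9]) (10 * i.val + j.val) = B i j := by
  rw [tb_enc]
  fin_cases i <;> fin_cases j <;> rfl

theorem chk_sound (s d0 d1 d2 d3 d4 d5 : Nat) (Ms : List Nat)
    (h : chk (fun i j => tb s (Nat.add (Nat.mul 6 i) j)) d0 d1 d2 d3 d4 d5 Ms = true)
    (e0 : cnt [tb s 0, tb s 1, tb s 2, tb s 3, tb s 4, tb s 5] + d0 = 3)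
    (e1 : cnt [tb s 6, tb s 7, tb s 8, tb s 9, tb s 10, tb s 11] + d1 = 3)
    (e2 : cnt [tb s 12, tb s 13, tb s 14, tb s 15, tb s 16, tb s 17] + d2 = 3)
    (e3 : cnt [tb s 18, tb s 19, tb s 20, tb s 21, tb s 22, tb s 23] + d3 = 3)
    (e4 : cnt [tb s 24, tb s 25, tb s 26, tb s 27, tb s 28, tb s 29] + d4 = 3)
    (e5 : cnt [tb s 30, tb s 31, tb s 32, tb s 33, tb s 34, tb s 35] + d5 = 3)
    (B : Fin 10 → Fin 10 → Bool) (hs : ∀ i j, B i j = B j i) (hi : ∀ i, B i i = false)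
    (hL : ∀ i j : Fin 6, B (Fin.castAdd 4 i) (Fin.castAdd 4 j) = tb s (6 * i.val + j.val))
    (hdL : ∀ i : Fin 10, i.val < 6 → cnt [B i 0, B i 1, B i 2, B i 3, B i 4, B i 5,
      B i 6, B i 7, B i 8, B i 9] = 3)
    (hdH : ∀ i : Fin 10, 6 ≤ i.val → cnt [B i 0, B i 1, B i 2, B i 3, B i 4, B i 5,
      B i 6, B i 7, B i 8, B i 9] = 4)
    (hLH : ∀ i : Fin 10, 6 ≤ i.val → cnt [B i 0, B i 1, B i 2, B i 3, B i 4, B i 5] ≤ 2)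
    (h67 : B 6 7 = true) (h78 : B 7 8 = true) (h89 : B 8 9 = true) (h69 : B 6 9 = true) :
    ∃ M ∈ Ms, ∀ f : Fin 10 → Fin 10, Function.Injective f →
      ¬ ∀ i, B (f i) (f (i+1)) = true ∧ tb M (10 * (f i).val + (f (i+1)).val) = true := by
  have t00 : B 0 0 = tb s (Nat.add (Nat.mul 6 0) 0) := hL 0 0
  have t01 : B 0 1 = tb s (Nat.add (Nat.mul 6 0) 1) := hL 0 1
  have t02 : B 0 2 = tb s (Nat.add (Nat.mul 6 0) 2) := hL 0 2
  have t03 : B 0 3 = tb s (Nat.add (Nat.mul 6 0) 3) := hL 0 3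
  have t04 : B 0 4 = tb s (Nat.add (Nat.mul 6 0) 4) := hL 0 4
  have t05 : B 0 5 = tb s (Nat.add (Nat.mul 6 0) 5) := hL 0 5
  have t10 : B 1 0 = tb s (Nat.add (Nat.mul 6 1) 0) := hL 1 0
  have t11 : B 1 1 = tb s (Nat.add (Nat.mul 6 1) 1) := hL 1 1
  have t12 : B 1 2 = tb s (Nat.add (Nat.mul 6 1) 2) := hL 1 2
  have t13 : B 1 3 = tb s (Nat.add (Nat.mul 6 1) 3) := hL 1 3
  have t14 : B 1 4 = tb s (Nat.add (Nat.mul 6 1) 4) := hL 1 4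
  have t15 : B 1 5 = tb s (Nat.add (Nat.mul 6 1) 5) := hL 1 5
  have t20 : B 2 0 = tb s (Nat.add (Nat.mul 6 2) 0) := hL 2 0
  have t21 : B 2 1 = tb s (Nat.add (Nat.mul 6 2) 1) := hL 2 1
  have t22 : B 2 2 = tb s (Nat.add (Nat.mul 6 2) 2) := hL 2 2
  have t23 : B 2 3 = tb s (Nat.add (Nat.mul 6 2) 3) := hL 2 3
  have t24 : B 2 4 = tb s (Nat.add (Nat.mul 6 2) 4) := hL 2 4
  have t25 : B 2 5 = tb s (Nat.add (Nat.mul 6 2) 5) := hL 2 5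
  have t30 : B 3 0 = tb s (Nat.add (Nat.mul 6 3) 0) := hL 3 0
  have t31 : B 3 1 = tb s (Nat.add (Nat.mul 6 3) 1) := hL 3 1
  have t32 : B 3 2 = tb s (Nat.add (Nat.mul 6 3) 2) := hL 3 2
  have t33 : B 3 3 = tb s (Nat.add (Nat.mul 6 3) 3) := hL 3 3
  have t34 : B 3 4 = tb s (Nat.add (Nat.mul 6 3) 4) := hL 3 4
  have t35 : B 3 5 = tb s (Nat.add (Nat.mul 6 3) 5) := hL 3 5
  have t40 : B 4 0 = tb s (Nat.add (Nat.mul 6 4) 0) := hL 4 0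
  have t41 : B 4 1 = tb s (Nat.add (Nat.mul 6 4) 1) := hL 4 1
  have t42 : B 4 2 = tb s (Nat.add (Nat.mul 6 4) 2) := hL 4 2
  have t43 : B 4 3 = tb s (Nat.add (Nat.mul 6 4) 3) := hL 4 3
  have t44 : B 4 4 = tb s (Nat.add (Nat.mul 6 4) 4) := hL 4 4
  have t45 : B 4 5 = tb s (Nat.add (Nat.mul 6 4) 5) := hL 4 5
  have t50 : B 5 0 = tb s (Nat.add (Nat.mul 6 5) 0) := hL 5 0
  have t51 : B 5 1 = tb s (Nat.add (Nat.mul 6 5) 1) := hL 5 1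
  have t52 : B 5 2 = tb s (Nat.add (Nat.mul 6 5) 2) := hL 5 2
  have t53 : B 5 3 = tb s (Nat.add (Nat.mul 6 5) 3) := hL 5 3
  have t54 : B 5 4 = tb s (Nat.add (Nat.mul 6 5) 4) := hL 5 4
  have t55 : B 5 5 = tb s (Nat.add (Nat.mul 6 5) 5) := hL 5 5
  have k0 : cnt [B 0 6, B 0 7, B 0 8, B 0 9] = d0 := by
    have p := hdL 0 (by decide)
    have e : cnt [B 0 0, B 0 1, B 0 2, B 0 3, B 0 4, B 0 5] + d0 = 3 := by
      rw [t00, t01, t02, t03, t04, t05]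
      exact e0
    clear * - p e
    simp only [cnt, Nat.add_eq] at p e ⊢
    omega
  have k1 : cnt [B 1 6, B 1 7, B 1 8, B 1 9] = d1 := by
    have p := hdL 1 (by decide)
    have e : cnt [B 1 0, B 1 1, B 1 2, B 1 3, B 1 4, B 1 5] + d1 = 3 := by
      rw [t10, t11, t12, t13, t14, t15]
      exact e1
    clear * - p e
    simp only [cnt, Nat.add_eq] at p e ⊢
    omega
  have k2 : cnt [B 2 6, B 2 7, B 2 8, B 2 9] = d2 := by
    have p := hdL 2 (by decide)
    have e : cnt [B 2 0, B 2 1, B 2 2, B 2 3, B 2 4, B 2 5] + d2 = 3 := by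
      rw [t20, t21, t22, t23, t24, t25]
      exact e2
    clear * - p e
    simp only [cnt, Nat.add_eq] at p e ⊢
    omega
  have k3 : cnt [B 3 6, B 3 7, B 3 8, B 3 9] = d3 := by
    have p := hdL 3 (by decide)
    have e : cnt [B 3 0, B 3 1, B 3 2, B 3 3, B 3 4, B 3 5] + d3 = 3 := by
      rw [t30, t31, t32, t33, t34, t35]
      exact e3
    clear * - p e
    simp only [cnt, Nat.add_eq] at p e ⊢
    omega
  have k4 : cnt [B 4 6, B 4 7, B 4 8, B 4 9] = d4 := by
    have p := hdL 4 (by decide)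
    have e : cnt [B 4 0, B 4 1, B 4 2, B 4 3, B 4 4, B 4 5] + d4 = 3 := by
      rw [t40, t41, t42, t43, t44, t45]
      exact e4
    clear * - p e
    simp only [cnt, Nat.add_eq] at p e ⊢
    omega
  have k5 : cnt [B 5 6, B 5 7, B 5 8, B 5 9] = d5 := by
    have p := hdL 5 (by decide)
    have e : cnt [B 5 0, B 5 1, B 5 2, B 5 3, B 5 4, B 5 5] + d5 = 3 := by
      rw [t50, t51, t52, t53, t54, t55]
      exact e5
    clear * - p e
    simp only [cnt, Nat.add_eq] at p e ⊢
    omega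
  have r6 : cnt [B 0 6, B 1 6, B 2 6, B 3 6, B 4 6, B 5 6] ≤ 2 := by
    have p := hLH 6 (by decide)
    rw [hs 6 0, hs 6 1, hs 6 2, hs 6 3, hs 6 4, hs 6 5] at p
    exact p
  have q6 : cnt [B 0 6, B 1 6, B 2 6, B 3 6, B 4 6, B 5 6, true, B 6 8, true] = 4 := by
    have p := hdH 6 (by decide)
    rw [hs 6 0, hs 6 1, hs 6 2, hs 6 3, hs 6 4, hs 6 5, h67, h69, hi 6] at p
    clear * - p
    simp only [cnt, Nat.add_eq, cond_false, cond_true] at p ⊢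
    omega
  have r7 : cnt [B 0 7, B 1 7, B 2 7, B 3 7, B 4 7, B 5 7] ≤ 2 := by
    have p := hLH 7 (by decide)
    rw [hs 7 0, hs 7 1, hs 7 2, hs 7 3, hs 7 4, hs 7 5] at p
    exact p
  have q7 : cnt [B 0 7, B 1 7, B 2 7, B 3 7, B 4 7, B 5 7, true, true, B 7 9] = 4 := by
    have p := hdH 7 (by decide)
    rw [hs 7 0, hs 7 1, hs 7 2, hs 7 3, hs 7 4, hs 7 5, hs 7 6, h67, h78, hi 7] at p
    clear * - p
    simp only [cnt, Nat.add_eq, cond_false, cond_true] at p ⊢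
    omega
  have r8 : cnt [B 0 8, B 1 8, B 2 8, B 3 8, B 4 8, B 5 8] ≤ 2 := by
    have p := hLH 8 (by decide)
    rw [hs 8 0, hs 8 1, hs 8 2, hs 8 3, hs 8 4, hs 8 5] at p
    exact p
  have q8 : cnt [B 0 8, B 1 8, B 2 8, B 3 8, B 4 8, B 5 8, B 6 8, true, true] = 4 := by
    have p := hdH 8 (by decide)
    rw [hs 8 0, hs 8 1, hs 8 2, hs 8 3, hs 8 4, hs 8 5, hs 8 6, hs 8 7, h78, h89, hi 8] at p
    clear * - p
    simp only [cnt, Nat.add_eq, cond_false, cond_true] at p ⊢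
    omega
  have r9 : cnt [B 0 9, B 1 9, B 2 9, B 3 9, B 4 9, B 5 9] ≤ 2 := by
    have p := hLH 9 (by decide)
    rw [hs 9 0, hs 9 1, hs 9 2, hs 9 3, hs 9 4, hs 9 5] at p
    exact p
  have q9 : cnt [B 0 9, B 1 9, B 2 9, B 3 9, B 4 9, B 5 9, true, B 7 9, true] = 4 := by
    have p := hdH 9 (by decide)
    rw [hs 9 0, hs 9 1, hs 9 2, hs 9 3, hs 9 4, hs 9 5, hs 9 6, hs 9 7, hs 9 8, h69, h89, hi 9] at p
    clear * - p
    simp only [cnt, Nat.add_eq, cond_false, cond_true] at p ⊢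
    omega
  have h := chk_bool _ d0 d1 d2 d3 d4 d5 Ms h (B 0 6) (B 0 7) (B 0 8) (B 0 9) (B 1 6) (B 1 7) (B 1 8) (B 1 9) (B 2 6) (B 2 7) (B 2 8) (B 2 9) (B 3 6) (B 3 7) (B 3 8) (B 3 9) (B 4 6) (B 4 7) (B 4 8) (B 4 9) (B 5 6) (B 5 7) (B 5 8) (B 5 9)
    (B 6 8) (B 7 9) k0 k1 k2 k3 k4 k5 r6 r7 r8 r9 q6 q7 q8 q9
  have h' : kill Ms (enc [
      B 0 0, B 0 1, B 0 2, B 0 3, B 0 4, B 0 5, B 0 6, B 0 7, B 0 8, B 0 9,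
      B 1 0, B 1 1, B 1 2, B 1 3, B 1 4, B 1 5, B 1 6, B 1 7, B 1 8, B 1 9,
      B 2 0, B 2 1, B 2 2, B 2 3, B 2 4, B 2 5, B 2 6, B 2 7, B 2 8, B 2 9,
      B 3 0, B 3 1, B 3 2, B 3 3, B 3 4, B 3 5, B 3 6, B 3 7, B 3 8, B 3 9,
      B 4 0, B 4 1, B 4 2, B 4 3, B 4 4, B 4 5, B 4 6, B 4 7, B 4 8, B 4 9,
      B 5 0, B 5 1, B 5 2, B 5 3, B 5 4, B 5 5, B 5 6, B 5 7, B 5 8, B 5 9,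
      B 6 0, B 6 1, B 6 2, B 6 3, B 6 4, B 6 5, B 6 6, B 6 7, B 6 8, B 6 9,
      B 7 0, B 7 1, B 7 2, B 7 3, B 7 4, B 7 5, B 7 6, B 7 7, B 7 8, B 7 9,
      B 8 0, B 8 1, B 8 2, B 8 3, B 8 4, B 8 5, B 8 6, B 8 7, B 8 8, B 8 9,
      B 9 0, B 9 1, B 9 2, B 9 3, B 9 4, B 9 5, B 9 6, B 9 7, B 9 8, B 9 9]) = true := by
    rw [hs 6 0, hs 6 1, hs 6 2, hs 6 3, hs 6 4, hs 6 5, hs 7 0, hs 7 1, hs 7 2, hs 7 3, hs 7 4, hs 7 5, hs 7 6, hs 8 0, hs 8 1, hs 8 2, hs 8 3, hs 8 4, hs 8 5, hs 8 6, hs 8 7, hs 9 0, hs 9 1, hs 9 2, hs 9 3, hs 9 4, hs 9 5, hs 9 6, hs 9 7, hs 9 8, h67, h78, h89, h69,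
      hi 6, hi 7, hi 8, hi 9, t00, t01, t02, t03, t04, t05, t10, t11, t12, t13, t14, t15, t20, t21, t22, t23, t24, t25, t30, t31, t32, t33, t34, t35, t40, t41, t42, t43, t44, t45, t50, t51, t52, t53, t54, t55]
    exact h
  obtain ⟨M, hM, hd⟩ := kill_sound h'
  refine ⟨M, hM, fun f hf hadj => dfs_false hd f hf fun i => ?_⟩
  rw [tb_land, tb_tab, (hadj i).1, (hadj i).2]
  rfl
def allMs : List Nat := msP6 ++ (msC6 ++ (msP2C4 ++ (msP3C3 ++ (msK1C5 ++ (msC3C3)))))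

def okM (M : Nat) : Bool :=
  (List.range 10).all fun u => (List.range 10).all fun v =>
    cond (tb M (Nat.add (Nat.mul 10 u) v)) (tb M (Nat.add (Nat.mul 10 v) u))
      (!(tb M (Nat.add (Nat.mul 10 v) u)) && (List.range 10).all fun w =>
        tb M (Nat.add (Nat.mul 10 u) w) || Nat.beq v w)

theorem okM_sound {M : Nat} (h : okM M = true) (u v : Fin 10) :
    tb M (10 * u.val + v.val) = tb M (10 * v.val + u.val) ∧
    ∀ w : Fin 10, tb M (10 * u.val + v.val) = false → tb M (10 * u.val + w.val) = false →
      v = w := by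
  unfold okM at h
  rw [List.all_eq_true] at h
  have h := h u.val (List.mem_range.mpr u.isLt)
  rw [List.all_eq_true] at h
  have h := h v.val (List.mem_range.mpr v.isLt)
  simp only [Nat.add_eq, Nat.mul_eq] at h
  cases h1 : tb M (10 * u.val + v.val) with
  | true => 
    rw [h1, cond_true] at h
    exact ⟨h.symm, fun w hw => absurd hw (by decide)⟩
  | false =>
    rw [h1, cond_false, Bool.and_eq_true, List.all_eq_true] at h
    refine ⟨?_, fun w _ hw => ?_⟩
    · have := h.1
      cases h2 : tb M (10 * v.val + u.val)
      · rfl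
      · rw [h2] at this
        exact absurd this (by decide)
    · have := h.2 w.val (List.mem_range.mpr w.isLt)
      rw [hw, Bool.false_or, Nat.beq_eq] at this
      exact Fin.ext this

theorem allMs_ok : allMs.all okM = true := by
  decide +kernel

/-- every mask in the list removes a matching -/
theorem allMs_matching (M : Nat) (hM : M ∈ allMs) (u v : Fin 10) :
    tb M (10 * u.val + v.val) = tb M (10 * v.val + u.val) ∧
    ∀ w : Fin 10, tb M (10 * u.val + v.val) = false → tb M (10 * u.val + w.val) = false →
      v = w :=
  okM_sound (List.all_eq_true.mp allMs_ok M hM) u v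

theorem final_check (s : Nat) (hmem : s ∈ shapeCodes)
    (B : Fin 10 → Fin 10 → Bool) (hs : ∀ i j, B i j = B j i) (hi : ∀ i, B i i = false)
    (hL : ∀ i j : Fin 6, B (Fin.castAdd 4 i) (Fin.castAdd 4 j) = tb s (6 * i.val + j.val))
    (hdL : ∀ i : Fin 10, i.val < 6 → cnt [B i 0, B i 1, B i 2, B i 3, B i 4, B i 5,
      B i 6, B i 7, B i 8, B i 9] = 3)
    (hdH : ∀ i : Fin 10, 6 ≤ i.val → cnt [B i 0, B i 1, B i 2, B i 3, B i 4, B i 5,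
      B i 6, B i 7, B i 8, B i 9] = 4)
    (hLH : ∀ i : Fin 10, 6 ≤ i.val → cnt [B i 0, B i 1, B i 2, B i 3, B i 4, B i 5] ≤ 2)
    (h67 : B 6 7 = true) (h78 : B 7 8 = true) (h89 : B 8 9 = true) (h69 : B 6 9 = true) :
    ∃ M ∈ allMs, ∀ f : Fin 10 → Fin 10, Function.Injective f →
      ¬ ∀ i, B (f i) (f (i+1)) = true ∧ tb M (10 * (f i).val + (f (i+1)).val) = true := by
  simp only [shapeCodes, List.mem_cons, List.not_mem_nil, or_false] at hmem
  rcases hmem with rfl | rfl | rfl | rfl | rfl | rfl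
  · obtain ⟨M, hM, h⟩ := chk_sound 17856241986 2 1 1 1 1 2 msP6 chkP6
      (by decide) (by decide) (by decide)
      (by decide) (by decide) (by decide) B hs hi hL hdL hdH hLH h67 h78 h89 h69
    exact ⟨M, by simp only [allMs, List.mem_append]; tauto, h⟩
  · obtain ⟨M, hM, h⟩ := chk_sound 18929983842 1 1 1 1 1 1 msC6 chkC6
      (by decide) (by decide) (by decide)
      (by decide) (by decide) (by decide) B hs hi hL hdL hdH hLH h67 h78 h89 h69
    exact ⟨M, by simp only [allMs, List.mem_append]; tauto, h⟩
  · obtain ⟨M, hM, h⟩ := chk_sound 22151331906 2 2 1 1 1 1 msP2C4 chkP2C4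
      (by decide) (by decide) (by decide)
      (by decide) (by decide) (by decide) B hs hi hL hdL hdH hLH h67 h78 h89 h69
    exact ⟨M, by simp only [allMs, List.mem_append]; tauto, h⟩
  · obtain ⟨M, hM, h⟩ := chk_sound 26453483842 2 1 2 1 1 1 msP3C3 chkP3C3
      (by decide) (by decide) (by decide)
      (by decide) (by decide) (by decide) B hs hi hL hdL hdH hLH h67 h78 h89 h69
    exact ⟨M, by simp only [allMs, List.mem_append]; tauto, h⟩
  · obtain ⟨M, hM, h⟩ := chk_sound 20003727616 3 1 1 1 1 1 msK1C5 chkK1C5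
      (by decide) (by decide) (by decide)
      (by decide) (by decide) (by decide) B hs hi hL hdL hdH hLH h67 h78 h89 h69
    exact ⟨M, by simp only [allMs, List.mem_append]; tauto, h⟩
  · obtain ⟨M, hM, h⟩ := chk_sound 26453487942 1 1 1 1 1 1 msC3C3 chkC3C3
      (by decide) (by decide) (by decide)
      (by decide) (by decide) (by decide) B hs hi hL hdL hdH hLH h67 h78 h89 h69
    exact ⟨M, by simp only [allMs, List.mem_append]; tauto, h⟩

/-! ### Graph part of the lower bound -/

theorem ham {V : Type} {F : SimpleGraph V} (hA : Arrows F (pathGraph 3) (cycleGraph 10))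
    (R : SimpleGraph V) (hRF : R ≤ F) (hR : ∀ u v w, R.Adj u v → R.Adj u w → v = w) :
    ∃ f : Fin 10 → V, Function.Injective f ∧
      ∀ i, F.Adj (f i) (f (i+1)) ∧ ¬ R.Adj (f i) (f (i+1)) := by
  rcases hA R hRF with ⟨f, hf⟩ | ⟨f, hf⟩
  · exfalso
    have h10 : R.Adj (f 1) (f 0) := f.map_adj (by rw [pathGraph_adj]; decide)
    have h12 : R.Adj (f 1) (f 2) := f.map_adj (by rw [pathGraph_adj]; decide)
    have := hf (hR _ _ _ h10 h12)
    exact absurd this (by decide)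
  · refine ⟨f, hf, fun i => ?_⟩
    have h : (F \ R).Adj (f i) (f (i+1)) := f.map_adj (by
      rw [cycleGraph_adj]; right; simp)
    rw [SimpleGraph.sdiff_adj] at h
    exact h

/-- `C` is (the adjacency relation of) a spanning cycle of `F` avoiding `R`. -/
structure Cyc {V : Type} [Fintype V] (F : SimpleGraph V) (R C : V → V → Prop) : Prop where
  symm : ∀ u v, C u v → C v u
  sub : ∀ u v, C u v → F.Adj u v
  avoid : ∀ u v, C u v → ¬ R u v
  two : ∀ v, ∃ x y, x ≠ y ∧ C v x ∧ C v y ∧ ∀ z, C v z → z = x ∨ z = y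
  conn : ∀ S : Finset V, S.Nonempty → (∀ u ∈ S, ∀ v, C u v → v ∈ S) → S = Finset.univ

theorem cyc {V : Type} [Fintype V] {F : SimpleGraph V} (hV : Fintype.card V = 10)
    (hA : Arrows F (pathGraph 3) (cycleGraph 10))
    (R : V → V → Prop) (hRF : ∀ u v, R u v → F.Adj u v) (hs : ∀ u v, R u v → R v u)
    (hR : ∀ u v w, R u v → R u w → v = w) : ∃ C, Cyc F R C := by
  obtain ⟨f, hf, hadj⟩ := ham hA ⟨R, ⟨hs⟩, ⟨fun u hu => (hRF u u hu).ne rfl⟩⟩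
    (fun u v h => hRF u v h) hR
  have hsurj : Function.Surjective f :=
    ((Fintype.bijective_iff_injective_and_card f).mpr ⟨hf, by simp [hV]⟩).2
  refine ⟨fun u v => ∃ i, (u = f i ∧ v = f (i+1)) ∨ (v = f i ∧ u = f (i+1)),
    ?_, ?_, ?_, ?_, ?_⟩
  · rintro u v ⟨i, h⟩
    exact ⟨i, h.symm⟩
  · rintro u v ⟨i, ⟨rfl, rfl⟩ | ⟨rfl, rfl⟩⟩
    · exact (hadj i).1
    · exact (hadj i).1.symm
  · rintro u v ⟨i, ⟨rfl, rfl⟩ | ⟨rfl, rfl⟩⟩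
    · exact (hadj i).2
    · exact fun h => (hadj i).2 (hs _ _ h)
  · intro v
    obtain ⟨i, rfl⟩ := hsurj v
    refine ⟨f (i+1), f (i-1), ?_, ⟨i, Or.inl ⟨rfl, rfl⟩⟩, ⟨i-1, Or.inr ⟨rfl, by simp⟩⟩, ?_⟩
    · intro h
      have := hf h
      clear h
      revert this
      revert i
      decide
    · rintro z ⟨j, ⟨h, rfl⟩ | ⟨rfl, h⟩⟩
      · have := hf h
        subst this
        exact Or.inl rfl
      · have := hf h
        subst this
        right
        simp
  · intro S ⟨v, hv⟩ hS
    obtain ⟨i, rfl⟩ := hsurj v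
    have hall : ∀ n : Nat, f (i + Fin.ofNat 10 n) ∈ S := by
      intro n
      induction n with
      | zero => simpa using hv
      | succ n ih =>
        refine hS _ ih _ ⟨i + Fin.ofNat 10 n, Or.inl ⟨rfl, ?_⟩⟩
        congr 1
        rw [add_assoc]
        congr 1
        apply Fin.ext
        simp [Fin.add_def]
    ext w
    simp only [Finset.mem_univ, iff_true]
    obtain ⟨j, rfl⟩ := hsurj w
    have := hall (j - i).val
    simpa using this

theorem pairs_eq {V : Type} {a1 a2 b1 b2 c1 c2 : V}
    (key : ∀ x y z, (x = a1 ∨ x = a2) → (y = b1 ∨ y = b2) → (z = c1 ∨ z = c2) →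
      x = y ∨ x = z ∨ y = z) (da : a1 ≠ a2) (db : b1 ≠ b2) (dc : c1 ≠ c2) :
    ((b1 = a1 ∧ b2 = a2) ∨ (b1 = a2 ∧ b2 = a1)) ∧
    ((c1 = a1 ∧ c2 = a2) ∨ (c1 = a2 ∧ c2 = a1)) := by
  have k111 := key a1 b1 c1 (Or.inl rfl) (Or.inl rfl) (Or.inl rfl)
  have k112 := key a1 b1 c2 (Or.inl rfl) (Or.inl rfl) (Or.inr rfl)
  have k121 := key a1 b2 c1 (Or.inl rfl) (Or.inr rfl) (Or.inl rfl)
  have k122 := key a1 b2 c2 (Or.inl rfl) (Or.inr rfl) (Or.inr rfl)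
  have k211 := key a2 b1 c1 (Or.inr rfl) (Or.inl rfl) (Or.inl rfl)
  have k212 := key a2 b1 c2 (Or.inr rfl) (Or.inl rfl) (Or.inr rfl)
  have k221 := key a2 b2 c1 (Or.inr rfl) (Or.inr rfl) (Or.inl rfl)
  have k222 := key a2 b2 c2 (Or.inr rfl) (Or.inr rfl) (Or.inr rfl)
  clear key
  constructor <;> grind

section
variable {V : Type} [Fintype V] {F : SimpleGraph V}

theorem cyc1 (hV : Fintype.card V = 10) (hA : Arrows F (pathGraph 3) (cycleGraph 10))
    (a b : V) (h : F.Adj a b) :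
    ∃ R C, Cyc F R C ∧ R a b ∧ R b a := by
  obtain ⟨C, hC⟩ := cyc hV hA (fun u v => (u = a ∧ v = b) ∨ (u = b ∧ v = a))
    (by rintro u v (⟨rfl, rfl⟩ | ⟨rfl, rfl⟩); exacts [h, h.symm])
    (by tauto) (by have := h.ne; grind)
  exact ⟨_, C, hC, by tauto, by tauto⟩

theorem cyc2 (hV : Fintype.card V = 10) (hA : Arrows F (pathGraph 3) (cycleGraph 10))
    (a b c d : V) (h : F.Adj a b) (h' : F.Adj c d) (h1 : a ≠ c) (h2 : a ≠ d) (h3 : b ≠ c)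
    (h4 : b ≠ d) :
    ∃ R C, Cyc F R C ∧ R a b ∧ R b a ∧ R c d ∧ R d c := by
  obtain ⟨C, hC⟩ := cyc hV hA (fun u v => (u = a ∧ v = b) ∨ (u = b ∧ v = a) ∨
      (u = c ∧ v = d) ∨ (u = d ∧ v = c))
    (by rintro u v (⟨rfl, rfl⟩ | ⟨rfl, rfl⟩ | ⟨rfl, rfl⟩ | ⟨rfl, rfl⟩)
        exacts [h, h.symm, h', h'.symm])
    (by tauto) (by have := h.ne; have := h'.ne; grind)
  exact ⟨_, C, hC, by simp, by simp, by simp, by simp⟩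

theorem cyc3 (hV : Fintype.card V = 10) (hA : Arrows F (pathGraph 3) (cycleGraph 10))
    (a b c d p q : V) (h : F.Adj a b) (h' : F.Adj c d) (h'' : F.Adj p q)
    (h1 : a ≠ c) (h2 : a ≠ d) (h3 : b ≠ c) (h4 : b ≠ d)
    (h5 : a ≠ p) (h6 : a ≠ q) (h7 : b ≠ p) (h8 : b ≠ q)
    (h9 : c ≠ p) (h10 : c ≠ q) (h11 : d ≠ p) (h12 : d ≠ q) :
    ∃ R C, Cyc F R C ∧ R a b ∧ R b a ∧ R c d ∧ R d c ∧ R p q ∧ R q p := by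
  obtain ⟨C, hC⟩ := cyc hV hA (fun u v => (u = a ∧ v = b) ∨ (u = b ∧ v = a) ∨
      (u = c ∧ v = d) ∨ (u = d ∧ v = c) ∨ (u = p ∧ v = q) ∨ (u = q ∧ v = p))
    (by rintro u v (⟨rfl, rfl⟩ | ⟨rfl, rfl⟩ | ⟨rfl, rfl⟩ | ⟨rfl, rfl⟩ | ⟨rfl, rfl⟩ | ⟨rfl, rfl⟩)
        exacts [h, h.symm, h', h'.symm, h'', h''.symm])
    (by tauto) (by have := h.ne; have := h'.ne; have := h''.ne; grind)
  exact ⟨_, C, hC, by simp, by simp, by simp, by simp, by simp, by simp⟩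

/-- a vertex with neighbourhood `{x, y, z}` whose edge to `z` is not used -/
theorem Cyc.force {R C : V → V → Prop} (hC : Cyc F R C) {a x y z : V}
    (hN : ∀ w, F.Adj a w → w = x ∨ w = y ∨ w = z) (hz : ¬ C a z) : C a x ∧ C a y := by
  obtain ⟨p, q, hpq, hp, hq, -⟩ := hC.two a
  have h1 := hN p (hC.sub _ _ hp)
  have h2 := hN q (hC.sub _ _ hq)
  have h3 : p ≠ z := by rintro rfl; exact hz hp
  have h4 : q ≠ z := by rintro rfl; exact hz hq
  rcases h1 with rfl | rfl | rfl
  · rcases h2 with rfl | rfl | rfl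
    · exact absurd rfl hpq
    · exact ⟨hp, hq⟩
    · exact absurd rfl h4
  · rcases h2 with rfl | rfl | rfl
    · exact ⟨hq, hp⟩
    · exact absurd rfl hpq
    · exact absurd rfl h4
  · exact absurd rfl h3

theorem Cyc.only {R C : V → V → Prop} (hC : Cyc F R C) {a x y z : V}
    (hx : C a x) (hy : C a y) (hz : C a z) (hxy : x ≠ y) : z = x ∨ z = y := by
  obtain ⟨p, q, hpq, hp, hq, h⟩ := hC.two a
  have h1 := h x hx
  have h2 := h y hy
  have h3 := h z hz
  grind

theorem Cyc.no3 {R C : V → V → Prop} (hC : Cyc F R C) {v a b c : V}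
    (ha : C a v) (hb : C b v) (hc : C c v) (hab : a ≠ b) (hac : a ≠ c) (hbc : b ≠ c) : False := by
  rcases hC.only (hC.symm _ _ ha) (hC.symm _ _ hb) (hC.symm _ _ hc) hab with h | h
  · exact hac h.symm
  · exact hbc h.symm

theorem min_deg (hV : Fintype.card V = 10) (hA : Arrows F (pathGraph 3) (cycleGraph 10))
    (v x y : V) (h : ∀ w, F.Adj v w → w = x ∨ w = y) : False := by
  obtain ⟨C0, h0⟩ := cyc hV hA (fun _ _ => False) (by tauto) (by tauto) (by tauto)
  obtain ⟨p, -, -, hp, -, -⟩ := h0.two v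
  obtain ⟨R, C, hC, hR, -⟩ := cyc1 hV hA v p (h0.sub _ _ hp)
  obtain ⟨s, t, hst, hs, ht, -⟩ := hC.two v
  have h1 := h p (h0.sub _ _ hp)
  have h2 := h s (hC.sub _ _ hs)
  have h3 := h t (hC.sub _ _ ht)
  have h4 : s ≠ p := by rintro rfl; exact hC.avoid _ _ hs hR
  have h5 : t ≠ p := by rintro rfl; exact hC.avoid _ _ ht hR
  grind

/-- `N(a) = {v, x, y}` -/
structure Nb (F : SimpleGraph V) (a v x y : V) : Prop where
  iff : ∀ w, F.Adj a w ↔ w = v ∨ w = x ∨ w = y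
  h1 : v ≠ x
  h2 : v ≠ y
  h3 : x ≠ y

theorem Cyc.forceV {R C : V → V → Prop} (hC : Cyc F R C) {a v x y z : V}
    (hN : Nb F a v x y) (hz : F.Adj a z) (hzv : z ≠ v) (hR : R a z) : C a v := by
  have hz' : ¬ C a z := fun h => hC.avoid _ _ h hR
  rcases (hN.iff z).mp hz with rfl | rfl | rfl
  · exact absurd rfl hzv
  · exact (hC.force (x := v) (y := y) (z := z) (fun w hw => by
      have := (hN.iff w).mp hw; tauto) hz').1
  · exact (hC.force (x := v) (y := x) (z := z) (fun w hw => by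
      have := (hN.iff w).mp hw; tauto) hz').1

section
variable (hV : Fintype.card V = 10) (hA : Arrows F (pathGraph 3) (cycleGraph 10))
  {v a b c a1 a2 b1 b2 c1 c2 : V}
  (hab : a ≠ b) (hac : a ≠ c) (hbc : b ≠ c)
  (ha : Nb F a v a1 a2) (hb : Nb F b v b1 b2) (hc : Nb F c v c1 c2)
include hV hA hab hac hbc ha hb hc

theorem cover3 (x y z : V) (hx : F.Adj a x) (hy : F.Adj b y) (hz : F.Adj c z)
    (xv : x ≠ v) (yv : y ≠ v) (zv : z ≠ v) (xy : x ≠ y) (xz : x ≠ z) (yz : y ≠ z)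
    (nab : ¬ F.Adj a b) (nac : ¬ F.Adj a c) (nbc : ¬ F.Adj b c) : False := by
  obtain ⟨R, C, hC, h1, -, h2, -, h3, -⟩ := cyc3 hV hA a x b y c z hx hy hz hab
    (by rintro rfl; exact nab hy.symm) (by rintro rfl; exact nab hx) xy hac
    (by rintro rfl; exact nac hz.symm) (by rintro rfl; exact nac hx) xz hbc
    (by rintro rfl; exact nbc hz.symm) (by rintro rfl; exact nbc hy) yz
  exact hC.no3 (hC.forceV ha hx xv h1) (hC.forceV hb hy yv h2) (hC.forceV hc hz zv h3) hab hac hbc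

theorem cover2 (z : V) (h : F.Adj a b) (hz : F.Adj c z) (zv : z ≠ v) (za : z ≠ a) (zb : z ≠ b) :
    False := by
  have hav : F.Adj a v := (ha.iff v).mpr (Or.inl rfl)
  have hbv : F.Adj b v := (hb.iff v).mpr (Or.inl rfl)
  obtain ⟨R, C, hC, h1, h2, h3, -⟩ := cyc2 hV hA a b c z h hz hac za.symm hbc zb.symm
  exact hC.no3 (hC.forceV ha h hbv.ne h1) (hC.forceV hb h.symm hav.ne h2)
    (hC.forceV hc hz zv h3) hab hac hbc

theorem adj_case (h : F.Adj a b) : False := by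
  classical
  have hav : F.Adj a v := (ha.iff v).mpr (Or.inl rfl)
  have hbv : F.Adj b v := (hb.iff v).mpr (Or.inl rfl)
  have hcv : F.Adj c v := (hc.iff v).mpr (Or.inl rfl)
  have key : ∀ z, F.Adj c z → z ≠ v → z = a ∨ z = b := by
    intro z hz zv
    by_contra hcon
    push Not at hcon
    exact cover2 hV hA hab hac hbc ha hb hc z h hz zv hcon.1 hcon.2
  have k1 := key c1 ((hc.iff c1).mpr (by tauto)) hc.h1.symm
  have k2 := key c2 ((hc.iff c2).mpr (by tauto)) hc.h2.symm
  have k3 := hc.h3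
  have hca : F.Adj c a := (hc.iff a).mpr (by grind)
  have hcb : F.Adj c b := (hc.iff b).mpr (by grind)
  have Na : ∀ w, F.Adj a w → w = v ∨ w = c ∨ w = b := by
    intro w hw
    have e1 := (ha.iff w).mp hw
    have e2 := (ha.iff b).mp h
    have e3 := (ha.iff c).mp hca.symm
    have := hbv.ne
    have := hcv.ne
    grind
  have Nb' : ∀ w, F.Adj b w → w = v ∨ w = c ∨ w = a := by
    intro w hw
    have e1 := (hb.iff w).mp hw
    have e2 := (hb.iff a).mp h.symm
    have e3 := (hb.iff c).mp hcb.symm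
    have := hav.ne
    have := hcv.ne
    grind
  obtain ⟨R, C, hC, h1, h2⟩ := cyc1 hV hA a b h
  obtain ⟨p1, p2⟩ := hC.force Na (fun h => hC.avoid _ _ h h1)
  obtain ⟨q1, q2⟩ := hC.force Nb' (fun h => hC.avoid _ _ h h2)
  have hu := hC.conn {a, b, c, v} ⟨a, by simp⟩ (by
    intro u hu w hw
    simp only [Finset.mem_insert, Finset.mem_singleton] at hu ⊢
    rcases hu with rfl | rfl | rfl | rfl
    · have := hC.only p1 p2 hw hcv.ne.symm; tauto
    · have := hC.only q1 q2 hw hcv.ne.symm; tauto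
    · have := hC.only (hC.symm _ _ p2) (hC.symm _ _ q2) hw hab; tauto
    · have := hC.only (hC.symm _ _ p1) (hC.symm _ _ q1) hw hab; tauto)
  have h4 : ({a, b, c, v} : Finset V).card ≤ 4 := Finset.card_le_four
  rw [hu, Finset.card_univ, hV] at h4
  omega

theorem same_case (x y : V) (xy : x ≠ y)
    (Na : ∀ w, F.Adj a w ↔ w = v ∨ w = x ∨ w = y) (Nb' : ∀ w, F.Adj b w ↔ w = v ∨ w = x ∨ w = y)
    (Nc : ∀ w, F.Adj c w ↔ w = v ∨ w = x ∨ w = y) (xv : x ≠ v) (yv : y ≠ v)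
    (nab : ¬ F.Adj a b) : False := by
  classical
  have hax := (Na x).mpr (by tauto)
  have hby := (Nb' y).mpr (by tauto)
  obtain ⟨R, C, hC, h1, -, h2, -⟩ := cyc2 hV hA a x b y hax hby hab
    (by rintro rfl; exact nab hby.symm) (by rintro rfl; exact nab hax) xy
  obtain ⟨p1, p2⟩ := hC.force (a := a) (x := v) (y := y) (z := x)
    (fun w hw => by have := (Na w).mp hw; tauto) (fun h => hC.avoid _ _ h h1)
  obtain ⟨q1, q2⟩ := hC.force (a := b) (x := v) (y := x) (z := y)
    (fun w hw => by have := (Nb' w).mp hw; tauto) (fun h => hC.avoid _ _ h h2)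
  obtain ⟨r1, r2⟩ := hC.force (a := c) (x := x) (y := y) (z := v)
    (fun w hw => by have := (Nc w).mp hw; tauto) (fun h => hC.no3 p1 q1 h hab hac hbc)
  have hu := hC.conn {a, b, c, v, x, y} ⟨a, by simp⟩ (by
    intro u hu w hw
    simp only [Finset.mem_insert, Finset.mem_singleton] at hu ⊢
    rcases hu with rfl | rfl | rfl | rfl | rfl | rfl
    · have := hC.only p1 p2 hw yv.symm; tauto
    · have := hC.only q1 q2 hw xv.symm; tauto
    · have := hC.only r1 r2 hw xy; tauto
    · have := hC.only (hC.symm _ _ p1) (hC.symm _ _ q1) hw hab; tauto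
    · have := hC.only (hC.symm _ _ q2) (hC.symm _ _ r1) hw hbc; tauto
    · have := hC.only (hC.symm _ _ p2) (hC.symm _ _ r2) hw hac; tauto)
  have h4 : ({a, b, c, v, x, y} : Finset V).card ≤ 6 := Finset.card_le_six
  rw [hu, Finset.card_univ, hV] at h4
  omega

theorem three_nb : False := by
  by_cases nab : F.Adj a b
  · exact adj_case hV hA hab hac hbc ha hb hc nab
  by_cases nac : F.Adj a c
  · exact adj_case hV hA hac hab hbc.symm ha hc hb nac
  by_cases nbc : F.Adj b c
  · exact adj_case hV hA hbc hab.symm hac.symm hb hc ha nbc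
  have key : ∀ x y z, (x = a1 ∨ x = a2) → (y = b1 ∨ y = b2) → (z = c1 ∨ z = c2) →
      x = y ∨ x = z ∨ y = z := by
    intro x y z hx hy hz
    by_contra hcon
    push Not at hcon
    have xv : x ≠ v := by rcases hx with rfl | rfl; exacts [ha.h1.symm, ha.h2.symm]
    have yv : y ≠ v := by rcases hy with rfl | rfl; exacts [hb.h1.symm, hb.h2.symm]
    have zv : z ≠ v := by rcases hz with rfl | rfl; exacts [hc.h1.symm, hc.h2.symm]
    exact cover3 hV hA hab hac hbc ha hb hc x y z ((ha.iff x).mpr (Or.inr hx))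
      ((hb.iff y).mpr (Or.inr hy)) ((hc.iff z).mpr (Or.inr hz)) xv yv zv
      hcon.1 hcon.2.1 hcon.2.2 nab nac nbc
  have da := ha.h3
  obtain ⟨e1, e2⟩ := pairs_eq key da hb.h3 hc.h3
  refine same_case hV hA hab hac hbc ha hb hc a1 a2 da ha.iff ?_ ?_ ha.h1.symm ha.h2.symm nab
  · intro w
    rw [hb.iff]
    rcases e1 with ⟨rfl, rfl⟩ | ⟨rfl, rfl⟩ <;> tauto
  · intro w
    rw [hc.iff]
    rcases e2 with ⟨rfl, rfl⟩ | ⟨rfl, rfl⟩ <;> tauto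

end
end

section
variable {V : Type} [Fintype V] [DecidableEq V] {F : SimpleGraph V} [DecidableRel F.Adj]

theorem deg_ge (hV : Fintype.card V = 10) (hA : Arrows F (pathGraph 3) (cycleGraph 10))
    (v : V) : 3 ≤ F.degree v := by
  by_contra hlt
  have h2 : (F.neighborFinset v).card ≤ 2 := by
    rw [F.card_neighborFinset_eq_degree]; omega
  have : ∃ x y, ∀ w, F.Adj v w → w = x ∨ w = y := by
    have h3 : (F.neighborFinset v).card = 0 ∨ (F.neighborFinset v).card = 1 ∨
      (F.neighborFinset v).card = 2 := by omega
    rcases h3 with h | h | h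
    · rw [Finset.card_eq_zero] at h
      refine ⟨v, v, fun w hw => ?_⟩
      rw [← F.mem_neighborFinset, h] at hw
      exact absurd hw (Finset.notMem_empty _)
    · obtain ⟨x, hx⟩ := Finset.card_eq_one.mp h
      refine ⟨x, x, fun w hw => ?_⟩
      rw [← F.mem_neighborFinset, hx, Finset.mem_singleton] at hw
      exact Or.inl hw
    · obtain ⟨x, y, -, hx⟩ := Finset.card_eq_two.mp h
      refine ⟨x, y, fun w hw => ?_⟩
      rw [← F.mem_neighborFinset, hx, Finset.mem_insert, Finset.mem_singleton] at hw
      exact hw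
  obtain ⟨x, y, h⟩ := this
  exact min_deg hV hA v x y h

theorem nb_of_deg {a v : V} (hd : F.degree a = 3) (hav : F.Adj v a) :
    ∃ x y, Nb F a v x y := by
  have hm : v ∈ F.neighborFinset a := by rw [F.mem_neighborFinset]; exact hav.symm
  have h2 : ((F.neighborFinset a).erase v).card = 2 := by
    rw [Finset.card_erase_of_mem hm, F.card_neighborFinset_eq_degree, hd]
  obtain ⟨x, y, hxy, he⟩ := Finset.card_eq_two.mp h2
  have hx : x ∈ (F.neighborFinset a).erase v := by rw [he]; simp
  have hy : y ∈ (F.neighborFinset a).erase v := by rw [he]; simp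
  refine ⟨x, y, ⟨fun w => ?_, (Finset.ne_of_mem_erase hx).symm,
    (Finset.ne_of_mem_erase hy).symm, hxy⟩⟩
  rw [← F.mem_neighborFinset, ← Finset.insert_erase hm, he]
  simp

theorem low_nb (hV : Fintype.card V = 10) (hA : Arrows F (pathGraph 3) (cycleGraph 10))
    (v : V) : (Finset.univ.filter fun w => F.Adj v w ∧ F.degree w = 3).card ≤ 2 := by
  by_contra hlt
  push Not at hlt
  obtain ⟨a, b, c, ha, hb, hc, hab, hac, hbc⟩ := Finset.two_lt_card_iff.mp hlt
  simp only [Finset.mem_filter, Finset.mem_univ, true_and] at ha hb hc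
  obtain ⟨a1, a2, ha'⟩ := nb_of_deg ha.2 ha.1
  obtain ⟨b1, b2, hb'⟩ := nb_of_deg hb.2 hb.1
  obtain ⟨c1, c2, hc'⟩ := nb_of_deg hc.2 hc.1
  exact three_nb hV hA hab hac hbc ha' hb' hc'

theorem low_card (hV : Fintype.card V = 10) (hA : Arrows F (pathGraph 3) (cycleGraph 10))
    (hE : F.edgeFinset.card ≤ 17) :
    (Finset.univ.filter fun w => F.degree w = 3).card = 6 ∧
    ∀ v, F.degree v ≠ 3 → F.degree v = 4 := by
  have hsum := F.sum_degrees_eq_twice_card_edges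
  set T := Finset.univ.filter fun w => F.degree w = 3 with hT
  have hcard : T.card + Tᶜ.card = 10 := by rw [Finset.card_add_card_compl, hV]
  have hT3 : ∀ v ∈ T, F.degree v = 3 := fun v hv => (Finset.mem_filter.mp hv).2
  have hTc : ∀ v ∈ Tᶜ, F.degree v ≠ 3 := fun v hv h => by
    rw [Finset.mem_compl] at hv
    exact hv (Finset.mem_filter.mpr ⟨Finset.mem_univ _, h⟩)
  have hTc4 : ∀ v ∈ Tᶜ, 4 ≤ F.degree v := fun v hv => by
    have := deg_ge hV hA v
    have := hTc v hv
    omega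
  rw [← Finset.sum_add_sum_compl T, Finset.sum_congr rfl hT3, Finset.sum_const,
    smul_eq_mul] at hsum
  have h4 : Tᶜ.card * 4 ≤ ∑ v ∈ Tᶜ, F.degree v := by
    rw [← smul_eq_mul]
    exact Finset.card_nsmul_le_sum _ _ _ hTc4
  have hdc : T.card * 1 ≤ Tᶜ.card * 2 := by
    apply Finset.card_mul_le_card_mul F.Adj
    · intro a ha
      have h3 := hT3 a ha
      have hl := low_nb hV hA a
      have hsplit : (F.neighborFinset a) ⊆
          (Finset.univ.filter fun w => F.Adj a w ∧ F.degree w = 3) ∪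
          (Finset.bipartiteAbove F.Adj Tᶜ a) := by
        intro w hw
        rw [F.mem_neighborFinset] at hw
        by_cases hd : F.degree w = 3
        · simp [hw, hd]
        · apply Finset.mem_union_right
          simp [Finset.mem_bipartiteAbove, hT, hd, hw]
      have h5 := (Finset.card_le_card hsplit).trans (Finset.card_union_le _ _)
      rw [F.card_neighborFinset_eq_degree, h3] at h5
      omega
    · intro b hb
      refine le_trans (Finset.card_le_card ?_) (low_nb hV hA b)
      intro w hw
      rw [Finset.mem_bipartiteBelow] at hw
      simp only [Finset.mem_filter, Finset.mem_univ, true_and]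
      exact ⟨hw.2.symm, hT3 w hw.1⟩
  have h6 : T.card = 6 := by omega
  refine ⟨h6, fun v hv => ?_⟩
  have hle : ∑ v ∈ Tᶜ, F.degree v ≤ ∑ v ∈ Tᶜ, 4 := by
    rw [Finset.sum_const, smul_eq_mul]
    omega
  have heq := (Finset.sum_eq_sum_iff_of_le hTc4).mp
    (le_antisymm (by rw [Finset.sum_const, smul_eq_mul]; omega) hle)
  have hvm : v ∈ Tᶜ := by simp [hT, hv]
  exact (heq v hvm).symm

theorem cnt6 (p : Fin 6 → Bool) : cnt [p 0, p 1, p 2, p 3, p 4, p 5] =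
    (Finset.univ.filter fun i => p i = true).card := by
  rw [Finset.card_filter, Fin.sum_univ_six]
  simp only [cnt, Nat.add_eq, Bool.cond_eq_ite]
  omega

theorem cnt4 (p : Fin 4 → Bool) : cnt [p 0, p 1, p 2, p 3] =
    (Finset.univ.filter fun i => p i = true).card := by
  rw [Finset.card_filter, Fin.sum_univ_four]
  simp only [cnt, Nat.add_eq, Bool.cond_eq_ite]
  omega

theorem cnt_app (l m : List Bool) : cnt (l ++ m) = cnt l + cnt m := by
  induction l with
  | nil => simp [cnt]
  | cons b l ih => simp only [List.cons_append, cnt, Nat.add_eq, ih]; omega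

theorem cnt_low (g : Fin 6 ≃ {v : V // F.degree v = 3}) (v : V) :
    cnt [decide (F.Adj v (g 0)), decide (F.Adj v (g 1)), decide (F.Adj v (g 2)),
      decide (F.Adj v (g 3)), decide (F.Adj v (g 4)), decide (F.Adj v (g 5))] =
    (Finset.univ.filter fun w => F.Adj v w ∧ F.degree w = 3).card := by
  rw [cnt6 (fun i => decide (F.Adj v (g i)))]
  refine Finset.card_bij (fun i _ => (g i : V)) ?_ ?_ ?_
  · intro i hi
    simp only [Finset.mem_filter, Finset.mem_univ, true_and, decide_eq_true_eq] at hi ⊢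
    exact ⟨hi, (g i).2⟩
  · intro i _ j _ h
    exact g.injective (Subtype.ext h)
  · intro w hw
    simp only [Finset.mem_filter, Finset.mem_univ, true_and] at hw
    refine ⟨g.symm ⟨w, hw.2⟩, ?_, ?_⟩ <;> simp [hw]

theorem cnt_high (g : Fin 4 ≃ {v : V // ¬ F.degree v = 3}) (v : V) :
    cnt [decide (F.Adj v (g 0)), decide (F.Adj v (g 1)), decide (F.Adj v (g 2)),
      decide (F.Adj v (g 3))] =
    (Finset.univ.filter fun w => F.Adj v w ∧ ¬ F.degree w = 3).card := by
  rw [cnt4 (fun i => decide (F.Adj v (g i)))]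
  refine Finset.card_bij (fun i _ => (g i : V)) ?_ ?_ ?_
  · intro i hi
    simp only [Finset.mem_filter, Finset.mem_univ, true_and, decide_eq_true_eq] at hi ⊢
    exact ⟨hi, (g i).2⟩
  · intro i _ j _ h
    exact g.injective (Subtype.ext h)
  · intro w hw
    simp only [Finset.mem_filter, Finset.mem_univ, true_and] at hw
    refine ⟨g.symm ⟨w, hw.2⟩, ?_, ?_⟩ <;> simp [hw]

theorem deg_split (v : V) : (Finset.univ.filter fun w => F.Adj v w ∧ F.degree w = 3).card +
    (Finset.univ.filter fun w => F.Adj v w ∧ ¬ F.degree w = 3).card = F.degree v := by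
  rw [← F.card_neighborFinset_eq_degree, F.neighborFinset_eq_filter,
    ← Finset.card_filter_add_card_filter_not (s := Finset.univ.filter (F.Adj v))
      (fun w => F.degree w = 3), Finset.filter_filter, Finset.filter_filter]

theorem edge_count (a : Fin 6 → Fin 6 → Bool) (b : Fin 6 → Fin 4 → Bool)
    (hs : ∀ i j, a i j = a j i) (hi : ∀ i, a i i = false)
    (hd : ∀ i, cnt [a i 0, a i 1, a i 2, a i 3, a i 4, a i 5] +
      cnt [b i 0, b i 1, b i 2, b i 3] = 3)
    (hh : ∀ k, cnt [b 0 k, b 1 k, b 2 k, b 3 k, b 4 k, b 5 k] ≤ 2) :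
    5 ≤ cnt [a 0 1, a 0 2, a 0 3, a 0 4, a 0 5, a 1 2, a 1 3, a 1 4, a 1 5,
      a 2 3, a 2 4, a 2 5, a 3 4, a 3 5, a 4 5] := by
  have d0 := hd 0
  have d1 := hd 1
  have d2 := hd 2
  have d3 := hd 3
  have d4 := hd 4
  have d5 := hd 5
  have h0 := hh 0
  have h1 := hh 1
  have h2 := hh 2
  have h3 := hh 3
  rw [hi] at d0 d1 d2 d3 d4 d5
  rw [hs 1 0] at d1
  rw [hs 2 0, hs 2 1] at d2
  rw [hs 3 0, hs 3 1, hs 3 2] at d3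
  rw [hs 4 0, hs 4 1, hs 4 2, hs 4 3] at d4
  rw [hs 5 0, hs 5 1, hs 5 2, hs 5 3, hs 5 4] at d5
  clear hs hi hd hh
  simp only [cnt, Nat.add_eq, cond_false] at d0 d1 d2 d3 d4 d5 h0 h1 h2 h3 ⊢
  linarith

end

theorem lower {V : Type} [Fintype V] (F : SimpleGraph V) (hV : Fintype.card V = 10)
    (hE : F.edgeSet.ncard < 18) (hA : Arrows F (pathGraph 3) (cycleGraph 10)) : False := by
  classical
  have hE' : F.edgeFinset.card ≤ 17 := by
    rw [Set.ncard_eq_toFinset_card'] at hE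
    exact Nat.lt_succ_iff.mp hE
  obtain ⟨h6, h4⟩ := low_card hV hA hE'
  have c6 : Fintype.card {v : V // F.degree v = 3} = 6 := by
    rw [Fintype.card_subtype]; exact h6
  have c4 : Fintype.card {v : V // ¬ F.degree v = 3} = 4 := by
    rw [Fintype.card_subtype_compl, c6, hV]
  let eS : Fin 6 ≃ {v : V // F.degree v = 3} := (Fintype.equivFinOfCardEq c6).symm
  let eH : Fin 4 ≃ {v : V // ¬ F.degree v = 3} := (Fintype.equivFinOfCardEq c4).symm
  have hdeg : ∀ v, (Finset.univ.filter fun w => F.Adj v w ∧ F.degree w = 3).card +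
      (Finset.univ.filter fun w => F.Adj v w ∧ ¬ F.degree w = 3).card = F.degree v := deg_split
  have hlow := low_nb hV hA
  have hsym : ∀ u v : V, decide (F.Adj u v) = decide (F.Adj v u) := fun u v => by
    rw [F.adj_comm]
  have hirr : ∀ u : V, decide (F.Adj u u) = false := fun u => by simp
  obtain ⟨σ, s, hs, hσ⟩ := shape_exists (fun i j => decide (F.Adj (eS i) (eS j)))
    (fun i j => hsym _ _) (fun i => hirr _)
    (fun i => by rw [cnt_low eS]; exact hlow _)
    (edge_count (fun i j => decide (F.Adj (eS i) (eS j)))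
      (fun i k => decide (F.Adj (eS i) (eH k))) (fun i j => hsym _ _) (fun i => hirr _)
      (fun i => by rw [cnt_low eS, cnt_high eH, hdeg]; exact (eS i).2)
      (fun k => by
        have := hlow (eH k)
        rw [← cnt_low eS] at this
        simp only [hsym (eH k)] at this
        exact this))
  obtain ⟨τ, t1, t2, t3, t4⟩ := four_label (fun i j => decide (F.Adj (eH i) (eH j)))
    (fun i j => hsym _ _) (fun i => hirr _) (fun i => by
      rw [cnt_high eH]
      have e1 := hdeg (eH i)
      have e2 := hlow (eH i)
      have e3 := h4 (eH i) (eH i).2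
      omega)
  let gS : Fin 6 ≃ {v : V // F.degree v = 3} := σ.trans eS
  let gH : Fin 4 ≃ {v : V // ¬ F.degree v = 3} := τ.trans eH
  let e : Fin 10 ≃ V := (finSumFinEquiv (m := 6) (n := 4)).symm.trans
    ((Equiv.sumCongr gS gH).trans (Equiv.sumCompl _))
  have ecast : ∀ i : Fin 6, e (Fin.castAdd 4 i) = gS i := fun i => by
    simp only [e, Equiv.trans_apply]
    erw [finSumFinEquiv_symm_apply_castAdd]
    rfl
  have enat : ∀ i : Fin 4, e (Fin.natAdd 6 i) = gH i := fun i => by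
    simp only [e, Equiv.trans_apply]
    erw [finSumFinEquiv_symm_apply_natAdd]
    rfl
  have e0 : e 0 = gS 0 := ecast 0
  have e1 : e 1 = gS 1 := ecast 1
  have e2 : e 2 = gS 2 := ecast 2
  have e3 : e 3 = gS 3 := ecast 3
  have e4 : e 4 = gS 4 := ecast 4
  have e5 : e 5 = gS 5 := ecast 5
  have e6 : e 6 = gH 0 := enat 0
  have e7 : e 7 = gH 1 := enat 1
  have e8 : e 8 = gH 2 := enat 2
  have e9 : e 9 = gH 3 := enat 3
  have elow : ∀ i : Fin 10, i.val < 6 → F.degree (e i) = 3 := by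
    intro i hi
    have := ecast ⟨i.val, hi⟩
    rw [show Fin.castAdd 4 (⟨i.val, hi⟩ : Fin 6) = i from rfl] at this
    rw [this]
    exact (gS _).2
  have ehigh : ∀ i : Fin 10, 6 ≤ i.val → F.degree (e i) = 4 := by
    intro i hi
    have := enat ⟨i.val - 6, by omega⟩
    rw [show Fin.natAdd 6 (⟨i.val - 6, by omega⟩ : Fin 4) = i from
      Fin.ext (by simp only [Fin.natAdd_mk]; omega)] at this
    rw [this]
    exact h4 _ (gH _).2
  have hgS : ∀ i j : Fin 6, decide (F.Adj (gS i) (gS j)) = tb s (6 * i.val + j.val) := hσ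
  have u1 : decide (F.Adj (gH 0) (gH 1)) = true := t1
  have u2 : decide (F.Adj (gH 1) (gH 2)) = true := t2
  have u3 : decide (F.Adj (gH 2) (gH 3)) = true := t3
  have u4 : decide (F.Adj (gH 0) (gH 3)) = true := t4
  clear_value e gS gH
  have hrow : ∀ v : V, cnt [decide (F.Adj v (e 0)), decide (F.Adj v (e 1)), decide (F.Adj v (e 2)),
      decide (F.Adj v (e 3)), decide (F.Adj v (e 4)), decide (F.Adj v (e 5)),
      decide (F.Adj v (e 6)), decide (F.Adj v (e 7)), decide (F.Adj v (e 8)),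
      decide (F.Adj v (e 9))] = F.degree v := by
    intro v
    rw [e0, e1, e2, e3, e4, e5, e6, e7, e8, e9, ← hdeg v, ← cnt_low gS, ← cnt_high gH, ← cnt_app]
    rfl
  obtain ⟨M, hM, hcon⟩ := final_check s hs (fun i j => decide (F.Adj (e i) (e j)))
    (fun i j => hsym _ _) (fun i => hirr _)
    (fun i j => by rw [ecast, ecast]; exact hgS i j)
    (fun i hi => (hrow (e i)).trans (elow i hi))
    (fun i hi => (hrow (e i)).trans (ehigh i hi))
    (fun i _ => by rw [e0, e1, e2, e3, e4, e5, cnt_low gS]; exact hlow _)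
    (by rw [e6, e7]; exact u1) (by rw [e7, e8]; exact u2) (by rw [e8, e9]; exact u3)
    (by rw [e6, e9]; exact u4)
  have hmat := allMs_matching M hM
  obtain ⟨f, hf, hadj⟩ := ham hA
    { Adj := fun u v => F.Adj u v ∧ tb M (10 * (e.symm u).val + (e.symm v).val) = false
      symm := ⟨fun u v h => ⟨h.1.symm, (hmat _ _).1.symm.trans h.2⟩⟩
      loopless := ⟨fun u h => h.1.ne rfl⟩ }
    (fun u v h => h.1)
    (fun u v w h1 h2 => e.symm.injective ((hmat _ _).2 _ h1.2 h2.2))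
  refine hcon (fun i => e.symm (f i)) (fun i j h => hf (e.symm.injective h)) fun i => ?_
  obtain ⟨g1, g2⟩ := hadj i
  refine ⟨by simpa using g1, ?_⟩
  by_contra hne
  exact g2 ⟨g1, by simpa using hne⟩

/-! ### The graph with 18 edges -/

def NF : Nat := 121507133779103951633738387612

def ex : SimpleGraph (Fin 10) where
  Adj u v := tb NF (10 * u.val + v.val) = true
  symm := ⟨by decide +kernel⟩
  loopless := ⟨by decide +kernel⟩

instance : DecidableRel ex.Adj := fun u v =>
  inferInstanceAs (Decidable (tb NF (10 * u.val + v.val) = true))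

def exE : List (Fin 10 × Fin 10) := [(0, 2), (0, 3), (0, 4), (0, 7), (1, 2), (1, 4), (1, 9), (2, 6), (2, 8), (3, 5), (3, 6), (3, 8), (4, 8), (5, 7), (5, 9), (6, 7), (6, 9), (7, 8)]

def exC : List (Nat × (Fin 10 → Fin 10)) := [
  (81878468520918958819417526292, ![0, 2, 1, 9, 6, 3, 5, 7, 8, 4]),
  (118856828358142463080130433168, ![0, 4, 1, 2, 8, 3, 5, 9, 6, 7]),
  (42119089045075767816751693836, ![0, 2, 6, 7, 5, 9, 1, 4, 8, 3]),
  (119002162590212165760370888728, ![0, 3, 6, 9, 5, 7, 8, 2, 1, 4]),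
  (42264350080194770106421100676, ![0, 2, 6, 3, 5, 9, 1, 4, 8, 7]),
  (81718589257254579740583936144, ![0, 4, 1, 9, 6, 2, 8, 3, 5, 7]),
  (42114216747933643817727037584, ![0, 4, 8, 2, 1, 9, 5, 3, 6, 7]),
  (118871297550830783518622109828, ![0, 2, 1, 4, 8, 3, 6, 9, 5, 7]),
  (119016707617195157172467552268, ![0, 2, 1, 4, 8, 7, 6, 9, 5, 3]),
  (81878468516307273832921055244, ![0, 2, 6, 9, 1, 4, 8, 7, 5, 3]),
  (42264386678670119202196033560, ![0, 3, 6, 2, 1, 9, 5, 7, 8, 4]),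
  (42254753189260258653450551316, ![0, 2, 6, 7, 8, 3, 5, 9, 1, 4]),
  (81728335184046147544226992152, ![0, 3, 5, 7, 6, 9, 1, 2, 8, 4]),
  (42249879568834464376412454936, ![0, 3, 6, 2, 8, 7, 5, 9, 1, 4]),
  (42114253346408994013012561944, ![0, 3, 6, 7, 5, 9, 1, 2, 8, 4]),
  (42119052446600416521955578000, ![0, 4, 8, 3, 5, 9, 1, 2, 6, 7]),
  (81718663777488951508679016468, ![0, 2, 8, 3, 5, 7, 6, 9, 1, 4]),
  (81728335184046148643737583628, ![0, 2, 8, 4, 1, 9, 6, 7, 5, 3]),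
  (81733170887324606334462595092, ![0, 2, 1, 9, 6, 7, 5, 3, 8, 4]),
  (81728260668423461862138974352, ![0, 4, 8, 2, 1, 9, 6, 3, 5, 7]),
  (118871335467978119005424603268, ![0, 2, 1, 4, 8, 3, 5, 9, 6, 7]),
  (119016669700047821685665058828, ![0, 2, 1, 4, 8, 7, 5, 9, 6, 3]),
  (42119014529453082134663676036, ![0, 2, 6, 3, 8, 4, 1, 9, 5, 7]),
  (119002200507359501247173382168, ![0, 3, 5, 9, 6, 7, 8, 2, 1, 4]),
  (118856790440995127593327939728, ![0, 4, 1, 2, 8, 3, 6, 9, 5, 7]),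
  (42264424595817455788509118476, ![0, 2, 6, 7, 8, 4, 1, 9, 5, 3]),
  (42104545336764761696171999376, ![0, 4, 1, 9, 5, 3, 8, 2, 6, 7])]

theorem ex_card : ex.edgeSet.ncard = 18 := by
  have h : ex.edgeSet = ((exE.map fun p => s(p.1, p.2)).toFinset : Set (Sym2 (Fin 10))) := by
    ext z
    induction z with
    | _ u v =>
      rw [SimpleGraph.mem_edgeSet, Finset.mem_coe, List.mem_toFinset]
      revert u v
      decide +kernel
  rw [h, Set.ncard_coe_finset]
  decide +kernel

theorem exE_spec : ∀ u v : Fin 10, ex.Adj u v → (u, v) ∈ exE ∨ (v, u) ∈ exE := by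
  decide +kernel

theorem exC_spec : ∀ p ∈ exC, (∀ i j : Fin 10, p.2 i = p.2 j → i = j) ∧
    ∀ i : Fin 10, ex.Adj (p.2 i) (p.2 (i+1)) ∧
      tb p.1 (10 * (p.2 i).val + (p.2 (i+1)).val) = true ∧
      tb p.1 (10 * (p.2 (i+1)).val + (p.2 i).val) = true := by
  decide +kernel

/-- the two edges form a path on three vertices -/
def confl (e f : Fin 10 × Fin 10) : Bool :=
  (Nat.beq e.1.val f.1.val && !Nat.beq e.2.val f.2.val) ||
  ((Nat.beq e.1.val f.2.val && !Nat.beq e.2.val f.1.val) ||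
  ((Nat.beq e.2.val f.1.val && !Nat.beq e.1.val f.2.val) ||
  (Nat.beq e.2.val f.2.val && !Nat.beq e.1.val f.1.val)))

def srch : List (Fin 10 × Fin 10) → List (Fin 10 × Fin 10) → Bool
  | [], ch => exC.any fun c => ch.all fun e => !tb c.1 (Nat.add (Nat.mul 10 e.1.val) e.2.val)
  | e :: t, ch => srch t ch && (ch.any (confl e) || srch t (e :: ch))

theorem srch_true : srch exE [] = true := by
  decide +kernel

theorem srch_sound (R : SimpleGraph (Fin 10)) (hR : ∀ u v w, R.Adj u v → R.Adj u w → v = w) :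
    ∀ (E ch : List (Fin 10 × Fin 10)), srch E ch = true → (∀ e ∈ ch, R.Adj e.1 e.2) →
    ∃ c ∈ exC, ∀ e, (e ∈ E ∨ e ∈ ch) → R.Adj e.1 e.2 →
      tb c.1 (10 * e.1.val + e.2.val) = false := by
  intro E
  induction E with
  | nil =>
    intro ch h _
    unfold srch at h
    rw [List.any_eq_true] at h
    obtain ⟨c, hc, h⟩ := h
    rw [List.all_eq_true] at h
    refine ⟨c, hc, fun e he _ => ?_⟩
    rcases he with he | he
    · exact absurd he List.not_mem_nil
    · simpa using h e he
  | cons e t ih =>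
    intro ch h hch
    unfold srch at h
    rw [Bool.and_eq_true, Bool.or_eq_true] at h
    by_cases he : R.Adj e.1 e.2
    · rcases h.2 with h2 | h2
      · exfalso
        rw [List.any_eq_true] at h2
        obtain ⟨f, hf, hc⟩ := h2
        have hf' := hch f hf
        simp only [confl, Bool.or_eq_true, Bool.and_eq_true, Nat.beq_eq, Bool.not_eq_true',
          ← Bool.not_eq_true, ← Fin.ext_iff] at hc
        rcases hc with ⟨h1, h2⟩ | ⟨h1, h2⟩ | ⟨h1, h2⟩ | ⟨h1, h2⟩
        · exact h2 (hR _ _ _ he (h1 ▸ hf'))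
        · exact h2 (hR _ _ _ he (h1 ▸ hf'.symm))
        · exact h2 (hR _ _ _ he.symm (h1 ▸ hf'))
        · exact h2 (hR _ _ _ he.symm (h1 ▸ hf'.symm))
      · obtain ⟨c, hc, hh⟩ := ih (e :: ch) h2 (by
          intro f hf
          rcases List.mem_cons.mp hf with rfl | hf
          · exact he
          · exact hch f hf)
        refine ⟨c, hc, fun f hf hRf => hh f ?_ hRf⟩
        simp only [List.mem_cons] at hf ⊢
        tauto
    · obtain ⟨c, hc, hh⟩ := ih ch h.1 hch
      refine ⟨c, hc, fun f hf hRf => hh f ?_ hRf⟩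
      rcases hf with hf | hf
      · rcases List.mem_cons.mp hf with rfl | hf
        · exact absurd hRf he
        · exact Or.inl hf
      · exact Or.inr hf

theorem upper : Arrows ex (pathGraph 3) (cycleGraph 10) := by
  intro R hRF
  by_cases hR : ∀ u v w, R.Adj u v → R.Adj u w → v = w
  · right
    obtain ⟨c, hc, h⟩ := srch_sound R hR exE [] srch_true (by simp)
    obtain ⟨hinj, hadj⟩ := exC_spec c hc
    have key : ∀ i, (ex \ R).Adj (c.2 i) (c.2 (i+1)) := by
      intro i
      rw [SimpleGraph.sdiff_adj]
      obtain ⟨h1, h2, h3⟩ := hadj i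
      refine ⟨h1, fun hr => ?_⟩
      rcases exE_spec _ _ h1 with hm | hm
      · have := h _ (Or.inl hm) hr
        rw [h2] at this
        exact Bool.noConfusion this
      · have := h _ (Or.inl hm) hr.symm
        rw [h3] at this
        exact Bool.noConfusion this
    refine ⟨⟨c.2, ?_⟩, hinj⟩
    intro a b hab
    rw [cycleGraph_adj] at hab
    rcases hab with hab | hab
    · have : a = b + 1 := by rw [← hab]; simp
      rw [this]
      exact (key b).symm
    · have : b = a + 1 := by rw [← hab]; simp
      rw [this]
      exact key a
  · left
    push Not at hR
    obtain ⟨u, v, w, h1, h2, hvw⟩ := hR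
    refine ⟨⟨![v, u, w], ?_⟩, ?_⟩
    · intro a b hab
      rw [pathGraph_adj] at hab
      fin_cases a <;> fin_cases b <;> simp at hab ⊢ <;>
        first | exact h1 | exact h2 | exact h1.symm | exact h2.symm
    · intro a b hab
      have := h1.ne
      have := h2.ne
      fin_cases a <;> fin_cases b <;> simp_all

end RP

theorem stmt_10 :
    (∃ F : SimpleGraph (Fin 10), F.edgeSet.ncard = 18 ∧
      Arrows F (pathGraph 3) (cycleGraph 10)) ∧
    (∀ (V : Type) [Fintype V] (F : SimpleGraph V), Fintype.card V = 10 →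
      F.edgeSet.ncard < 18 → ¬ Arrows F (pathGraph 3) (cycleGraph 10)) :=
  ⟨⟨RP.ex, RP.ex_card, RP.upper⟩, fun _ _ F hV hE hA => RP.lower F hV hE hA⟩
end
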